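/- Suppose β > 1/2 and the external field F₀ is constant. Then an irreducible degree-d GL solution exists if and only if α > 2π|d|. Moreover, if α > 2π|d|, then every degree-d field pair minimizing E over all degree-d field pairs is irreducible. -/

import Mathlib

open MeasureTheory Complex

noncomputable section

/-- Partial derivative in the first coordinate direction. -/
def pd1 {E : Type*} [NormedAddCommGroup E] [NormedSpace ℝ E]
    (f : ℝ × ℝ → E) (x : ℝ × ℝ) : E := fderiv ℝ f x (1, 0)

/-- Partial derivative in the second coordinate direction. -/
def pd2 {E : Type*} [NormedAddCommGroup E] [NormedSpace ℝ E]
    (f : ℝ × ℝ → E) (x : ℝ × ℝ) : E := fderiv ℝ f x (0, 1)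

/-- Covariant derivative `D₁φ = ∂₁φ + i a₁ φ`. -/
def D1 (a1 : ℝ × ℝ → ℝ) (φ : ℝ × ℝ → ℂ) : ℝ × ℝ → ℂ :=
  fun x => pd1 φ x + Complex.I * (a1 x : ℂ) * φ x

/-- Covariant derivative `D₂φ = ∂₂φ + i a₂ φ`. -/
def D2 (a2 : ℝ × ℝ → ℝ) (φ : ℝ × ℝ → ℂ) : ℝ × ℝ → ℂ :=
  fun x => pd2 φ x + Complex.I * (a2 x : ℂ) * φ x

/-- Curvature `F(a) = ∂₁a₂ − ∂₂a₁`. -/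
def curv (a1 a2 : ℝ × ℝ → ℝ) : ℝ × ℝ → ℝ :=
  fun x => pd1 a2 x - pd2 a1 x

/-- The fundamental domain `[0,1]²`. -/
def unitSquare : Set (ℝ × ℝ) := Set.Icc (0, 0) (1, 1)

/-- A degree-`d` field pair on the torus: smooth quasi-periodic `(a, φ)`. -/
structure FieldPair (d : ℤ) where
  a1 : ℝ × ℝ → ℝ
  a2 : ℝ × ℝ → ℝ
  φ : ℝ × ℝ → ℂ
  smooth_a1 : ContDiff ℝ (⊤ : ℕ∞) a1
  smooth_a2 : ContDiff ℝ (⊤ : ℕ∞) a2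
  smooth_φ : ContDiff ℝ (⊤ : ℕ∞) φ
  per1_a1 : ∀ x : ℝ × ℝ, a1 (x.1 + 1, x.2) = a1 x
  per1_a2 : ∀ x : ℝ × ℝ, a2 (x.1 + 1, x.2) = a2 x
  per1_φ : ∀ x : ℝ × ℝ, φ (x.1 + 1, x.2) = φ x
  per2_a2 : ∀ x : ℝ × ℝ, a2 (x.1, x.2 + 1) = a2 x
  per2_a1 : ∀ x : ℝ × ℝ, a1 (x.1, x.2 + 1) = a1 x - 2 * Real.pi * d
  per2_φ : ∀ x : ℝ × ℝ, φ (x.1, x.2 + 1) =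
      Complex.exp (2 * Real.pi * Complex.I * (d : ℂ) * (x.1 : ℂ)) * φ x

/-- The smooth ℤ²-periodic external field with `∫_{[0,1]²} F₀ = 2πd`. -/
def ExternalField (d : ℤ) (F₀ : ℝ × ℝ → ℝ) : Prop :=
  ContDiff ℝ (⊤ : ℕ∞) F₀ ∧ (∀ x : ℝ × ℝ, F₀ (x.1 + 1, x.2) = F₀ x) ∧
    (∀ x : ℝ × ℝ, F₀ (x.1, x.2 + 1) = F₀ x) ∧
    (∫ x in unitSquare, F₀ x) = 2 * Real.pi * d

/-- The Ginzburg–Landau free energy. -/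
def energy (α β : ℝ) (F₀ : ℝ × ℝ → ℝ) {d : ℤ} (P : FieldPair d) : ℝ :=
  (1 / 2) * ∫ x in unitSquare,
    ((curv P.a1 P.a2 x - F₀ x) ^ 2 + ‖D1 P.a1 P.φ x‖ ^ 2 + ‖D2 P.a2 P.φ x‖ ^ 2
      - α * ‖P.φ x‖ ^ 2 + (β / 2) * ‖P.φ x‖ ^ 4)

/-- The Ginzburg–Landau equations. -/
def IsGLSolution (α β : ℝ) (F₀ : ℝ × ℝ → ℝ) {d : ℤ} (P : FieldPair d) : Prop :=
  (∀ x : ℝ × ℝ,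
      pd2 (fun y => curv P.a1 P.a2 y - F₀ y) x
        + ((starRingEnd ℂ) (P.φ x) * D1 P.a1 P.φ x).im = 0) ∧
  (∀ x : ℝ × ℝ,
      -pd1 (fun y => curv P.a1 P.a2 y - F₀ y) x
        + ((starRingEnd ℂ) (P.φ x) * D2 P.a2 P.φ x).im = 0) ∧
  (∀ x : ℝ × ℝ,
      -(D1 P.a1 (D1 P.a1 P.φ) x + D2 P.a2 (D2 P.a2 P.φ) x)
        = (α : ℂ) * P.φ x - (β : ℂ) * (‖P.φ x‖ : ℂ) ^ 2 * P.φ x)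

/-- The set of energies of all degree-`d` field pairs. -/
def energySet (α β : ℝ) (F₀ : ℝ × ℝ → ℝ) (d : ℤ) : Set ℝ :=
  { t : ℝ | ∃ P : FieldPair d, t = energy α β F₀ P }

/-- `λ₁`, the lowest eigenvalue of the covariant Laplacian among connections
with curvature `F₀`. -/
def lambda1 (d : ℤ) (F₀ : ℝ × ℝ → ℝ) : ℝ :=
  sInf { t : ℝ | ∃ P : FieldPair d,
    (∀ x : ℝ × ℝ, curv P.a1 P.a2 x = F₀ x) ∧
    (∫ x in unitSquare, ‖P.φ x‖ ^ 2) = 1 ∧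
    t = ∫ x in unitSquare, (‖D1 P.a1 P.φ x‖ ^ 2 + ‖D2 P.a2 P.φ x‖ ^ 2) }

namespace GinzburgLandau

local notation "smoothOrder" => (((⊤ : ℕ∞)) : WithTop ℕ∞)

/-! ### Directional derivatives -/

/-- The coordinate directions of the plane. -/
def dir (j : Fin 2) : ℝ × ℝ := if j = 0 then (1, 0) else (0, 1)

/-- Partial derivative in the `j`-th coordinate direction. -/
def pd {E : Type*} [NormedAddCommGroup E] [NormedSpace ℝ E] (j : Fin 2)
    (f : ℝ × ℝ → E) : ℝ × ℝ → E := fun x => fderiv ℝ f x (dir j)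

section PartialDerivatives

variable {E F : Type*} [NormedAddCommGroup E] [NormedSpace ℝ E]
  [NormedAddCommGroup F] [NormedSpace ℝ F]

theorem pd1_eq (f : ℝ × ℝ → E) : pd1 f = pd 0 f := by
  funext x; simp [pd1, pd, dir]

theorem pd2_eq (f : ℝ × ℝ → E) : pd2 f = pd 1 f := by
  funext x; simp [pd2, pd, dir]

theorem fderiv_eq_pd (f : ℝ × ℝ → E) (x v : ℝ × ℝ) :
    fderiv ℝ f x v = v.1 • pd 0 f x + v.2 • pd 1 f x := by
  have : v = v.1 • dir 0 + v.2 • dir 1 := by ext <;> simp [dir]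
  conv_lhs => rw [this]
  rw [map_add, map_smul, map_smul]; rfl

theorem smooth_pd {f : ℝ × ℝ → E} (hf : ContDiff ℝ smoothOrder f) (j : Fin 2) :
    ContDiff ℝ smoothOrder (pd j f) :=
  (hf.fderiv_right (m := smoothOrder) (by simp)).clm_apply contDiff_const

theorem differentiable_of_smooth {f : ℝ × ℝ → E} (hf : ContDiff ℝ smoothOrder f) :
    Differentiable ℝ f := hf.differentiable (by simp)

theorem pd_add {f g : ℝ × ℝ → E} (hf : ContDiff ℝ smoothOrder f) (hg : ContDiff ℝ smoothOrder g)
    (j : Fin 2) (x : ℝ × ℝ) : pd j (fun y => f y + g y) x = pd j f x + pd j g x := by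
  simp only [pd]
  rw [fderiv_fun_add (differentiable_of_smooth hf x) (differentiable_of_smooth hg x)]; rfl

theorem pd_sub {f g : ℝ × ℝ → E} (hf : ContDiff ℝ smoothOrder f) (hg : ContDiff ℝ smoothOrder g)
    (j : Fin 2) (x : ℝ × ℝ) : pd j (fun y => f y - g y) x = pd j f x - pd j g x := by
  simp only [pd]
  rw [fderiv_fun_sub (differentiable_of_smooth hf x) (differentiable_of_smooth hg x)]; rfl

theorem pd_clm (L : E →L[ℝ] F) {f : ℝ × ℝ → E} (hf : ContDiff ℝ smoothOrder f)
    (j : Fin 2) (x : ℝ × ℝ) : pd j (fun y => L (f y)) x = L (pd j f x) := by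
  simp only [pd]
  have := (L.hasFDerivAt.comp x (differentiable_of_smooth hf x).hasFDerivAt).fderiv
  simp only [Function.comp_def] at this
  rw [this]; rfl

theorem pd_const (c : E) (j : Fin 2) (x : ℝ × ℝ) : pd j (fun _ => c) x = 0 := by
  simp [pd]

theorem pd_mul {R : Type*} [NormedCommRing R] [NormedAlgebra ℝ R] {f g : ℝ × ℝ → R}
    (hf : ContDiff ℝ smoothOrder f) (hg : ContDiff ℝ smoothOrder g)
    (j : Fin 2) (x : ℝ × ℝ) :
    pd j (fun y => f y * g y) x = pd j f x * g x + f x * pd j g x := by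
  simp only [pd]
  rw [fderiv_fun_mul (differentiable_of_smooth hf x) (differentiable_of_smooth hg x)]
  simp; ring

theorem pd_const_mul {R : Type*} [NormedCommRing R] [NormedAlgebra ℝ R] (c : R) {f : ℝ × ℝ → R}
    (hf : ContDiff ℝ smoothOrder f) (j : Fin 2) (x : ℝ × ℝ) :
    pd j (fun y => c * f y) x = c * pd j f x := by
  rw [pd_mul contDiff_const hf, pd_const]; ring

theorem pd_neg {f : ℝ × ℝ → E} (j : Fin 2) (x : ℝ × ℝ) :
    pd j (fun y => - f y) x = - pd j f x := by
  simp [pd, fderiv_fun_neg]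

theorem pd_conj {f : ℝ × ℝ → ℂ} (hf : ContDiff ℝ smoothOrder f) (j : Fin 2) (x : ℝ × ℝ) :
    pd j (fun y => (starRingEnd ℂ) (f y)) x = (starRingEnd ℂ) (pd j f x) :=
  pd_clm (conjCLE : ℂ →L[ℝ] ℂ) hf j x

theorem pd_re {f : ℝ × ℝ → ℂ} (hf : ContDiff ℝ smoothOrder f) (j : Fin 2) (x : ℝ × ℝ) :
    pd j (fun y => (f y).re) x = (pd j f x).re := pd_clm reCLM hf j x

theorem pd_im {f : ℝ × ℝ → ℂ} (hf : ContDiff ℝ smoothOrder f) (j : Fin 2) (x : ℝ × ℝ) :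
    pd j (fun y => (f y).im) x = (pd j f x).im := pd_clm imCLM hf j x

theorem pd_ofReal {f : ℝ × ℝ → ℝ} (hf : ContDiff ℝ smoothOrder f) (j : Fin 2) (x : ℝ × ℝ) :
    pd j (fun y => (f y : ℂ)) x = ((pd j f x : ℝ) : ℂ) := pd_clm ofRealCLM hf j x

theorem smooth_conj {f : ℝ × ℝ → ℂ} (hf : ContDiff ℝ smoothOrder f) :
    ContDiff ℝ smoothOrder (fun y => (starRingEnd ℂ) (f y)) :=
  (conjCLE : ℂ →L[ℝ] ℂ).contDiff.comp hf

theorem smooth_re {f : ℝ × ℝ → ℂ} (hf : ContDiff ℝ smoothOrder f) :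
    ContDiff ℝ smoothOrder (fun y => (f y).re) := reCLM.contDiff.comp hf

theorem smooth_im {f : ℝ × ℝ → ℂ} (hf : ContDiff ℝ smoothOrder f) :
    ContDiff ℝ smoothOrder (fun y => (f y).im) := imCLM.contDiff.comp hf

theorem smooth_ofReal {f : ℝ × ℝ → ℝ} (hf : ContDiff ℝ smoothOrder f) :
    ContDiff ℝ smoothOrder (fun y => (f y : ℂ)) := ofRealCLM.contDiff.comp hf

theorem pd_comm {f : ℝ × ℝ → E} (hf : ContDiff ℝ smoothOrder f) (i j : Fin 2) (x : ℝ × ℝ) :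
    pd i (pd j f) x = pd j (pd i f) x := by
  have h1 : ∀ k l : Fin 2, pd k (pd l f) x = fderiv ℝ (fderiv ℝ f) x (dir k) (dir l) := by
    intro k l
    have hd : DifferentiableAt ℝ (fderiv ℝ f) x :=
      (hf.fderiv_right (m := smoothOrder) (by simp)).differentiable (by simp) x
    change fderiv ℝ (fun y => fderiv ℝ f y (dir l)) x (dir k) = _
    rw [fderiv_clm_apply hd (differentiableAt_const _)]
    simp
  rw [h1, h1]
  have hs : IsSymmSndFDerivAt ℝ f x :=
    hf.contDiffAt.isSymmSndFDerivAt (by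
    rw [minSmoothness_of_isRCLikeNormedField]; 
    exact WithTop.coe_le_coe.2 (le_top : (2 : ℕ∞) ≤ ⊤))
  exact hs.eq _ _

/-- The restriction of a smooth function to a coordinate line has the partial derivative as
derivative. -/
theorem hasDerivAt_fst {f : ℝ × ℝ → E} (hf : ContDiff ℝ smoothOrder f) (s t : ℝ) :
    HasDerivAt (fun s => f (s, t)) (pd 0 f (s, t)) s := by
  have h := (differentiable_of_smooth hf (s, t)).hasFDerivAt
  have h2 : HasDerivAt (fun s : ℝ => (s, t)) ((1, 0) : ℝ × ℝ) s :=
    (hasDerivAt_id s).prodMk (hasDerivAt_const s t)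
  simpa [pd, dir, Function.comp_def] using h.comp_hasDerivAt s h2

theorem hasDerivAt_snd {f : ℝ × ℝ → E} (hf : ContDiff ℝ smoothOrder f) (s t : ℝ) :
    HasDerivAt (fun t => f (s, t)) (pd 1 f (s, t)) t := by
  have h := (differentiable_of_smooth hf (s, t)).hasFDerivAt
  have h2 : HasDerivAt (fun t : ℝ => (s, t)) ((0, 1) : ℝ × ℝ) t :=
    (hasDerivAt_const t s).prodMk (hasDerivAt_id t)
  simpa [pd, dir, Function.comp_def] using h.comp_hasDerivAt t h2

end PartialDerivatives

/-! ### Integration over the unit square -/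

/-- Integral over the fundamental domain. -/
def sqInt {E : Type*} [NormedAddCommGroup E] [NormedSpace ℝ E] (f : ℝ × ℝ → E) : E :=
  ∫ x in unitSquare, f x

theorem integrableOn_square {E : Type*} [NormedAddCommGroup E] {f : ℝ × ℝ → E}
    (hf : Continuous f) : IntegrableOn f unitSquare := hf.integrableOn_Icc

section SquareIntegral

variable {E : Type*} [NormedAddCommGroup E] [NormedSpace ℝ E]

theorem unitSquare_eq : unitSquare = Set.Icc (0 : ℝ) 1 ×ˢ Set.Icc (0 : ℝ) 1 := by
  rw [unitSquare, Set.Icc_prod_Icc]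

theorem volume_unitSquare : volume unitSquare = 1 := by
  rw [unitSquare_eq, Measure.volume_eq_prod, Measure.prod_prod]; simp

theorem isCompact_unitSquare : IsCompact unitSquare := isCompact_Icc

theorem sqInt_add {f g : ℝ × ℝ → E} (hf : Continuous f) (hg : Continuous g) :
    sqInt (fun x => f x + g x) = sqInt f + sqInt g :=
  integral_add (integrableOn_square hf) (integrableOn_square hg)

theorem sqInt_sub {f g : ℝ × ℝ → E} (hf : Continuous f) (hg : Continuous g) :
    sqInt (fun x => f x - g x) = sqInt f - sqInt g :=
  integral_sub (integrableOn_square hf) (integrableOn_square hg)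

theorem sqInt_neg (f : ℝ × ℝ → E) : sqInt (fun x => - f x) = - sqInt f := integral_neg f

theorem sqInt_const_mul {R : Type*} [RCLike R] (c : R) (f : ℝ × ℝ → R) :
    sqInt (fun x => c * f x) = c * sqInt f := integral_const_mul c f

theorem sqInt_const [CompleteSpace E] (c : E) : sqInt (fun _ => c) = c := by
  simp [sqInt, Measure.real, volume_unitSquare]

theorem sqInt_mono {f g : ℝ × ℝ → ℝ} (hf : Continuous f) (hg : Continuous g)
    (h : ∀ x, f x ≤ g x) : sqInt f ≤ sqInt g :=
  setIntegral_mono (integrableOn_square hf) (integrableOn_square hg) h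

theorem sqInt_nonneg {f : ℝ × ℝ → ℝ} (h : ∀ x, 0 ≤ f x) : 0 ≤ sqInt f :=
  integral_nonneg h

theorem norm_sqInt_le (f : ℝ × ℝ → E) : ‖sqInt f‖ ≤ sqInt (fun x => ‖f x‖) :=
  norm_integral_le_integral_norm f

theorem sqInt_clm {F : Type*} [NormedAddCommGroup F] [NormedSpace ℝ F] [CompleteSpace E]
    [CompleteSpace F] (L : E →L[ℝ] F) {f : ℝ × ℝ → E} (hf : Continuous f) :
    sqInt (fun x => L (f x)) = L (sqInt f) :=
  L.integral_comp_comm (integrableOn_square hf)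

theorem sqInt_re {f : ℝ × ℝ → ℂ} (hf : Continuous f) :
    sqInt (fun x => (f x).re) = (sqInt f).re := sqInt_clm reCLM hf

theorem sqInt_conj {f : ℝ × ℝ → ℂ} (hf : Continuous f) :
    sqInt (fun x => (starRingEnd ℂ) (f x)) = (starRingEnd ℂ) (sqInt f) :=
  sqInt_clm (conjCLE : ℂ →L[ℝ] ℂ) hf

theorem sqInt_ofReal {f : ℝ × ℝ → ℝ} (hf : Continuous f) :
    sqInt (fun x => (f x : ℂ)) = ((sqInt f : ℝ) : ℂ) := sqInt_clm ofRealCLM hf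

theorem sqInt_eq_iterated {f : ℝ × ℝ → E} (hf : Continuous f) :
    sqInt f = ∫ s in (0 : ℝ)..1, ∫ t in (0 : ℝ)..1, f (s, t) := by
  rw [sqInt, unitSquare_eq, Measure.volume_eq_prod, setIntegral_prod]
  · rw [intervalIntegral.integral_of_le zero_le_one, integral_Icc_eq_integral_Ioc]
    simp_rw [intervalIntegral.integral_of_le (zero_le_one (α := ℝ)), integral_Icc_eq_integral_Ioc]
  · rw [← Measure.volume_eq_prod, ← unitSquare_eq]; exact integrableOn_square hf

theorem sqInt_eq_iterated_symm {f : ℝ × ℝ → E} (hf : Continuous f) :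
    sqInt f = ∫ t in (0 : ℝ)..1, ∫ s in (0 : ℝ)..1, f (s, t) := by
  rw [sqInt_eq_iterated hf]
  refine intervalIntegral_intervalIntegral_swap (F := fun s t => f (s, t)) ?_
  refine (hf.integrableOn_Icc (a := ((0 : ℝ), (0 : ℝ))) (b := (1, 1))).mono_set ?_
  rw [← Set.Icc_prod_Icc, Set.uIoc_of_le zero_le_one]
  exact Set.prod_mono Set.Ioc_subset_Icc_self Set.Ioc_subset_Icc_self

/-- A continuous nonnegative function with vanishing integral vanishes on the square. -/
theorem eq_zero_of_sqInt_eq_zero {f : ℝ × ℝ → ℝ} (hf : Continuous f) (h0 : ∀ x, 0 ≤ f x)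
    (h : sqInt f = 0) : ∀ x ∈ unitSquare, f x = 0 := by
  have h1 : f =ᵐ[volume.restrict unitSquare] 0 :=
    (integral_eq_zero_iff_of_nonneg h0 (integrableOn_square hf)).1 h
  have h2 : f =ᵐ[volume.restrict (interior unitSquare)] 0 :=
    ae_mono (Measure.restrict_mono interior_subset le_rfl) h1
  have h3 := Measure.eqOn_open_of_ae_eq h2 isOpen_interior hf.continuousOn continuousOn_const
  have h4 : closure (interior unitSquare) = unitSquare := by
    rw [unitSquare_eq, interior_prod_eq, closure_prod_eq, interior_Icc,
      closure_Ioo zero_ne_one]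
  have h5 := h3.closure hf continuous_const
  rw [h4] at h5
  exact h5

/-- Cauchy–Schwarz on the unit square. -/
theorem sqInt_mul_sq_le {f g : ℝ × ℝ → ℝ} (hf : Continuous f) (hg : Continuous g) :
    (sqInt fun x => f x * g x) ^ 2 ≤ (sqInt fun x => f x ^ 2) * sqInt fun x => g x ^ 2 := by
  have key : ∀ r : ℝ, 0 ≤ (sqInt fun x => g x ^ 2) * (r * r)
      + (-2 * sqInt fun x => f x * g x) * r + sqInt fun x => f x ^ 2 := by
    intro r
    have h : 0 ≤ sqInt fun x => (f x - r * g x) ^ 2 := sqInt_nonneg fun x => sq_nonneg _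
    have e : (sqInt fun x => (f x - r * g x) ^ 2) = sqInt fun x =>
        (r * r) * g x ^ 2 + ((-2 * r) * (f x * g x) + f x ^ 2) := by
      congr 1; funext x; ring
    rw [e, sqInt_add (by fun_prop) (by fun_prop), sqInt_add (by fun_prop) (by fun_prop),
      sqInt_const_mul, sqInt_const_mul] at h
    linarith
  have := discrim_le_zero key
  rw [discrim] at this
  nlinarith

theorem sqInt_pd_fst_eq_zero [CompleteSpace E] {f : ℝ × ℝ → E} (hf : ContDiff ℝ smoothOrder f)
    (hp : ∀ t, f (1, t) = f (0, t)) : sqInt (pd 0 f) = 0 := by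
  rw [sqInt_eq_iterated_symm (smooth_pd hf 0).continuous]
  have : ∀ t : ℝ, ∫ s in (0 : ℝ)..1, pd 0 f (s, t) = 0 := by
    intro t
    rw [intervalIntegral.integral_eq_sub_of_hasDerivAt (fun s _ => hasDerivAt_fst hf s t), hp,
      sub_self]
    have := (smooth_pd hf 0).continuous
    exact Continuous.intervalIntegrable (by fun_prop) _ _
  simp [this]

theorem sqInt_pd_snd [CompleteSpace E] {f : ℝ × ℝ → E} (hf : ContDiff ℝ smoothOrder f) (c : E)
    (hp : ∀ s, f (s, 1) = f (s, 0) + c) : sqInt (pd 1 f) = c := by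
  rw [sqInt_eq_iterated (smooth_pd hf 1).continuous]
  have : ∀ s : ℝ, ∫ t in (0 : ℝ)..1, pd 1 f (s, t) = c := by
    intro s
    rw [intervalIntegral.integral_eq_sub_of_hasDerivAt (fun t _ => hasDerivAt_snd hf s t), hp,
      add_sub_cancel_left]
    have := (smooth_pd hf 1).continuous
    exact Continuous.intervalIntegrable (by fun_prop) _ _
  simp [this]

end SquareIntegral

/-! ### Sections and connections -/

/-- Smooth sections of the degree-`d` line bundle. -/
structure IsSec (d : ℤ) (u : ℝ × ℝ → ℂ) : Prop where
  smooth : ContDiff ℝ smoothOrder u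
  per1 : ∀ s t : ℝ, u (s + 1, t) = u (s, t)
  per2 : ∀ s t : ℝ, u (s, t + 1) = cexp (2 * Real.pi * Complex.I * (d : ℂ) * (s : ℂ)) * u (s, t)

/-- Smooth unitary connections on the degree-`d` line bundle. -/
structure IsConn (d : ℤ) (A : Fin 2 → ℝ × ℝ → ℝ) : Prop where
  smooth : ∀ j, ContDiff ℝ smoothOrder (A j)
  per1 : ∀ j, ∀ s t : ℝ, A j (s + 1, t) = A j (s, t)
  per2 : ∀ j, ∀ s t : ℝ, A j (s, t + 1) = A j (s, t) - 2 * Real.pi * d * (dir j).1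

/-- Covariant derivative in the `j`-th direction. -/
def cov (A : Fin 2 → ℝ × ℝ → ℝ) (j : Fin 2) (u : ℝ × ℝ → ℂ) : ℝ × ℝ → ℂ :=
  fun x => pd j u x + Complex.I * (A j x : ℂ) * u x

/-- The constant-curvature background connection. -/
def bg (d : ℤ) (j : Fin 2) (x : ℝ × ℝ) : ℝ := -(2 * Real.pi * d) * x.2 * (dir j).1

theorem isConn_bg (d : ℤ) : IsConn d (bg d) where
  smooth j := by unfold bg; fun_prop
  per1 j s t := by simp [bg]
  per2 j s t := by simp only [bg]; ring

theorem IsSec.continuous {d : ℤ} {u : ℝ × ℝ → ℂ} (hu : IsSec d u) : Continuous u :=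
  hu.smooth.continuous

theorem smooth_cov {A : Fin 2 → ℝ × ℝ → ℝ} (hA : ∀ j, ContDiff ℝ smoothOrder (A j))
    {u : ℝ × ℝ → ℂ} (hu : ContDiff ℝ smoothOrder u) (j : Fin 2) :
    ContDiff ℝ smoothOrder (cov A j u) :=
  (smooth_pd hu j).add ((contDiff_const.mul (smooth_ofReal (hA j))).mul hu)

theorem conj_twist (d : ℤ) (s : ℝ) :
    (starRingEnd ℂ) (cexp (2 * Real.pi * Complex.I * (d : ℂ) * (s : ℂ))) =
      cexp (2 * Real.pi * Complex.I * ((-d : ℤ) : ℂ) * (s : ℂ)) := by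
  rw [← exp_conj]; congr 1; simp [conj_ofNat]

theorem pd_translate {E : Type*} [NormedAddCommGroup E] [NormedSpace ℝ E] (f : ℝ × ℝ → E)
    (v : ℝ × ℝ) (j : Fin 2) (x : ℝ × ℝ) : pd j (fun y => f (y + v)) x = pd j f (x + v) := by
  simp only [pd, fderiv_comp_add_right]

theorem pd_twist (d : ℤ) (j : Fin 2) (x : ℝ × ℝ) :
    pd j (fun y : ℝ × ℝ => cexp (2 * Real.pi * Complex.I * (d : ℂ) * (y.1 : ℂ))) x =
      2 * Real.pi * Complex.I * (d : ℂ) * ((dir j).1 : ℂ) *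
        cexp (2 * Real.pi * Complex.I * (d : ℂ) * (x.1 : ℂ)) := by
  have h1 : HasFDerivAt (fun y : ℝ × ℝ => (y.1 : ℂ))
      (ofRealCLM.comp (ContinuousLinearMap.fst ℝ ℝ ℝ)) x :=
    (ofRealCLM.comp (ContinuousLinearMap.fst ℝ ℝ ℝ)).hasFDerivAt
  have h2 := (h1.const_mul (2 * Real.pi * Complex.I * (d : ℂ))).cexp
  simp only [pd]
  rw [h2.fderiv]
  simp; ring

theorem IsSec.cov {d : ℤ} {A : Fin 2 → ℝ × ℝ → ℝ} (hA : IsConn d A) {u : ℝ × ℝ → ℂ}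
    (hu : IsSec d u) (j : Fin 2) : IsSec d (cov A j u) where
  smooth := smooth_cov hA.smooth hu.smooth j
  per1 s t := by
    have h : (fun y : ℝ × ℝ => u (y + (1, 0))) = u := by
      funext ⟨a, b⟩; simp [hu.per1]
    have h2 := pd_translate u (1, 0) j (s, t)
    rw [h] at h2
    simp only [Prod.mk_add_mk, add_zero] at h2
    simp only [GinzburgLandau.cov, hA.per1, hu.per1, h2]
  per2 s t := by
    have h : (fun y : ℝ × ℝ => u (y + (0, 1))) =
        fun y => cexp (2 * Real.pi * Complex.I * (d : ℂ) * (y.1 : ℂ)) * u y := by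
      funext ⟨a, b⟩; simp [hu.per2]
    have h2 := pd_translate u (0, 1) j (s, t)
    have hs : ContDiff ℝ smoothOrder
        (fun y : ℝ × ℝ => cexp (2 * Real.pi * Complex.I * (d : ℂ) * (y.1 : ℂ))) :=
      (contDiff_const.mul (smooth_ofReal contDiff_fst)).cexp
    rw [h, pd_mul hs hu.smooth, pd_twist] at h2
    simp only [Prod.mk_add_mk, add_zero] at h2
    simp only [GinzburgLandau.cov, hA.per2, hu.per2, ← h2]
    push_cast
    ring

theorem IsSec.add {d : ℤ} {u v : ℝ × ℝ → ℂ} (hu : IsSec d u) (hv : IsSec d v) :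
    IsSec d (fun x => u x + v x) where
  smooth := hu.smooth.add hv.smooth
  per1 s t := by simp only [hu.per1, hv.per1]
  per2 s t := by simp only [hu.per2, hv.per2]; ring

theorem IsSec.const_mul {d : ℤ} {u : ℝ × ℝ → ℂ} (c : ℂ) (hu : IsSec d u) :
    IsSec d (fun x => c * u x) where
  smooth := contDiff_const.mul hu.smooth
  per1 s t := by simp only [hu.per1]
  per2 s t := by simp only [hu.per2]; ring

theorem IsSec.mul {d e f : ℤ} {u v : ℝ × ℝ → ℂ} (hu : IsSec d u) (hv : IsSec e v)
    (h : d + e = f) : IsSec f (fun x => u x * v x) where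
  smooth := hu.smooth.mul hv.smooth
  per1 s t := by simp only [hu.per1, hv.per1]
  per2 s t := by
    simp only [hu.per2, hv.per2, ← h]
    rw [show (2 * Real.pi * Complex.I * ((d + e : ℤ) : ℂ) * (s : ℂ)) =
      2 * Real.pi * Complex.I * (d : ℂ) * (s : ℂ) + 2 * Real.pi * Complex.I * (e : ℂ) * (s : ℂ) by
        push_cast; ring, exp_add]
    ring

theorem IsSec.conj {d e : ℤ} {u : ℝ × ℝ → ℂ} (hu : IsSec d u) (h : -d = e) :
    IsSec e (fun x => (starRingEnd ℂ) (u x)) where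
  smooth := smooth_conj hu.smooth
  per1 s t := by simp only [hu.per1]
  per2 s t := by simp only [hu.per2, map_mul, conj_twist, h]

theorem isSec_const (c : ℂ) : IsSec 0 (fun _ => c) where
  smooth := contDiff_const
  per1 s t := rfl
  per2 s t := by simp

theorem isSec_zero (d : ℤ) : IsSec d (fun _ => 0) where
  smooth := contDiff_const
  per1 s t := rfl
  per2 s t := by simp

theorem IsSec.periodic2 {u : ℝ × ℝ → ℂ} (hu : IsSec 0 u) (s t : ℝ) : u (s, t + 1) = u (s, t) := by
  simpa using hu.per2 s t

/-! ### Algebra of covariant derivatives -/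

theorem cov_add {A : Fin 2 → ℝ × ℝ → ℝ} {u v : ℝ × ℝ → ℂ} (hu : ContDiff ℝ smoothOrder u)
    (hv : ContDiff ℝ smoothOrder v) (j : Fin 2) (x : ℝ × ℝ) :
    cov A j (fun y => u y + v y) x = cov A j u x + cov A j v x := by
  simp only [cov, pd_add hu hv]; ring

theorem cov_const_mul {A : Fin 2 → ℝ × ℝ → ℝ} (c : ℂ) {u : ℝ × ℝ → ℂ}
    (hu : ContDiff ℝ smoothOrder u) (j : Fin 2) (x : ℝ × ℝ) :
    cov A j (fun y => c * u y) x = c * cov A j u x := by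
  simp only [cov, pd_const_mul c hu]; ring

theorem cov_bg_mul {d e f : ℤ} (h : d + e = f) {u v : ℝ × ℝ → ℂ}
    (hu : ContDiff ℝ smoothOrder u) (hv : ContDiff ℝ smoothOrder v) (j : Fin 2) (x : ℝ × ℝ) :
    cov (bg f) j (fun y => u y * v y) x = cov (bg d) j u x * v x + u x * cov (bg e) j v x := by
  simp only [cov, pd_mul hu hv, ← h, bg]; push_cast; ring

theorem cov_bg_conj {d e : ℤ} (h : -d = e) {u : ℝ × ℝ → ℂ}
    (hu : ContDiff ℝ smoothOrder u) (j : Fin 2) (x : ℝ × ℝ) :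
    cov (bg e) j (fun y => (starRingEnd ℂ) (u y)) x = (starRingEnd ℂ) (cov (bg d) j u x) := by
  simp only [cov, pd_conj hu, ← h, bg]; simp [conj_ofNat]

theorem pd_conj_mul (A : Fin 2 → ℝ × ℝ → ℝ) {u v : ℝ × ℝ → ℂ}
    (hu : ContDiff ℝ smoothOrder u) (hv : ContDiff ℝ smoothOrder v) (j : Fin 2) (x : ℝ × ℝ) :
    pd j (fun y => (starRingEnd ℂ) (u y) * v y) x =
      (starRingEnd ℂ) (cov A j u x) * v x + (starRingEnd ℂ) (u x) * cov A j v x := by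
  rw [pd_mul (smooth_conj hu) hv, pd_conj hu]
  simp only [cov, map_add, map_mul, conj_I, conj_ofReal]; ring

theorem cov_comm {A : Fin 2 → ℝ × ℝ → ℝ} (hA : ∀ j, ContDiff ℝ smoothOrder (A j))
    {u : ℝ × ℝ → ℂ} (hu : ContDiff ℝ smoothOrder u) (i j : Fin 2) (x : ℝ × ℝ) :
    cov A i (cov A j u) x = cov A j (cov A i u) x +
      Complex.I * ((pd i (A j) x - pd j (A i) x : ℝ) : ℂ) * u x := by
  have key : ∀ k l : Fin 2, pd k (cov A l u) x = pd k (pd l u) x +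
      Complex.I * ((pd k (A l) x : ℝ) : ℂ) * u x + Complex.I * (A l x : ℂ) * pd k u x := by
    intro k l
    have h1 : ContDiff ℝ smoothOrder (fun y => Complex.I * (A l y : ℂ)) :=
      contDiff_const.mul (smooth_ofReal (hA l))
    change pd k (fun y => pd l u y + Complex.I * (A l y : ℂ) * u y) x = _
    rw [pd_add (smooth_pd hu l) (h1.mul hu), pd_mul h1 hu, pd_const_mul _ (smooth_ofReal (hA l)),
      pd_ofReal (hA l)]
    ring
  have h1 : cov A i (cov A j u) x = pd i (cov A j u) x + Complex.I * (A i x : ℂ) * cov A j u x := rfl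
  have h2 : cov A j (cov A i u) x = pd j (cov A i u) x + Complex.I * (A j x : ℂ) * cov A i u x := rfl
  rw [h1, h2, key, key, pd_comm hu i j]
  simp only [cov]
  push_cast
  ring

theorem pd_bg (d : ℤ) (i j : Fin 2) (x : ℝ × ℝ) :
    pd i (bg d j) x = -(2 * Real.pi * d) * (dir j).1 * (dir i).2 := by
  have : HasFDerivAt (bg d j)
      ((-(2 * Real.pi * d) * (dir j).1) • ContinuousLinearMap.snd ℝ ℝ ℝ) x := by
    have h := (ContinuousLinearMap.snd ℝ ℝ ℝ).hasFDerivAt (x := x)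
    have h2 := h.const_smul (-(2 * Real.pi * d) * (dir j).1)
    refine h2.congr_of_eventuallyEq (Filter.Eventually.of_forall fun y => ?_)
    simp [bg]; ring
  simp only [pd, this.fderiv]
  simp

theorem sqInt_pd_eq_zero {w : ℝ × ℝ → ℂ} (hw : IsSec 0 w) (j : Fin 2) : sqInt (pd j w) = 0 := by
  fin_cases j
  · exact sqInt_pd_fst_eq_zero hw.smooth fun t => by simpa using hw.per1 0 t
  · exact sqInt_pd_snd hw.smooth 0 fun s => by simpa using hw.periodic2 s 0

/-- Integration by parts for covariant derivatives. -/
theorem sqInt_conj_mul_cov {d : ℤ} {A : Fin 2 → ℝ × ℝ → ℝ} (hA : IsConn d A) {u v : ℝ × ℝ → ℂ}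
    (hu : IsSec d u) (hv : IsSec d v) (j : Fin 2) :
    (sqInt fun x => (starRingEnd ℂ) (u x) * cov A j v x) =
      - sqInt fun x => (starRingEnd ℂ) (cov A j u x) * v x := by
  have h := sqInt_pd_eq_zero ((hu.conj rfl).mul hv (by ring : -d + d = 0)) j
  have e : pd j (fun y => (starRingEnd ℂ) (u y) * v y) = fun x =>
      (starRingEnd ℂ) (cov A j u x) * v x + (starRingEnd ℂ) (u x) * cov A j v x := by
    funext x; exact pd_conj_mul A hu.smooth hv.smooth j x
  have c1 := (hu.cov hA j).conj rfl |>.continuous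
  have c2 := (hv.cov hA j).continuous
  have c3 := (hu.conj rfl).continuous
  rw [e, sqInt_add (c1.fun_mul hv.continuous) (c3.fun_mul c2)] at h
  linear_combination h

/-! ### Doubly periodic real functions -/

/-- Smooth doubly periodic real functions. -/
structure IsPer (g : ℝ × ℝ → ℝ) : Prop where
  smooth : ContDiff ℝ smoothOrder g
  per1 : ∀ s t : ℝ, g (s + 1, t) = g (s, t)
  per2 : ∀ s t : ℝ, g (s, t + 1) = g (s, t)

namespace IsPer

variable {g h : ℝ × ℝ → ℝ}

theorem continuous (hg : IsPer g) : Continuous g := hg.smooth.continuous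

theorem add (hg : IsPer g) (hh : IsPer h) : IsPer (fun x => g x + h x) where
  smooth := hg.smooth.add hh.smooth
  per1 s t := by simp only [hg.per1, hh.per1]
  per2 s t := by simp only [hg.per2, hh.per2]

theorem sub (hg : IsPer g) (hh : IsPer h) : IsPer (fun x => g x - h x) where
  smooth := hg.smooth.sub hh.smooth
  per1 s t := by simp only [hg.per1, hh.per1]
  per2 s t := by simp only [hg.per2, hh.per2]

theorem mul (hg : IsPer g) (hh : IsPer h) : IsPer (fun x => g x * h x) where
  smooth := hg.smooth.mul hh.smooth
  per1 s t := by simp only [hg.per1, hh.per1]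
  per2 s t := by simp only [hg.per2, hh.per2]

theorem const_mul (hg : IsPer g) (c : ℝ) : IsPer (fun x => c * g x) where
  smooth := contDiff_const.mul hg.smooth
  per1 s t := by simp only [hg.per1]
  per2 s t := by simp only [hg.per2]

theorem comp {k : ℝ → ℝ} (hk : ContDiff ℝ smoothOrder k) (hg : IsPer g) :
    IsPer (fun x => k (g x)) where
  smooth := hk.comp hg.smooth
  per1 s t := by simp only [hg.per1]
  per2 s t := by simp only [hg.per2]

theorem ofReal (hg : IsPer g) : IsSec 0 (fun x => (g x : ℂ)) where
  smooth := smooth_ofReal hg.smooth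
  per1 s t := by simp only [hg.per1]
  per2 s t := by simp [hg.per2]

theorem sqInt_pd (hg : IsPer g) (j : Fin 2) : sqInt (GinzburgLandau.pd j g) = 0 := by
  fin_cases j
  · exact sqInt_pd_fst_eq_zero hg.smooth fun t => by simpa using hg.per1 0 t
  · exact sqInt_pd_snd hg.smooth 0 fun s => by simpa using hg.per2 s 0

theorem exists_mem_square (hg : IsPer g) (x : ℝ × ℝ) :
    ∃ y ∈ unitSquare, g y = g x := by
  refine ⟨(Int.fract x.1, Int.fract x.2), ?_, ?_⟩
  · rw [unitSquare_eq]
    exact ⟨⟨Int.fract_nonneg _, (Int.fract_lt_one _).le⟩,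
      ⟨Int.fract_nonneg _, (Int.fract_lt_one _).le⟩⟩
  · have h1 : ∀ t, Function.Periodic (fun s => g (s, t)) 1 := fun t s => hg.per1 s t
    have h2 : ∀ s, Function.Periodic (fun t => g (s, t)) 1 := fun s t => hg.per2 s t
    have e1 := (h1 (Int.fract x.2)).sub_int_mul_eq ⌊x.1⌋ (x := x.1)
    have e2 := (h2 x.1).sub_int_mul_eq ⌊x.2⌋ (x := x.2)
    simp only [mul_one] at e1 e2
    exact e1.trans e2

theorem eq_zero_of_sqInt (hg : IsPer g) (h0 : ∀ x, 0 ≤ g x) (h : sqInt g = 0) (x : ℝ × ℝ) :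
    g x = 0 := by
  obtain ⟨y, hy, e⟩ := hg.exists_mem_square x
  rw [← e]; exact eq_zero_of_sqInt_eq_zero hg.continuous h0 h y hy

theorem ofShift (hg : ContDiff ℝ smoothOrder g) (c₁ c₂ : ℝ) (h1 : ∀ s t, g (s + 1, t) = g (s, t) + c₁)
    (h2 : ∀ s t, g (s, t + 1) = g (s, t) + c₂) (j : Fin 2) : IsPer (GinzburgLandau.pd j g) where
  smooth := smooth_pd hg j
  per1 s t := by
    have h : (fun y : ℝ × ℝ => g (y + (1, 0))) = fun y => g y + c₁ := by
      funext ⟨a, b⟩; simp [h1]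
    have e := pd_translate g (1, 0) j (s, t)
    rw [h, pd_add hg contDiff_const, pd_const] at e
    simpa using e.symm
  per2 s t := by
    have h : (fun y : ℝ × ℝ => g (y + (0, 1))) = fun y => g y + c₂ := by
      funext ⟨a, b⟩; simp [h2]
    have e := pd_translate g (0, 1) j (s, t)
    rw [h, pd_add hg contDiff_const, pd_const] at e
    simpa using e.symm

theorem pd (hg : IsPer g) (j : Fin 2) : IsPer (GinzburgLandau.pd j g) :=
  ofShift hg.smooth 0 0 (by simpa using hg.per1) (by simpa using hg.per2) j

/-- Integration by parts for doubly periodic functions. -/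
theorem sqInt_mul_pd (hg : IsPer g) (hh : IsPer h) (j : Fin 2) :
    (sqInt fun x => g x * GinzburgLandau.pd j h x) =
      - sqInt fun x => GinzburgLandau.pd j g x * h x := by
  have e := (hg.mul hh).sqInt_pd j
  have e2 : GinzburgLandau.pd j (fun x => g x * h x) = fun x =>
      GinzburgLandau.pd j g x * h x + g x * GinzburgLandau.pd j h x := by
    funext x; exact pd_mul hg.smooth hh.smooth j x
  rw [e2, sqInt_add ((hg.pd j).mul hh).continuous (hg.mul (hh.pd j)).continuous] at e
  linarith

end IsPer

theorem isPer_const (c : ℝ) : IsPer (fun _ => c) := ⟨contDiff_const, fun _ _ => rfl, fun _ _ => rfl⟩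

theorem IsSec.re {u : ℝ × ℝ → ℂ} (hu : IsSec 0 u) : IsPer (fun x => (u x).re) where
  smooth := smooth_re hu.smooth
  per1 s t := by simp only [hu.per1]
  per2 s t := by simp only [hu.periodic2]

theorem IsSec.im {u : ℝ × ℝ → ℂ} (hu : IsSec 0 u) : IsPer (fun x => (u x).im) where
  smooth := smooth_im hu.smooth
  per1 s t := by simp only [hu.per1]
  per2 s t := by simp only [hu.periodic2]

theorem IsSec.pairing {d : ℤ} {u v : ℝ × ℝ → ℂ} (hu : IsSec d u) (hv : IsSec d v) :
    IsSec 0 (fun x => (starRingEnd ℂ) (u x) * v x) :=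
  (hu.conj rfl).mul hv (by ring)

theorem conj_mul_self_re (z : ℂ) : ((starRingEnd ℂ) z * z).re = ‖z‖ ^ 2 := by
  rw [← normSq_eq_conj_mul_self, ofReal_re, normSq_eq_norm_sq]

theorem IsSec.norm_sq {d : ℤ} {u : ℝ × ℝ → ℂ} (hu : IsSec d u) : IsPer (fun x => ‖u x‖ ^ 2) := by
  have := (hu.pairing hu).re
  simpa only [conj_mul_self_re] using this

/-- Curvature of a connection. -/
def curvature (A : Fin 2 → ℝ × ℝ → ℝ) (x : ℝ × ℝ) : ℝ := pd 0 (A 1) x - pd 1 (A 0) x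

theorem IsConn.isPer_pd {d : ℤ} {A : Fin 2 → ℝ × ℝ → ℝ} (hA : IsConn d A) (i j : Fin 2) :
    IsPer (pd i (A j)) :=
  IsPer.ofShift (hA.smooth j) 0 (-(2 * Real.pi * d * (dir j).1)) (by simpa using hA.per1 j)
    (fun s t => by rw [hA.per2]; ring) i

theorem IsConn.isPer_curvature {d : ℤ} {A : Fin 2 → ℝ × ℝ → ℝ} (hA : IsConn d A) :
    IsPer (curvature A) := (hA.isPer_pd 0 1).sub (hA.isPer_pd 1 0)

/-- The total curvature is `2πd`. -/
theorem IsConn.sqInt_curvature {d : ℤ} {A : Fin 2 → ℝ × ℝ → ℝ} (hA : IsConn d A) :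
    sqInt (curvature A) = 2 * Real.pi * d := by
  have h1 : sqInt (pd 0 (A 1)) = 0 :=
    sqInt_pd_fst_eq_zero (hA.smooth 1) fun t => by simpa using hA.per1 1 0 t
  have h2 : sqInt (pd 1 (A 0)) = -(2 * Real.pi * d) :=
    sqInt_pd_snd (hA.smooth 0) _ fun s => by
      have := hA.per2 0 s 0
      simp [dir] at this; rw [this]; ring
  change sqInt (fun x => pd 0 (A 1) x - pd 1 (A 0) x) = _
  rw [sqInt_sub (hA.isPer_pd 0 1).continuous (hA.isPer_pd 1 0).continuous, h1, h2]; ring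

/-! ### The supercurrent -/

/-- The supercurrent `Im(φ̄ D_jφ)`. -/
def current (A : Fin 2 → ℝ × ℝ → ℝ) (φ : ℝ × ℝ → ℂ) (j : Fin 2) (x : ℝ × ℝ) : ℝ :=
  ((starRingEnd ℂ) (φ x) * cov A j φ x).im

section Current

variable {d : ℤ} {A : Fin 2 → ℝ × ℝ → ℝ} {φ : ℝ × ℝ → ℂ}

theorem isPer_current (hA : IsConn d A) (hφ : IsSec d φ) (j : Fin 2) : IsPer (current A φ j) :=
  (hφ.pairing (hφ.cov hA j)).im

theorem pd_current (hA : IsConn d A) (hφ : IsSec d φ) (i j : Fin 2) (x : ℝ × ℝ) :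
    pd i (current A φ j) x = ((starRingEnd ℂ) (cov A i φ x) * cov A j φ x).im +
      ((starRingEnd ℂ) (φ x) * cov A i (cov A j φ) x).im := by
  have h := (hφ.cov hA j)
  change pd i (fun y => ((starRingEnd ℂ) (φ y) * cov A j φ y).im) x = _
  rw [pd_im (hφ.pairing h).smooth, pd_conj_mul A hφ.smooth h.smooth, add_im]

theorem pd_norm_sq (A : Fin 2 → ℝ × ℝ → ℝ) {u : ℝ × ℝ → ℂ} (hu : IsSec d u) (i : Fin 2) (x : ℝ × ℝ) :
    pd i (fun y => ‖u y‖ ^ 2) x = 2 * ((starRingEnd ℂ) (u x) * cov A i u x).re := by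
  have e : (fun y => ‖u y‖ ^ 2) = fun y => ((starRingEnd ℂ) (u y) * u y).re := by
    funext y; rw [conj_mul_self_re]
  rw [e, pd_re (hu.pairing hu).smooth, pd_conj_mul A hu.smooth hu.smooth]
  simp; ring

theorem pd_pd_norm_sq (hA : IsConn d A) (hφ : IsSec d φ) (i : Fin 2) (x : ℝ × ℝ) :
    pd i (pd i (fun y => ‖φ y‖ ^ 2)) x = 2 * (‖cov A i φ x‖ ^ 2 +
      ((starRingEnd ℂ) (φ x) * cov A i (cov A i φ) x).re) := by
  have e : pd i (fun y => ‖φ y‖ ^ 2) = fun y => 2 * ((starRingEnd ℂ) (φ y) * cov A i φ y).re := by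
    funext y; exact pd_norm_sq A hφ i y
  have h := hφ.cov hA i
  rw [e, pd_const_mul _ (smooth_re (hφ.pairing h).smooth), pd_re (hφ.pairing h).smooth,
    pd_conj_mul A hφ.smooth h.smooth, add_re, conj_mul_self_re]

end Current

/-! ### Non-existence below the critical value -/

section Nonexistence

variable {d : ℤ} {A : Fin 2 → ℝ × ℝ → ℝ} {φ : ℝ × ℝ → ℂ} {α β : ℝ}

/-- A periodic subsolution `w·u ≤ Δu` with `w ≥ 0` not identically zero is nonpositive. -/
theorem nonpos_of_subsolution {u w : ℝ × ℝ → ℝ} (hu : IsPer u) (hw : IsPer w)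
    (hw0 : ∀ x, 0 ≤ w x) (hne : ∃ x, w x ≠ 0)
    (hsub : ∀ x, w x * u x ≤ pd 0 (pd 0 u) x + pd 1 (pd 1 u) x) (x : ℝ × ℝ) : u x ≤ 0 := by
  by_contra! hx
  have hsg : ContDiff ℝ smoothOrder expNegInvGlue := expNegInvGlue.contDiff
  have hG := hu.comp hsg
  have hG0 : ∀ y, 0 ≤ expNegInvGlue (u y) := fun y => expNegInvGlue.nonneg _
  have hd0 : ∀ r, 0 ≤ deriv expNegInvGlue r := fun r => expNegInvGlue.monotone.deriv_nonneg
  have hpd : ∀ j y, pd j (fun z => expNegInvGlue (u z)) y =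
      deriv expNegInvGlue (u y) * pd j u y := by
    intro j y
    have h1 : HasDerivAt expNegInvGlue (deriv expNegInvGlue (u y)) (u y) :=
      (hsg.differentiable (by simp) _).hasDerivAt
    have h2 := h1.comp_hasFDerivAt y (differentiable_of_smooth hu.smooth y).hasFDerivAt
    simp only [pd]
    have h3 := h2.fderiv
    simp only [Function.comp_def] at h3
    rw [h3]; rfl
  have hb : ∀ j, (sqInt fun y => expNegInvGlue (u y) * pd j (pd j u) y) =
      - sqInt fun y => pd j (fun z => expNegInvGlue (u z)) y * pd j u y := fun j =>
    hG.sqInt_mul_pd (hu.pd j) j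
  have cG := hG.continuous
  have c1 := fun j => (hG.mul ((hu.pd j).pd j)).continuous
  have hlo : (0 : ℝ) ≤ sqInt fun y => expNegInvGlue (u y) * (w y * u y) := by
    refine sqInt_nonneg fun y => ?_
    rcases le_or_gt (u y) 0 with h | h
    · rw [expNegInvGlue.zero_of_nonpos h, zero_mul]
    · exact mul_nonneg (hG0 y) (mul_nonneg (hw0 y) h.le)
  have hle : (sqInt fun y => expNegInvGlue (u y) * (w y * u y)) ≤
      (sqInt fun y => expNegInvGlue (u y) * pd 0 (pd 0 u) y) +
        sqInt fun y => expNegInvGlue (u y) * pd 1 (pd 1 u) y := by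
    rw [← sqInt_add (c1 0) (c1 1)]
    refine sqInt_mono (hG.mul (hw.mul hu)).continuous ((c1 0).add (c1 1)) fun y => ?_
    have := mul_le_mul_of_nonneg_left (hsub y) (hG0 y)
    linarith
  have hgr : ∀ j y, 0 ≤ pd j (fun z => expNegInvGlue (u z)) y * pd j u y := by
    intro j y
    rw [hpd, mul_assoc]
    exact mul_nonneg (hd0 _) (mul_self_nonneg _)
  have hgi : ∀ j, 0 ≤ sqInt fun y => pd j (fun z => expNegInvGlue (u z)) y * pd j u y :=
    fun j => sqInt_nonneg (hgr j)
  have h0 := hgi 0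
  have h1 := hgi 1
  rw [hb, hb] at hle
  have z : ∀ j, (sqInt fun y => pd j (fun z => expNegInvGlue (u z)) y * pd j u y) = 0 := by
    intro j; fin_cases j
    · simp only [Fin.zero_eta]; linarith
    · simp only [Fin.mk_one]; linarith
  have hz : ∀ j y, pd j (fun z => expNegInvGlue (u z)) y = 0 := by
    intro j y
    have e := ((hG.pd j).mul (hu.pd j)).eq_zero_of_sqInt (hgr j) (z j) y
    rw [hpd] at e ⊢
    rcases mul_eq_zero.1 e with h | h
    · exact h
    · rw [h, mul_zero]
  have hconst : ∀ y, expNegInvGlue (u y) = expNegInvGlue (u x) := by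
    intro y
    refine is_const_of_fderiv_eq_zero (𝕜 := ℝ) (differentiable_of_smooth hG.smooth) ?_ y x
    intro y; ext <;> simp [fderiv_eq_pd, hz]
  have hpos : ∀ y, 0 < u y := by
    intro y
    by_contra! h
    have := hconst y
    rw [expNegInvGlue.zero_of_nonpos h] at this
    exact (expNegInvGlue.pos_of_pos hx).ne this
  have hw2 : (sqInt fun y => expNegInvGlue (u y) * (w y * u y)) = 0 := by
    have := z 0
    have := z 1
    linarith
  obtain ⟨y, hy⟩ := hne
  have e := (hG.mul (hw.mul hu)).eq_zero_of_sqInt (fun y =>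
    mul_nonneg (hG0 y) (mul_nonneg (hw0 y) (hpos y).le)) hw2 y
  have := expNegInvGlue.pos_of_pos (hpos y)
  have := hpos y
  simp only [mul_eq_zero] at e
  rcases e with h | h | h
  · linarith
  · exact hy h
  · linarith

theorem critical_lt_of_solution (hβ : 1 / 2 ≤ β) (hA : IsConn d A) (hφ : IsSec d φ)
    (h1 : ∀ x, pd 1 (curvature A) x + current A φ 0 x = 0)
    (h2 : ∀ x, -pd 0 (curvature A) x + current A φ 1 x = 0)
    (h3 : ∀ x, -(cov A 0 (cov A 0 φ) x + cov A 1 (cov A 1 φ) x) =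
      (α : ℂ) * φ x - (β : ℂ) * (‖φ x‖ : ℂ) ^ 2 * φ x)
    (hne : ∃ x, φ x ≠ 0) : 2 * Real.pi * |(d : ℝ)| < α := by
  by_contra! hα
  obtain ⟨ε, hε, hεd⟩ : ∃ ε : ℝ, ε ^ 2 = 1 ∧ ε * d = |(d : ℝ)| := by
    rcases le_total 0 (d : ℝ) with h | h
    · exact ⟨1, by norm_num, by rw [abs_of_nonneg h, one_mul]⟩
    · exact ⟨-1, by norm_num, by rw [abs_of_nonpos h]; ring⟩
  have hw := hφ.norm_sq
  have hf := hA.isPer_curvature.sub (isPer_const (2 * Real.pi * d))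
  have hu := (hw.const_mul (1 / 2)).add (hf.const_mul ε)
  set w : ℝ × ℝ → ℝ := fun x => ‖φ x‖ ^ 2 with hwdef
  set u : ℝ × ℝ → ℝ := fun x => 1 / 2 * w x + ε * (curvature A x - 2 * Real.pi * d) with hudef
  have hF := hA.isPer_curvature
  have hpu : ∀ j, pd j u = fun x => 1 / 2 * pd j w x + ε * pd j (curvature A) x := by
    intro j; funext x
    rw [hudef, pd_add (hw.const_mul _).smooth (hf.const_mul _).smooth, pd_const_mul _ hw.smooth,
      pd_const_mul _ hf.smooth, pd_sub hF.smooth contDiff_const, pd_const, sub_zero]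
  have hppu : ∀ j x, pd j (pd j u) x = 1 / 2 * pd j (pd j w) x + ε * pd j (pd j (curvature A)) x := by
    intro j x
    rw [hpu, pd_add ((hw.pd j).const_mul _).smooth ((hF.pd j).const_mul _).smooth,
      pd_const_mul _ (hw.pd j).smooth, pd_const_mul _ (hF.pd j).smooth]
  have e1 : pd 1 (curvature A) = fun x => - current A φ 0 x := by
    funext x; linarith [h1 x]
  have e2 : pd 0 (curvature A) = current A φ 1 := by
    funext x; linarith [h2 x]
  have hsub : ∀ x, w x * u x ≤ pd 0 (pd 0 u) x + pd 1 (pd 1 u) x := by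
    intro x
    rw [hppu, hppu, e1, e2, pd_neg, pd_current hA hφ, pd_current hA hφ, pd_pd_norm_sq hA hφ,
      pd_pd_norm_sq hA hφ, cov_comm hA.smooth hφ.smooth 0 1]
    have h3' : cov A 0 (cov A 0 φ) x = -(cov A 1 (cov A 1 φ) x) -
        ((α : ℂ) * φ x - (β : ℂ) * (‖φ x‖ : ℂ) ^ 2 * φ x) := by
      rw [← h3 x]; ring
    rw [h3']
    have hwx : w x = (φ x).re ^ 2 + (φ x).im ^ 2 := by
      rw [hwdef]; simp only [← normSq_eq_norm_sq, normSq_apply]; ring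
    have hn : (‖φ x‖ : ℂ) ^ 2 = ((w x : ℝ) : ℂ) := by rw [hwdef]; push_cast; rfl
    have hF' : pd 0 (A 1) x - pd 1 (A 0) x = curvature A x := rfl
    have hux : u x = 1 / 2 * w x + ε * (curvature A x - 2 * Real.pi * d) := rfl
    rw [hn, hF', ← normSq_eq_norm_sq, ← normSq_eq_norm_sq, normSq_apply, normSq_apply]
    generalize cov A 0 φ x = p
    generalize cov A 1 φ x = q
    generalize cov A 1 (cov A 1 φ) x = r
    generalize cov A 1 (cov A 0 φ) x = r'
    have hwn : 0 ≤ w x := sq_nonneg ‖φ x‖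
    simp only [add_re, add_im, mul_re, mul_im, sub_re, sub_im, neg_re, neg_im, conj_re, conj_im,
      ofReal_re, ofReal_im, I_re, I_im]
    have k1 : 0 ≤ (p.re - ε * -q.im) ^ 2 + (p.im - ε * q.re) ^ 2 := by positivity
    have k2 : 0 ≤ w x * (2 * Real.pi * |(d : ℝ)| - α) := mul_nonneg hwn (by linarith)
    have k3 : 0 ≤ w x * ((β - 1 / 2) * w x) :=
      mul_nonneg hwn (mul_nonneg (by linarith) hwn)
    rw [hux]
    rw [← hεd] at k2
    rw [hwx] at k2 k3 ⊢
    linear_combination k1 + k2 + k3 + (q.re ^ 2 + q.im ^ 2) * hε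
  have hne' : ∃ x, w x ≠ 0 := by
    obtain ⟨x, hx⟩ := hne
    exact ⟨x, by simpa [hwdef] using hx⟩
  have hw0 : ∀ x, 0 ≤ w x := fun x => sq_nonneg _
  have hneg := nonpos_of_subsolution hu hw hw0 hne' hsub
  have hint : sqInt u = 1 / 2 * sqInt w := by
    rw [hudef, sqInt_add (hw.const_mul _).continuous (hf.const_mul _).continuous, sqInt_const_mul,
      sqInt_const_mul, sqInt_sub hF.continuous continuous_const, hA.sqInt_curvature, sqInt_const]
    ring
  have hle : sqInt u ≤ sqInt (fun _ : ℝ × ℝ => (0 : ℝ)) :=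
    sqInt_mono hu.continuous continuous_const hneg
  rw [sqInt_const, hint] at hle
  have hzero : sqInt w = 0 := le_antisymm (by linarith) (sqInt_nonneg hw0)
  obtain ⟨x, hx⟩ := hne'
  exact hx (hw.eq_zero_of_sqInt hw0 hzero x)

end Nonexistence

/-! ### Sobolev-type inequalities on the unit square -/

section Sobolev

variable {E : Type*} [NormedAddCommGroup E] [NormedSpace ℝ E]

theorem continuous_integral_fst {f : ℝ × ℝ → E} (hf : Continuous f) :
    Continuous fun t => ∫ s in (0 : ℝ)..1, f (s, t) :=
  intervalIntegral.continuous_parametric_intervalIntegral_of_continuous' (f := fun t s => f (s, t))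
    (by fun_prop) 0 1

theorem continuous_integral_snd {f : ℝ × ℝ → E} (hf : Continuous f) :
    Continuous fun s => ∫ t in (0 : ℝ)..1, f (s, t) :=
  intervalIntegral.continuous_parametric_intervalIntegral_of_continuous' (f := fun s t => f (s, t))
    (by fun_prop) 0 1

variable [CompleteSpace E]

theorem norm_sub_le_integral_deriv {f f' : ℝ → E} (hf : ∀ s, HasDerivAt f (f' s) s)
    (hc : Continuous f') {s r : ℝ} (hs : s ∈ Set.Icc (0 : ℝ) 1) (hr : r ∈ Set.Icc (0 : ℝ) 1) :
    ‖f s - f r‖ ≤ ∫ t in (0 : ℝ)..1, ‖f' t‖ := by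
  rw [← intervalIntegral.integral_eq_sub_of_hasDerivAt (fun t _ => hf t)
    (hc.intervalIntegrable r s)]
  refine (intervalIntegral.norm_integral_le_integral_norm_uIoc).trans ?_
  rw [intervalIntegral.integral_of_le zero_le_one]
  refine setIntegral_mono_set ?_ (Filter.Eventually.of_forall fun t => norm_nonneg _) ?_
  · exact (hc.norm.intervalIntegrable 0 1).1
  · refine LE.le.eventuallyLE ?_
    exact Set.Ioc_subset_Ioc (le_min hr.1 hs.1) (max_le hr.2 hs.2)

theorem norm_le_integral_add_deriv {f f' : ℝ → E} (hf : ∀ s, HasDerivAt f (f' s) s)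
    (hc : Continuous f') {s : ℝ} (hs : s ∈ Set.Icc (0 : ℝ) 1) :
    ‖f s‖ ≤ ∫ t in (0 : ℝ)..1, (‖f t‖ + ‖f' t‖) := by
  have hfc : Continuous f := continuous_iff_continuousAt.2 fun s => (hf s).continuousAt
  rw [intervalIntegral.integral_add (hfc.norm.intervalIntegrable _ _)
    (hc.norm.intervalIntegrable _ _)]
  have h : ∫ _ in (0 : ℝ)..1, ‖f s‖ ≤
      ∫ t in (0 : ℝ)..1, (‖f t‖ + ∫ r in (0 : ℝ)..1, ‖f' r‖) := by
    refine intervalIntegral.integral_mono_on zero_le_one (by simp)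
      ((hfc.norm.add continuous_const).intervalIntegrable _ _) fun t ht => ?_
    have := norm_sub_le_integral_deriv hf hc hs ht
    have := norm_sub_norm_le (f s) (f t)
    linarith
  rw [intervalIntegral.integral_add (hfc.norm.intervalIntegrable _ _) (by simp)] at h
  simpa using h

variable {g : ℝ × ℝ → E}

theorem norm_le_integral_fst (hg : ContDiff ℝ smoothOrder g) {s : ℝ} (hs : s ∈ Set.Icc (0 : ℝ) 1)
    (t : ℝ) : ‖g (s, t)‖ ≤ ∫ r in (0 : ℝ)..1, (‖g (r, t)‖ + ‖pd 0 g (r, t)‖) := by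
  have c := (smooth_pd hg 0).continuous
  exact norm_le_integral_add_deriv (f := fun r => g (r, t)) (fun r => hasDerivAt_fst hg r t)
    (by fun_prop) hs

theorem norm_le_integral_snd (hg : ContDiff ℝ smoothOrder g) (s : ℝ) {t : ℝ}
    (ht : t ∈ Set.Icc (0 : ℝ) 1) :
    ‖g (s, t)‖ ≤ ∫ r in (0 : ℝ)..1, (‖g (s, r)‖ + ‖pd 1 g (s, r)‖) := by
  have c := (smooth_pd hg 1).continuous
  exact norm_le_integral_add_deriv (f := fun r => g (s, r)) (fun r => hasDerivAt_snd hg s r)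
    (by fun_prop) ht

/-- Pointwise bound by the mixed first and second derivatives in `L¹`. -/
theorem norm_le_sqInt (hg : ContDiff ℝ smoothOrder g) {x : ℝ × ℝ} (hx : x ∈ unitSquare) :
    ‖g x‖ ≤ sqInt fun y => (‖g y‖ + ‖pd 1 g y‖) + (‖pd 0 g y‖ + ‖pd 1 (pd 0 g) y‖) := by
  rw [unitSquare_eq] at hx
  have h0 := smooth_pd hg 0
  have c := hg.continuous
  have c0 := h0.continuous
  have c1 := (smooth_pd hg 1).continuous
  have c2 := (smooth_pd h0 1).continuous
  rw [sqInt_eq_iterated (by fun_prop)]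
  refine (norm_le_integral_fst hg hx.1 x.2).trans ?_
  refine intervalIntegral.integral_mono_on zero_le_one
    (Continuous.intervalIntegrable (by fun_prop) _ _)
    (Continuous.intervalIntegrable (continuous_integral_snd
      (f := fun y => (‖g y‖ + ‖pd 1 g y‖) + (‖pd 0 g y‖ + ‖pd 1 (pd 0 g) y‖)) (by fun_prop)) _ _) fun r _ => ?_
  rw [intervalIntegral.integral_add (Continuous.intervalIntegrable (by fun_prop) _ _)
    (Continuous.intervalIntegrable (by fun_prop) _ _)]
  exact add_le_add (norm_le_integral_snd hg r hx.2) (norm_le_integral_snd h0 r hx.2)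

/-- Ladyzhenskaya's inequality on the unit square. -/
theorem sqInt_norm_sq_le (hg : ContDiff ℝ smoothOrder g) :
    (sqInt fun y => ‖g y‖ ^ 2) ≤
      (sqInt fun y => ‖g y‖ + ‖pd 0 g y‖) * sqInt fun y => ‖g y‖ + ‖pd 1 g y‖ := by
  have c := hg.continuous
  have c0 := (smooth_pd hg 0).continuous
  have c1 := (smooth_pd hg 1).continuous
  rw [sqInt_eq_iterated_symm (f := fun y => ‖g y‖ + ‖pd 0 g y‖) (by fun_prop),
    sqInt_eq_iterated (f := fun y => ‖g y‖ + ‖pd 1 g y‖) (by fun_prop),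
    sqInt_eq_iterated (by fun_prop)]
  have k0 : Continuous fun t => ∫ s in (0 : ℝ)..1, (‖g (s, t)‖ + ‖pd 0 g (s, t)‖) :=
    continuous_integral_fst (f := fun y => ‖g y‖ + ‖pd 0 g y‖) (by fun_prop)
  have k1 : Continuous fun s => ∫ t in (0 : ℝ)..1, (‖g (s, t)‖ + ‖pd 1 g (s, t)‖) :=
    continuous_integral_snd (f := fun y => ‖g y‖ + ‖pd 1 g y‖) (by fun_prop)
  rw [← intervalIntegral.integral_const_mul]
  refine intervalIntegral.integral_mono_on zero_le_one
    (Continuous.intervalIntegrable (continuous_integral_snd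
      (f := fun y => ‖g y‖ ^ 2) (by fun_prop)) _ _)
    (Continuous.intervalIntegrable (by fun_prop) _ _) fun s hs => ?_
  rw [← intervalIntegral.integral_mul_const]
  refine intervalIntegral.integral_mono_on zero_le_one
    (Continuous.intervalIntegrable (by fun_prop) _ _)
    (Continuous.intervalIntegrable (by fun_prop) _ _) fun t ht => ?_
  rw [sq]
  exact mul_le_mul (norm_le_integral_fst hg hs t) (norm_le_integral_snd hg s ht) (norm_nonneg _)
    ((norm_nonneg _).trans (norm_le_integral_fst hg hs t))

theorem sq_integral_le {f : ℝ → ℝ} (hf : Continuous f) :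
    (∫ t in (0 : ℝ)..1, f t) ^ 2 ≤ ∫ t in (0 : ℝ)..1, f t ^ 2 := by
  set m := ∫ t in (0 : ℝ)..1, f t with hm
  have h : 0 ≤ ∫ t in (0 : ℝ)..1, (f t - m) ^ 2 :=
    intervalIntegral.integral_nonneg zero_le_one fun t _ => sq_nonneg _
  have e : ∫ t in (0 : ℝ)..1, (f t - m) ^ 2 =
      (∫ t in (0 : ℝ)..1, f t ^ 2) - ∫ t in (0 : ℝ)..1, (2 * m * f t - m ^ 2) := by
    rw [← intervalIntegral.integral_sub (Continuous.intervalIntegrable (by fun_prop) _ _)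
      (Continuous.intervalIntegrable (by fun_prop) _ _)]
    congr 1; funext t; ring
  rw [e, intervalIntegral.integral_sub (Continuous.intervalIntegrable (by fun_prop) _ _) (by simp),
    intervalIntegral.integral_const_mul, ← hm] at h
  simp at h
  nlinarith

theorem sq_sqInt_le {f : ℝ × ℝ → ℝ} (hf : Continuous f) :
    (sqInt f) ^ 2 ≤ sqInt fun x => f x ^ 2 := by
  have := sqInt_mul_sq_le hf (continuous_const (y := (1 : ℝ)))
  simpa [sqInt_const] using this

/-- The Poincaré inequality for functions of mean zero. -/
theorem poincare (hg : ContDiff ℝ smoothOrder g) (h0 : sqInt g = 0) :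
    (sqInt fun y => ‖g y‖ ^ 2) ≤
      2 * ((sqInt fun y => ‖pd 0 g y‖ ^ 2) + sqInt fun y => ‖pd 1 g y‖ ^ 2) := by
  have c := hg.continuous
  have c0 := (smooth_pd hg 0).continuous
  have c1 := (smooth_pd hg 1).continuous
  set p : ℝ → ℝ := fun s => ∫ t in (0 : ℝ)..1, ‖pd 1 g (s, t)‖ with hp
  have cp : Continuous p := continuous_integral_snd (f := fun y => ‖pd 1 g y‖) (by fun_prop)
  set q : ℝ := sqInt fun y => ‖pd 0 g y‖ with hq
  have hq' : q = ∫ t in (0 : ℝ)..1, ∫ s in (0 : ℝ)..1, ‖pd 0 g (s, t)‖ :=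
    sqInt_eq_iterated_symm (by fun_prop)
  have cq := continuous_integral_fst (f := fun y => ‖pd 0 g y‖) (by fun_prop)
  have bound : ∀ s ∈ Set.Icc (0 : ℝ) 1, ∀ t ∈ Set.Icc (0 : ℝ) 1, ‖g (s, t)‖ ≤ p s + q := by
    intro s hs t ht
    have e : g (s, t) = ∫ t' in (0 : ℝ)..1, ∫ r in (0 : ℝ)..1, (g (s, t) - g (r, t')) := by
      have : ∀ t' : ℝ, ∫ r in (0 : ℝ)..1, (g (s, t) - g (r, t')) =
          g (s, t) - ∫ r in (0 : ℝ)..1, g (r, t') := by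
        intro t'
        rw [intervalIntegral.integral_sub (by simp) (Continuous.intervalIntegrable (by fun_prop) _ _)]
        simp
      simp_rw [this]
      rw [intervalIntegral.integral_sub (by simp)
        ((continuous_integral_fst c).intervalIntegrable _ _), ← sqInt_eq_iterated_symm c, h0]
      simp
    rw [e, hq']
    refine (intervalIntegral.norm_integral_le_integral_norm zero_le_one).trans ?_
    have k : p s + ∫ t in (0 : ℝ)..1, ∫ s in (0 : ℝ)..1, ‖pd 0 g (s, t)‖ =
        ∫ t in (0 : ℝ)..1, (p s + ∫ s in (0 : ℝ)..1, ‖pd 0 g (s, t)‖) := by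
      rw [intervalIntegral.integral_add (by simp) (cq.intervalIntegrable _ _)]; simp
    rw [k]
    refine intervalIntegral.integral_mono_on zero_le_one
      (Continuous.intervalIntegrable (continuous_integral_fst
        (f := fun y => g (s, t) - g y) (by fun_prop)).norm _ _)
      (Continuous.intervalIntegrable (by fun_prop) _ _) fun t' ht' => ?_
    refine (intervalIntegral.norm_integral_le_integral_norm zero_le_one).trans ?_
    have k2 : p s + ∫ s in (0 : ℝ)..1, ‖pd 0 g (s, t')‖ =
        ∫ _ in (0 : ℝ)..1, (p s + ∫ s in (0 : ℝ)..1, ‖pd 0 g (s, t')‖) := by simp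
    rw [k2]
    refine intervalIntegral.integral_mono_on zero_le_one
      (Continuous.intervalIntegrable (by fun_prop) _ _) (by simp) fun r hr => ?_
    have b1 := norm_sub_le_integral_deriv (f := fun τ => g (s, τ))
      (fun τ => hasDerivAt_snd hg s τ) (by fun_prop) ht ht'
    have b2 := norm_sub_le_integral_deriv (f := fun τ => g (τ, t'))
      (fun τ => hasDerivAt_fst hg τ t') (by fun_prop) hs hr
    calc ‖g (s, t) - g (r, t')‖ = ‖(g (s, t) - g (s, t')) + (g (s, t') - g (r, t'))‖ := by
          rw [sub_add_sub_cancel]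
      _ ≤ _ := (norm_add_le _ _).trans (add_le_add b1 b2)
  have hp2 : ∫ s in (0 : ℝ)..1, p s ^ 2 ≤ sqInt fun y => ‖pd 1 g y‖ ^ 2 := by
    rw [sqInt_eq_iterated (by fun_prop)]
    refine intervalIntegral.integral_mono_on zero_le_one
      (Continuous.intervalIntegrable (by fun_prop) _ _)
      (Continuous.intervalIntegrable (continuous_integral_snd
      (f := fun y => ‖pd 1 g y‖ ^ 2) (by fun_prop)) _ _) fun s _ => ?_
    exact sq_integral_le (by fun_prop)
  have hq2 : q ^ 2 ≤ sqInt fun y => ‖pd 0 g y‖ ^ 2 := sq_sqInt_le (by fun_prop)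
  have main : (sqInt fun y => ‖g y‖ ^ 2) ≤ ∫ s in (0 : ℝ)..1, (2 * p s ^ 2 + 2 * q ^ 2) := by
    rw [sqInt_eq_iterated (by fun_prop)]
    refine intervalIntegral.integral_mono_on zero_le_one
      (Continuous.intervalIntegrable (continuous_integral_snd
      (f := fun y => ‖g y‖ ^ 2) (by fun_prop)) _ _)
      (Continuous.intervalIntegrable (by fun_prop) _ _) fun s hs => ?_
    have : 2 * p s ^ 2 + 2 * q ^ 2 = ∫ _ in (0 : ℝ)..1, (2 * p s ^ 2 + 2 * q ^ 2) := by simp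
    rw [this]
    refine intervalIntegral.integral_mono_on zero_le_one
      (Continuous.intervalIntegrable (by fun_prop) _ _) (by simp) fun t ht => ?_
    have b := bound s hs t ht
    have b0 := norm_nonneg (g (s, t))
    nlinarith [sq_nonneg (p s - q)]
  rw [intervalIntegral.integral_add (Continuous.intervalIntegrable (by fun_prop) _ _) (by simp),
    intervalIntegral.integral_const_mul] at main
  simp at main
  linarith

end Sobolev

/-! ### `L²` pairing and elliptic estimates -/

/-- Squared `L²` norm over the unit square. -/
def nsq (u : ℝ × ℝ → ℂ) : ℝ := sqInt fun x => ‖u x‖ ^ 2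

/-- `L²` pairing over the unit square. -/
def ip (u v : ℝ × ℝ → ℂ) : ℂ := sqInt fun x => (starRingEnd ℂ) (u x) * v x

section Pairing

variable {u v w : ℝ × ℝ → ℂ}

theorem nsq_nonneg (u : ℝ × ℝ → ℂ) : 0 ≤ nsq u := sqInt_nonneg fun _ => sq_nonneg _

theorem nsq_add_le (hu : Continuous u) (hv : Continuous v) :
    nsq (fun x => u x + v x) ≤ 2 * nsq u + 2 * nsq v := by
  simp only [nsq]
  rw [← sqInt_const_mul, ← sqInt_const_mul, ← sqInt_add (by fun_prop) (by fun_prop)]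
  refine sqInt_mono (by fun_prop) (by fun_prop) fun x => ?_
  have h := norm_add_le (u x) (v x)
  nlinarith [norm_nonneg (u x + v x), sq_nonneg (‖u x‖ - ‖v x‖)]

theorem nsq_const_mul (c : ℂ) (u : ℝ × ℝ → ℂ) : nsq (fun x => c * u x) = ‖c‖ ^ 2 * nsq u := by
  simp only [nsq, norm_mul, mul_pow, sqInt_const_mul]

theorem nsq_conj (u : ℝ × ℝ → ℂ) : nsq (fun x => (starRingEnd ℂ) (u x)) = nsq u := by
  simp only [nsq, RCLike.norm_conj]

theorem nsq_mul_le (hu : Continuous u) (hv : Continuous v) {C : ℝ} (hC : ∀ x, ‖v x‖ ^ 2 ≤ C) :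
    nsq (fun x => u x * v x) ≤ C * nsq u := by
  simp only [nsq]
  rw [← sqInt_const_mul]
  refine sqInt_mono (by fun_prop) (by fun_prop) fun x => ?_
  rw [norm_mul, mul_pow, mul_comm]
  exact mul_le_mul_of_nonneg_right (hC x) (sq_nonneg _)

theorem ip_self (hu : Continuous u) : ip u u = (nsq u : ℂ) := by
  rw [ip, nsq, ← sqInt_ofReal (by fun_prop)]
  congr 1; funext x
  rw [← normSq_eq_conj_mul_self, normSq_eq_norm_sq]

theorem norm_ip_sq_le (hu : Continuous u) (hv : Continuous v) :
    ‖ip u v‖ ^ 2 ≤ nsq u * nsq v := by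
  have h1 : ‖ip u v‖ ≤ sqInt fun x => ‖u x‖ * ‖v x‖ := by
    refine (norm_sqInt_le _).trans (le_of_eq ?_)
    simp only [norm_mul, RCLike.norm_conj]
  calc ‖ip u v‖ ^ 2 ≤ (sqInt fun x => ‖u x‖ * ‖v x‖) ^ 2 :=
        pow_le_pow_left₀ (norm_nonneg _) h1 2
    _ ≤ nsq u * nsq v := sqInt_mul_sq_le (by fun_prop) (by fun_prop)

theorem norm_ip_le (hu : Continuous u) (hv : Continuous v) :
    2 * ‖ip u v‖ ≤ nsq u + nsq v := by
  have := norm_ip_sq_le hu hv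
  nlinarith [sq_nonneg (nsq u - nsq v), nsq_nonneg u, nsq_nonneg v, norm_nonneg (ip u v)]

theorem ip_add (hu : Continuous u) (hv : Continuous v) (hw : Continuous w) :
    ip u (fun x => v x + w x) = ip u v + ip u w := by
  simp only [ip, mul_add]
  exact sqInt_add (by fun_prop) (by fun_prop)

theorem ip_sub (hu : Continuous u) (hv : Continuous v) (hw : Continuous w) :
    ip u (fun x => v x - w x) = ip u v - ip u w := by
  simp only [ip, mul_sub]
  exact sqInt_sub (by fun_prop) (by fun_prop)

theorem ip_const_mul (c : ℂ) (u v : ℝ × ℝ → ℂ) : ip u (fun x => c * v x) = c * ip u v := by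
  simp only [ip, mul_left_comm _ c, sqInt_const_mul]

theorem ip_const_mul_left (c : ℂ) (u v : ℝ × ℝ → ℂ) :
    ip (fun x => c * u x) v = (starRingEnd ℂ) c * ip u v := by
  simp only [ip, map_mul, mul_assoc, sqInt_const_mul]

theorem ip_neg (u v : ℝ × ℝ → ℂ) : ip u (fun x => - v x) = - ip u v := by
  simp only [ip, mul_neg, sqInt_neg]

theorem ip_conj (hu : Continuous u) (hv : Continuous v) :
    (starRingEnd ℂ) (ip u v) = ip v u := by
  simp only [ip]
  rw [← sqInt_conj (by fun_prop)]
  congr 1; funext x; simp [mul_comm]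

theorem ip_cov {d : ℤ} {A : Fin 2 → ℝ × ℝ → ℝ} (hA : IsConn d A) (hu : IsSec d u)
    (hv : IsSec d v) (j : Fin 2) : ip u (cov A j v) = - ip (cov A j u) v :=
  sqInt_conj_mul_cov hA hu hv j

theorem IsSec.eq_zero_of_nsq {d : ℤ} (hu : IsSec d u) (h : nsq u = 0) (x : ℝ × ℝ) : u x = 0 := by
  simpa using hu.norm_sq.eq_zero_of_sqInt (fun _ => sq_nonneg _) h x

/-- The covariant Laplacian `-(D₁D₁ + D₂D₂)` of the background connection. -/
def lap (d : ℤ) (u : ℝ × ℝ → ℂ) (x : ℝ × ℝ) : ℂ :=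
  -(cov (bg d) 0 (cov (bg d) 0 u) x + cov (bg d) 1 (cov (bg d) 1 u) x)

variable {d : ℤ}

theorem IsSec.bgcov (hu : IsSec d u) (j : Fin 2) : IsSec d (GinzburgLandau.cov (bg d) j u) :=
  hu.cov (isConn_bg d) j

theorem IsSec.neg (hu : IsSec d u) : IsSec d (fun x => - u x) := by
  simpa using hu.const_mul (-1)

theorem IsSec.sub (hu : IsSec d u) (hv : IsSec d v) : IsSec d (fun x => u x - v x) := by
  simpa only [sub_eq_add_neg] using hu.add hv.neg

theorem IsSec.lap (hu : IsSec d u) : IsSec d (lap d u) :=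
  (((hu.bgcov 0).bgcov 0).add ((hu.bgcov 1).bgcov 1)).neg

theorem ip_lap (hu : IsSec d u) (hv : IsSec d v) :
    ip u (lap d v) = ip (cov (bg d) 0 u) (cov (bg d) 0 v) +
      ip (cov (bg d) 1 u) (cov (bg d) 1 v) := by
  have c : ∀ j, Continuous (cov (bg d) j (cov (bg d) j v)) := fun j =>
    ((hv.bgcov j).bgcov j).continuous
  change ip u (fun x => -(cov (bg d) 0 (cov (bg d) 0 v) x + cov (bg d) 1 (cov (bg d) 1 v) x)) = _
  rw [ip_neg, ip_add hu.continuous (c 0) (c 1), ip_cov (isConn_bg d) hu (hv.bgcov 0),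
    ip_cov (isConn_bg d) hu (hv.bgcov 1)]
  ring

theorem ip_lap_left (hu : IsSec d u) (hv : IsSec d v) :
    ip (lap d u) v = ip (cov (bg d) 0 u) (cov (bg d) 0 v) +
      ip (cov (bg d) 1 u) (cov (bg d) 1 v) := by
  rw [← ip_conj hv.continuous hu.lap.continuous, ip_lap hv hu, map_add,
    ip_conj (hv.bgcov _).continuous (hu.bgcov _).continuous,
    ip_conj (hv.bgcov _).continuous (hu.bgcov _).continuous]

theorem ip_lap_symm (hu : IsSec d u) (hv : IsSec d v) : ip u (lap d v) = ip (lap d u) v := by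
  rw [ip_lap hu hv, ip_lap_left hu hv]

theorem cov_cov_bg (hu : ContDiff ℝ smoothOrder u) (x : ℝ × ℝ) :
    cov (bg d) 0 (cov (bg d) 1 u) x = cov (bg d) 1 (cov (bg d) 0 u) x +
      2 * Real.pi * d * Complex.I * u x := by
  rw [cov_comm (isConn_bg d).smooth hu 0 1, pd_bg, pd_bg]
  simp [dir]; left; ring

theorem lap_cov_zero (hu : IsSec d u) (x : ℝ × ℝ) :
    lap d (cov (bg d) 0 u) x = cov (bg d) 0 (lap d u) x +
      4 * Real.pi * d * Complex.I * cov (bg d) 1 u x := by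
  have h0 := hu.bgcov 0
  have h1 := hu.bgcov 1
  have e1 : cov (bg d) 1 (cov (bg d) 0 u) = fun x => cov (bg d) 0 (cov (bg d) 1 u) x +
      (-(2 * Real.pi * d * Complex.I)) * u x := by
    funext x; rw [cov_cov_bg hu.smooth]; ring
  have e2 : lap d u = fun x => (-1) * (cov (bg d) 0 (cov (bg d) 0 u) x +
      cov (bg d) 1 (cov (bg d) 1 u) x) := by
    funext x; simp [lap]
  rw [e2, cov_const_mul _ ((h0.bgcov 0).add (h1.bgcov 1)).smooth,
    cov_add (h0.bgcov 0).smooth (h1.bgcov 1).smooth, cov_cov_bg h1.smooth]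
  simp only [lap]
  rw [e1, cov_add (h1.bgcov 0).smooth (hu.const_mul _).smooth, cov_const_mul _ hu.smooth]
  ring

theorem lap_cov_one (hu : IsSec d u) (x : ℝ × ℝ) :
    lap d (cov (bg d) 1 u) x = cov (bg d) 1 (lap d u) x -
      4 * Real.pi * d * Complex.I * cov (bg d) 0 u x := by
  have h0 := hu.bgcov 0
  have h1 := hu.bgcov 1
  have e1 : cov (bg d) 0 (cov (bg d) 1 u) = fun x => cov (bg d) 1 (cov (bg d) 0 u) x +
      (2 * Real.pi * d * Complex.I) * u x := by
    funext x; rw [cov_cov_bg hu.smooth]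
  have e2 : lap d u = fun x => (-1) * (cov (bg d) 0 (cov (bg d) 0 u) x +
      cov (bg d) 1 (cov (bg d) 1 u) x) := by
    funext x; simp [lap]
  rw [e2, cov_const_mul _ ((h0.bgcov 0).add (h1.bgcov 1)).smooth,
    cov_add (h0.bgcov 0).smooth (h1.bgcov 1).smooth]
  simp only [lap]
  rw [e1, cov_add (h0.bgcov 1).smooth (hu.const_mul _).smooth, cov_const_mul _ hu.smooth,
    cov_cov_bg h0.smooth]
  ring

/-- The sum of squared `L²` norms of first covariant derivatives. -/
def grad2 (d : ℤ) (u : ℝ × ℝ → ℂ) : ℝ := nsq (cov (bg d) 0 u) + nsq (cov (bg d) 1 u)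

/-- The sum of squared `L²` norms of second covariant derivatives. -/
def hess2 (d : ℤ) (u : ℝ × ℝ → ℂ) : ℝ := grad2 d (cov (bg d) 0 u) + grad2 d (cov (bg d) 1 u)

theorem grad2_nonneg (d : ℤ) (u : ℝ × ℝ → ℂ) : 0 ≤ grad2 d u :=
  add_nonneg (nsq_nonneg _) (nsq_nonneg _)

theorem hess2_nonneg (d : ℤ) (u : ℝ × ℝ → ℂ) : 0 ≤ hess2 d u :=
  add_nonneg (grad2_nonneg _ _) (grad2_nonneg _ _)

theorem nsq_cov_le (d : ℤ) (u : ℝ × ℝ → ℂ) (j : Fin 2) : nsq (cov (bg d) j u) ≤ grad2 d u := by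
  have h0 := nsq_nonneg (cov (bg d) 0 u)
  have h1 := nsq_nonneg (cov (bg d) 1 u)
  fin_cases j <;> simp only [grad2, Fin.zero_eta, Fin.mk_one] <;> linarith

theorem grad2_cov_le (d : ℤ) (u : ℝ × ℝ → ℂ) (j : Fin 2) : grad2 d (cov (bg d) j u) ≤ hess2 d u := by
  have h0 := grad2_nonneg d (cov (bg d) 0 u)
  have h1 := grad2_nonneg d (cov (bg d) 1 u)
  fin_cases j <;> simp only [hess2, Fin.zero_eta, Fin.mk_one] <;> linarith

theorem grad2_eq (hu : IsSec d u) : (grad2 d u : ℂ) = ip u (lap d u) := by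
  rw [ip_lap hu hu, ip_self (hu.bgcov 0).continuous, ip_self (hu.bgcov 1).continuous, grad2]
  push_cast; rfl

theorem grad2_le (hu : IsSec d u) : 2 * grad2 d u ≤ nsq u + nsq (lap d u) := by
  have h := norm_ip_le hu.continuous hu.lap.continuous
  rw [← grad2_eq hu, norm_real, Real.norm_eq_abs, abs_of_nonneg (grad2_nonneg d u)] at h
  exact h

theorem hess2_le (hu : IsSec d u) :
    hess2 d u ≤ nsq (lap d u) + 4 * Real.pi * |(d : ℝ)| * grad2 d u := by
  have h0 := hu.bgcov 0
  have h1 := hu.bgcov 1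
  set c : ℂ := 4 * Real.pi * d * Complex.I with hc
  have hcn : ‖c‖ = 4 * Real.pi * |(d : ℝ)| := by
    rw [hc]; simp [abs_of_pos Real.pi_pos]
  have e0 : lap d (cov (bg d) 0 u) = fun x => cov (bg d) 0 (lap d u) x + c * cov (bg d) 1 u x := by
    funext x; exact lap_cov_zero hu x
  have e1 : lap d (cov (bg d) 1 u) = fun x => cov (bg d) 1 (lap d u) x + (-c) * cov (bg d) 0 u x := by
    funext x; rw [lap_cov_one hu x]; ring
  have key : (hess2 d u : ℂ) = (nsq (lap d u) : ℂ) +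
      c * ip (cov (bg d) 0 u) (cov (bg d) 1 u) - c * ip (cov (bg d) 1 u) (cov (bg d) 0 u) := by
    rw [hess2]
    push_cast
    rw [grad2_eq h0, grad2_eq h1, e0, e1,
      ip_add h0.continuous (hu.lap.bgcov 0).continuous (h1.const_mul c).continuous,
      ip_add h1.continuous (hu.lap.bgcov 1).continuous (h0.const_mul (-c)).continuous,
      ip_const_mul, ip_const_mul, ← ip_self hu.lap.continuous, ip_lap_left hu hu.lap]
    ring
  have hn : ‖(hess2 d u : ℂ)‖ ≤ nsq (lap d u) + ‖c‖ * ‖ip (cov (bg d) 0 u) (cov (bg d) 1 u)‖ +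
      ‖c‖ * ‖ip (cov (bg d) 1 u) (cov (bg d) 0 u)‖ := by
    rw [key]
    refine (norm_sub_le _ _).trans ?_
    rw [norm_mul]
    refine add_le_add ((norm_add_le _ _).trans ?_) le_rfl
    rw [norm_mul, norm_real, Real.norm_eq_abs, abs_of_nonneg (nsq_nonneg _)]
  rw [norm_real, Real.norm_eq_abs, abs_of_nonneg (hess2_nonneg d u)] at hn
  have b1 := norm_ip_le h0.continuous h1.continuous
  have b2 := norm_ip_le h1.continuous h0.continuous
  rw [← hcn, grad2]
  nlinarith [norm_nonneg c, mul_le_mul_of_nonneg_left b1 (norm_nonneg c),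
    mul_le_mul_of_nonneg_left b2 (norm_nonneg c)]

theorem abs_pd_norm_sq_le (hu : IsSec d u) (j : Fin 2) (x : ℝ × ℝ) :
    |pd j (fun y => ‖u y‖ ^ 2) x| ≤ 2 * (‖u x‖ * ‖cov (bg d) j u x‖) := by
  rw [pd_norm_sq (bg d) hu, abs_mul, abs_two]
  refine mul_le_mul_of_nonneg_left ((abs_re_le_norm _).trans (le_of_eq ?_)) zero_le_two
  rw [norm_mul, RCLike.norm_conj]

theorem sqInt_norm_mul_le (hu : Continuous u) (hv : Continuous v) :
    (sqInt fun x => ‖u x‖ * ‖v x‖) ≤ √(nsq u * nsq v) :=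
  Real.le_sqrt_of_sq_le (sqInt_mul_sq_le (by fun_prop) (by fun_prop))

theorem sup_bound (hu : IsSec d u) (x : ℝ × ℝ) :
    ‖u x‖ ^ 2 ≤ 3 * nsq u + 2 * grad2 d u + 2 * √(nsq u * hess2 d u) := by
  have h0 := hu.bgcov 0
  have h1 := hu.bgcov 1
  have h10 := h0.bgcov 1
  have c := hu.continuous
  have c0 := h0.continuous
  have c1 := h1.continuous
  have c10 := h10.continuous
  have hw := hu.norm_sq
  obtain ⟨y, hy, e⟩ := hw.exists_mem_square x
  rw [← e]
  have hb := norm_le_sqInt hw.smooth hy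
  have i1 := (hw.pd 1).continuous
  have i0 := (hw.pd 0).continuous
  have i10 := ((hw.pd 0).pd 1).continuous
  have p10 : ∀ z, |pd 1 (pd 0 (fun y => ‖u y‖ ^ 2)) z| ≤
      2 * (‖cov (bg d) 1 u z‖ * ‖cov (bg d) 0 u z‖ + ‖u z‖ * ‖cov (bg d) 1 (cov (bg d) 0 u) z‖) := by
    intro z
    have e : pd 0 (fun y => ‖u y‖ ^ 2) =
        fun y => 2 * ((starRingEnd ℂ) (u y) * cov (bg d) 0 u y).re := by
      funext y; exact pd_norm_sq (bg d) hu 0 y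
    rw [e, pd_const_mul _ (smooth_re (hu.pairing h0).smooth), pd_re (hu.pairing h0).smooth,
      pd_conj_mul (bg d) hu.smooth h0.smooth, abs_mul, abs_two]
    refine mul_le_mul_of_nonneg_left ((abs_re_le_norm _).trans ((norm_add_le _ _).trans ?_))
      zero_le_two
    rw [norm_mul, norm_mul, RCLike.norm_conj, RCLike.norm_conj]
  have hle : (sqInt fun y => (‖(fun y => ‖u y‖ ^ 2) y‖ + ‖pd 1 (fun y => ‖u y‖ ^ 2) y‖) +
      (‖pd 0 (fun y => ‖u y‖ ^ 2) y‖ + ‖pd 1 (pd 0 (fun y => ‖u y‖ ^ 2)) y‖)) ≤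
      sqInt fun z => (3 * ‖u z‖ ^ 2 + 2 * (‖cov (bg d) 0 u z‖ ^ 2 + ‖cov (bg d) 1 u z‖ ^ 2)) +
        2 * (‖u z‖ * ‖cov (bg d) 1 (cov (bg d) 0 u) z‖) := by
    refine sqInt_mono (by fun_prop) (by fun_prop) fun z => ?_
    have a1 := abs_pd_norm_sq_le hu 1 z
    have a0 := abs_pd_norm_sq_le hu 0 z
    have a10 := p10 z
    simp only [Real.norm_eq_abs, abs_pow, abs_norm]
    nlinarith [sq_nonneg (‖u z‖ - ‖cov (bg d) 1 u z‖), sq_nonneg (‖u z‖ - ‖cov (bg d) 0 u z‖),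
      sq_nonneg (‖cov (bg d) 1 u z‖ - ‖cov (bg d) 0 u z‖)]
  have hr : (sqInt fun z => (3 * ‖u z‖ ^ 2 +
      2 * (‖cov (bg d) 0 u z‖ ^ 2 + ‖cov (bg d) 1 u z‖ ^ 2)) +
        2 * (‖u z‖ * ‖cov (bg d) 1 (cov (bg d) 0 u) z‖)) = 3 * nsq u + 2 * grad2 d u +
      2 * sqInt fun z => ‖u z‖ * ‖cov (bg d) 1 (cov (bg d) 0 u) z‖ := by
    rw [sqInt_add (by fun_prop) (by fun_prop), sqInt_add (by fun_prop) (by fun_prop),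
      sqInt_const_mul, sqInt_const_mul, sqInt_const_mul, sqInt_add (by fun_prop) (by fun_prop)]
    rfl
  have hs := sqInt_norm_mul_le c c10
  have hs2 : √(nsq u * nsq (cov (bg d) 1 (cov (bg d) 0 u))) ≤ √(nsq u * hess2 d u) :=
    Real.sqrt_le_sqrt (mul_le_mul_of_nonneg_left
      ((nsq_cov_le _ _ _).trans (grad2_cov_le _ _ _)) (nsq_nonneg u))
  have hy2 := (le_abs_self _).trans (hb.trans (hle.trans hr.le))
  linarith

theorem sqInt_pow_four_le (hu : IsSec d u) :
    (sqInt fun x => ‖u x‖ ^ 4) ≤ (nsq u + 2 * √(nsq u * grad2 d u)) ^ 2 := by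
  have hw := hu.norm_sq
  have c := hu.continuous
  have h := sqInt_norm_sq_le hw.smooth
  have e : (sqInt fun x => ‖u x‖ ^ 4) = sqInt fun y => ‖(fun y => ‖u y‖ ^ 2) y‖ ^ 2 := by
    congr 1; funext x; simp; ring
  have b : ∀ j, (sqInt fun y => ‖(fun y => ‖u y‖ ^ 2) y‖ + ‖pd j (fun y => ‖u y‖ ^ 2) y‖) ≤
      nsq u + 2 * √(nsq u * grad2 d u) := by
    intro j
    have cj := (hu.bgcov j).continuous
    have ij := (hw.pd j).continuous
    have s := sqInt_norm_mul_le c cj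
    have s2 : √(nsq u * nsq (cov (bg d) j u)) ≤ √(nsq u * grad2 d u) :=
      Real.sqrt_le_sqrt (mul_le_mul_of_nonneg_left (nsq_cov_le _ _ _) (nsq_nonneg u))
    calc _ ≤ sqInt fun y => ‖u y‖ ^ 2 + 2 * (‖u y‖ * ‖cov (bg d) j u y‖) := by
          refine sqInt_mono (by fun_prop) (by fun_prop) fun z => ?_
          have a1 := abs_pd_norm_sq_le hu j z
          simp only [Real.norm_eq_abs, abs_pow, abs_norm]
          linarith
      _ = nsq u + 2 * sqInt fun y => ‖u y‖ * ‖cov (bg d) j u y‖ := by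
          rw [sqInt_add (by fun_prop) (by fun_prop), sqInt_const_mul]; rfl
      _ ≤ _ := by linarith
  rw [e, sq]
  exact h.trans (mul_le_mul (b 0) (b 1) (sqInt_nonneg fun _ => by positivity)
    (add_nonneg (nsq_nonneg _) (by positivity)))

theorem nsq_mul_sq_le (hu : Continuous u) (hv : Continuous v) :
    nsq (fun x => u x * v x) ^ 2 ≤ (sqInt fun x => ‖u x‖ ^ 4) * sqInt fun x => ‖v x‖ ^ 4 := by
  have h := sqInt_mul_sq_le (f := fun x => ‖u x‖ ^ 2) (g := fun x => ‖v x‖ ^ 2) (by fun_prop)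
    (by fun_prop)
  simp only [← pow_mul] at h
  simpa only [nsq, norm_mul, mul_pow] using h

end Pairing

/-! ### Families bounded in Sobolev norms -/

/-- Families of sections of degree `d` with uniformly bounded `L²` norms of the covariant
derivatives of order at most `k`. -/
def Bdd (d : ℤ) : ℕ → (ℕ → ℝ × ℝ → ℂ) → Prop
  | 0, u => (∀ N, IsSec d (u N)) ∧ ∃ C, ∀ N, nsq (u N) ≤ C
  | k + 1, u => ((∀ N, IsSec d (u N)) ∧ ∃ C, ∀ N, nsq (u N) ≤ C) ∧
      ∀ j, Bdd d k (fun N => cov (bg d) j (u N))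

namespace Bdd

variable {d e f : ℤ} {k : ℕ} {u v : ℕ → ℝ × ℝ → ℂ}

theorem zero : ∀ {k : ℕ}, Bdd d k u → Bdd d 0 u
  | 0, h => h
  | _ + 1, h => h.1

theorem isSec (h : Bdd d k u) (N : ℕ) : IsSec d (u N) := h.zero.1 N

theorem exists_bound (h : Bdd d k u) : ∃ C, 0 ≤ C ∧ ∀ N, nsq (u N) ≤ C := by
  obtain ⟨C, hC⟩ := h.zero.2
  exact ⟨C, (nsq_nonneg _).trans (hC 0), hC⟩

theorem cov (h : Bdd d (k + 1) u) (j : Fin 2) :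
    Bdd d k (fun N => GinzburgLandau.cov (bg d) j (u N)) := h.2 j

theorem succ (h0 : Bdd d 0 u) (h : ∀ j, Bdd d k (fun N => GinzburgLandau.cov (bg d) j (u N))) :
    Bdd d (k + 1) u := ⟨h0, h⟩

theorem of_succ : ∀ {k : ℕ} {u : ℕ → ℝ × ℝ → ℂ}, Bdd d (k + 1) u → Bdd d k u
  | 0, _, h => h.1
  | _ + 1, _, h => ⟨h.1, fun j => (h.2 j).of_succ⟩

theorem mono (h : Bdd d k u) {l : ℕ} (hl : l ≤ k) : Bdd d l u := by
  induction k with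
  | zero => obtain rfl : l = 0 := by omega
            exact h
  | succ k ih =>
    rcases hl.eq_or_lt with rfl | hlt
    · exact h
    · exact ih h.of_succ (by omega)

theorem add : ∀ {k : ℕ} {u v : ℕ → ℝ × ℝ → ℂ}, Bdd d k u → Bdd d k v →
    Bdd d k (fun N x => u N x + v N x)
  | 0, u, v, hu, hv => by
    obtain ⟨C, _, hC⟩ := hu.exists_bound
    obtain ⟨C', _, hC'⟩ := hv.exists_bound
    refine ⟨fun N => (hu.1 N).add (hv.1 N), 2 * C + 2 * C', fun N => ?_⟩
    have := nsq_add_le (hu.1 N).continuous (hv.1 N).continuous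
    linarith [hC N, hC' N]
  | k + 1, u, v, hu, hv => by
    refine succ (add hu.zero hv.zero) fun j => ?_
    have e : (fun N => GinzburgLandau.cov (bg d) j (fun x => u N x + v N x)) = fun N x =>
        GinzburgLandau.cov (bg d) j (u N) x + GinzburgLandau.cov (bg d) j (v N) x := by
      funext N x; exact cov_add (hu.isSec N).smooth (hv.isSec N).smooth j x
    rw [e]
    exact add (hu.cov j) (hv.cov j)

theorem const_mul (c : ℂ) : ∀ {k : ℕ} {u : ℕ → ℝ × ℝ → ℂ}, Bdd d k u →
    Bdd d k (fun N x => c * u N x)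
  | 0, u, hu => by
    obtain ⟨C, _, hC⟩ := hu.exists_bound
    refine ⟨fun N => (hu.1 N).const_mul c, ‖c‖ ^ 2 * C, fun N => ?_⟩
    rw [nsq_const_mul]
    exact mul_le_mul_of_nonneg_left (hC N) (sq_nonneg _)
  | k + 1, u, hu => by
    refine succ (const_mul c hu.zero) fun j => ?_
    have e : (fun N => GinzburgLandau.cov (bg d) j (fun x => c * u N x)) = fun N x =>
        c * GinzburgLandau.cov (bg d) j (u N) x := by
      funext N x; exact cov_const_mul c (hu.isSec N).smooth j x
    rw [e]
    exact const_mul c (hu.cov j)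

theorem conj (h : -d = e) : ∀ {k : ℕ} {u : ℕ → ℝ × ℝ → ℂ}, Bdd d k u →
    Bdd e k (fun N x => (starRingEnd ℂ) (u N x))
  | 0, u, hu => by
    obtain ⟨C, _, hC⟩ := hu.exists_bound
    refine ⟨fun N => (hu.1 N).conj h, C, fun N => ?_⟩
    rw [nsq_conj]
    exact hC N
  | k + 1, u, hu => by
    refine succ (conj h hu.zero) fun j => ?_
    have e : (fun N => GinzburgLandau.cov (bg e) j (fun x => (starRingEnd ℂ) (u N x))) = fun N x =>
        (starRingEnd ℂ) (GinzburgLandau.cov (bg d) j (u N) x) := by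
      funext N x; exact cov_bg_conj h (hu.isSec N).smooth j x
    rw [e]
    exact conj h (hu.cov j)

theorem neg (hu : Bdd d k u) : Bdd d k (fun N x => - u N x) := by
  simpa using hu.const_mul (-1)

theorem sub (hu : Bdd d k u) (hv : Bdd d k v) : Bdd d k (fun N x => u N x - v N x) := by
  simpa only [sub_eq_add_neg] using hu.add hv.neg

theorem re (hu : Bdd 0 k u) : Bdd 0 k (fun N x => ((u N x).re : ℂ)) := by
  have := ((hu.add (hu.conj (by norm_num : -(0 : ℤ) = 0)))).const_mul (1 / 2)
  refine (congrArg (Bdd 0 k) ?_).mp this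
  funext N x
  rw [add_conj]; push_cast; ring

theorem im (hu : Bdd 0 k u) : Bdd 0 k (fun N x => ((u N x).im : ℂ)) := by
  refine (congrArg (Bdd 0 k) ?_).mp (hu.const_mul (-Complex.I)).re
  funext N x
  simp

theorem lap (hu : Bdd d (k + 2) u) : Bdd d k (fun N => GinzburgLandau.lap d (u N)) :=
  (((hu.cov 0).cov 0).add ((hu.cov 1).cov 1)).neg

theorem grad2_bound (hu : Bdd d (k + 1) u) : ∃ C, 0 ≤ C ∧ ∀ N, grad2 d (u N) ≤ C := by
  obtain ⟨C0, p0, h0⟩ := (hu.cov 0).exists_bound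
  obtain ⟨C1, p1, h1⟩ := (hu.cov 1).exists_bound
  exact ⟨C0 + C1, add_nonneg p0 p1, fun N => add_le_add (h0 N) (h1 N)⟩

theorem of_grad2 (hu : Bdd d 0 u) {C : ℝ} (h : ∀ N, grad2 d (u N) ≤ C) : Bdd d 1 u :=
  succ hu fun j => ⟨fun N => (hu.1 N).bgcov j, C, fun N => (nsq_cov_le d (u N) j).trans (h N)⟩

theorem sup_bound (hu : Bdd d (k + 2) u) : ∃ C, 0 ≤ C ∧ ∀ N x, ‖u N x‖ ^ 2 ≤ C := by
  obtain ⟨C, p, h⟩ := hu.exists_bound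
  obtain ⟨C1, p1, h1⟩ := hu.grad2_bound
  obtain ⟨C2, p2, h2⟩ := (hu.cov 0).grad2_bound
  obtain ⟨C3, p3, h3⟩ := (hu.cov 1).grad2_bound
  refine ⟨3 * C + 2 * C1 + 2 * √(C * (C2 + C3)), by positivity, fun N x => ?_⟩
  refine (GinzburgLandau.sup_bound (hu.isSec N) x).trans ?_
  have : √(nsq (u N) * hess2 d (u N)) ≤ √(C * (C2 + C3)) :=
    Real.sqrt_le_sqrt (mul_le_mul (h N) (add_le_add (h2 N) (h3 N)) (hess2_nonneg _ _) p)
  linarith [h N, h1 N]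

theorem four_bound (hu : Bdd d (k + 1) u) :
    ∃ C, 0 ≤ C ∧ ∀ N, (sqInt fun x => ‖u N x‖ ^ 4) ≤ C := by
  obtain ⟨C, p, h⟩ := hu.exists_bound
  obtain ⟨C1, p1, h1⟩ := hu.grad2_bound
  refine ⟨(C + 2 * √(C * C1)) ^ 2, by positivity, fun N => ?_⟩
  refine (sqInt_pow_four_le (hu.isSec N)).trans ?_
  have : √(nsq (u N) * grad2 d (u N)) ≤ √(C * C1) :=
    Real.sqrt_le_sqrt (mul_le_mul (h N) (h1 N) (grad2_nonneg _ _) p)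
  have := nsq_nonneg (u N)
  gcongr
  exact h N

theorem zero_mul_two (h : d + e = f) (hu : Bdd d 0 u) (hv : Bdd e 2 v) :
    Bdd f 0 (fun N x => u N x * v N x) := by
  obtain ⟨C, p, hC⟩ := hu.exists_bound
  obtain ⟨C', p', hC'⟩ := hv.sup_bound
  refine ⟨fun N => (hu.isSec N).mul (hv.isSec N) h, C' * C, fun N => ?_⟩
  exact (nsq_mul_le (hu.isSec N).continuous (hv.isSec N).continuous (hC' N)).trans
    (mul_le_mul_of_nonneg_left (hC N) p')

theorem one_mul_one (h : d + e = f) (hu : Bdd d 1 u) (hv : Bdd e 1 v) :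
    Bdd f 0 (fun N x => u N x * v N x) := by
  obtain ⟨C, p, hC⟩ := hu.four_bound
  obtain ⟨C', p', hC'⟩ := hv.four_bound
  refine ⟨fun N => (hu.isSec N).mul (hv.isSec N) h, √(C * C'), fun N => ?_⟩
  refine Real.le_sqrt_of_sq_le ?_
  refine (nsq_mul_sq_le (hu.isSec N).continuous (hv.isSec N).continuous).trans ?_
  exact mul_le_mul (hC N) (hC' N) (sqInt_nonneg fun _ => by positivity) p

/-- Products of families bounded in Sobolev spaces. -/
theorem mul (h : d + e = f) (hu : Bdd d k u) (hv : Bdd e (max k 2) v) :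
    Bdd f k (fun N x => u N x * v N x) := by
  induction k generalizing d e f u v with
  | zero => exact zero_mul_two h hu hv
  | succ k ih =>
    refine succ (zero_mul_two h hu.zero (hv.mono (by omega))) fun j => ?_
    have e' : (fun N => GinzburgLandau.cov (bg f) j (fun x => u N x * v N x)) = fun N x =>
        GinzburgLandau.cov (bg d) j (u N) x * v N x +
          u N x * GinzburgLandau.cov (bg e) j (v N) x := by
      funext N x; exact cov_bg_mul h (hu.isSec N).smooth (hv.isSec N).smooth j x
    rw [e']
    refine (ih h (hu.cov j) (hv.mono (by omega))).add ?_
    rcases k with _ | k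
    · exact one_mul_one h hu ((hv : Bdd e 2 v).cov j)
    · have hm : max (k + 1 + 1) 2 = (k + 1) + 1 := by omega
      rw [hm] at hv
      have := ih (f := f) (by omega) (hv.cov j) (hu.mono (by omega))
      simpa only [mul_comm] using this

/-- Elliptic regularity with uniform bounds. -/
theorem of_lap : ∀ {k : ℕ} {u : ℕ → ℝ × ℝ → ℂ}, Bdd d 0 u →
    Bdd d k (fun N => GinzburgLandau.lap d (u N)) → Bdd d (k + 2) u
  | 0, u, hu, hl => by
    obtain ⟨C, p, hC⟩ := hu.exists_bound
    obtain ⟨C', p', hC'⟩ := hl.exists_bound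
    have g : ∀ N, grad2 d (u N) ≤ C + C' := fun N => by
      linarith [grad2_le (hu.isSec N), hC N, hC' N, grad2_nonneg d (u N)]
    have h1 := hu.of_grad2 g
    have hh : ∀ N, hess2 d (u N) ≤ C' + 4 * Real.pi * |(d : ℝ)| * (C + C') := fun N => by
      have := Real.pi_pos
      exact (hess2_le (hu.isSec N)).trans
        (add_le_add (hC' N) (mul_le_mul_of_nonneg_left (g N) (by positivity)))
    exact succ hu fun j => (h1.cov j).of_grad2 fun N => (grad2_cov_le d (u N) j).trans (hh N)
  | k + 1, u, hu, hl => by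
    have h2 : Bdd d (k + 2) u := of_lap hu hl.of_succ
    refine succ hu fun j => of_lap (h2.cov j).zero ?_
    have hj : ∀ j, Bdd d k (fun N => GinzburgLandau.cov (bg d) j (u N)) :=
      fun j => (h2.cov j).of_succ
    fin_cases j
    · refine (congrArg (Bdd d k) ?_).mp
        ((hl.cov 0).add ((hj 1).const_mul (4 * Real.pi * d * Complex.I)))
      funext N x; exact (lap_cov_zero (hu.isSec N) x).symm
    · refine (congrArg (Bdd d k) ?_).mp
        ((hl.cov 1).sub ((hj 0).const_mul (4 * Real.pi * d * Complex.I)))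
      funext N x; exact (lap_cov_one (hu.isSec N) x).symm

end Bdd

/-! ### Galerkin spaces -/

/-- A sequence of finite-dimensional Laplacian-invariant spaces of sections. -/
structure GalerkinSystem (d : ℤ) where
  space : ℕ → Submodule ℂ (ℝ × ℝ → ℂ)
  finite : ∀ N, FiniteDimensional ℂ (space N)
  isSec : ∀ N, ∀ u ∈ space N, IsSec d u
  lap_mem : ∀ N, ∀ u ∈ space N, lap d u ∈ space N
  mono : Monotone space

/-- Galerkin projections preserve Sobolev bounds. -/
theorem Bdd.of_projection {d : ℤ} (V : GalerkinSystem d) :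
    ∀ {k : ℕ} {w R : ℕ → ℝ × ℝ → ℂ}, (∀ N, w N ∈ V.space N) → Bdd d k R →
      (∀ N, ∀ ψ ∈ V.space N, ip ψ (w N) = ip ψ (R N)) → Bdd d k w
  | 0, w, R, hw, hR, h => by
    obtain ⟨C, p, hC⟩ := hR.exists_bound
    refine ⟨fun N => V.isSec N _ (hw N), C, fun N => (?_ : nsq (w N) ≤ nsq (R N)).trans (hC N)⟩
    have e := h N _ (hw N)
    have hs := V.isSec N _ (hw N)
    rw [ip_self hs.continuous] at e
    have b := norm_ip_le hs.continuous (hR.isSec N).continuous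
    rw [← e, norm_real, Real.norm_eq_abs, abs_of_nonneg (nsq_nonneg _)] at b
    linarith
  | 1, w, R, hw, hR, h => by
    have h0 := of_projection V hw hR.zero h
    obtain ⟨C, p, hC⟩ := hR.grad2_bound
    refine h0.of_grad2 (C := C) fun N => (?_ : grad2 d (w N) ≤ grad2 d (R N)).trans (hC N)
    have hs := V.isSec N _ (hw N)
    have hr := hR.isSec N
    have e := h N _ (V.lap_mem N _ (hw N))
    rw [← ip_lap_symm hs hs, ← grad2_eq hs, ip_lap_left hs hr] at e
    have b0 := norm_ip_le (hs.bgcov 0).continuous (hr.bgcov 0).continuous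
    have b1 := norm_ip_le (hs.bgcov 1).continuous (hr.bgcov 1).continuous
    have b : ‖(grad2 d (w N) : ℂ)‖ ≤ ‖ip (GinzburgLandau.cov (bg d) 0 (w N))
        (GinzburgLandau.cov (bg d) 0 (R N))‖ +
        ‖ip (GinzburgLandau.cov (bg d) 1 (w N)) (GinzburgLandau.cov (bg d) 1 (R N))‖ := by
      rw [e]; exact norm_add_le _ _
    rw [norm_real, Real.norm_eq_abs, abs_of_nonneg (grad2_nonneg _ _)] at b
    simp only [grad2] at *
    linarith
  | k + 2, w, R, hw, hR, h => by
    refine (of_projection V hw hR.zero h).of_lap ?_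
    refine of_projection V (fun N => V.lap_mem N _ (hw N)) hR.lap fun N ψ hψ => ?_
    have hs := V.isSec N _ (hw N)
    have hp := V.isSec N _ hψ
    rw [ip_lap_symm hp hs, ip_lap_symm hp (hR.isSec N)]
    exact h N _ (V.lap_mem N _ hψ)

/-! ### The regularized energy -/

/-- Components of the one-form encoded by a complex-valued function. -/
def coef (B : ℝ × ℝ → ℂ) (j : Fin 2) (x : ℝ × ℝ) : ℝ := if j = 0 then (B x).re else (B x).im

/-- The connection obtained by adding a periodic one-form to the background connection. -/
def conn (d : ℤ) (B : ℝ × ℝ → ℂ) (j : Fin 2) (x : ℝ × ℝ) : ℝ := bg d j x + coef B j x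

theorem isPer_coef {B : ℝ × ℝ → ℂ} (hB : IsSec 0 B) (j : Fin 2) : IsPer (coef B j) := by
  fin_cases j
  · exact hB.re
  · exact hB.im

theorem isConn_conn (d : ℤ) {B : ℝ × ℝ → ℂ} (hB : IsSec 0 B) : IsConn d (conn d B) where
  smooth j := ((isConn_bg d).smooth j).add (isPer_coef hB j).smooth
  per1 j s t := by
    have h1 := (isConn_bg d).per1 j s t
    have h2 := (isPer_coef hB j).per1 s t
    simp only [conn, h1, h2]
  per2 j s t := by
    have h1 := (isConn_bg d).per2 j s t
    have h2 := (isPer_coef hB j).per2 s t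
    simp only [conn, h1, h2]
    ring

theorem cov_conn (d : ℤ) (B u : ℝ × ℝ → ℂ) (j : Fin 2) (x : ℝ × ℝ) :
    cov (conn d B) j u x = cov (bg d) j u x + Complex.I * (coef B j x : ℂ) * u x := by
  simp only [cov, conn]; push_cast; ring

theorem coef_add (B C : ℝ × ℝ → ℂ) (j : Fin 2) (x : ℝ × ℝ) :
    coef (fun x => B x + C x) j x = coef B j x + coef C j x := by
  simp only [coef]; split <;> simp

theorem coef_real_mul (t : ℝ) (C : ℝ × ℝ → ℂ) (j : Fin 2) (x : ℝ × ℝ) :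
    coef (fun x => (t : ℂ) * C x) j x = t * coef C j x := by
  simp only [coef]; split <;> simp

/-- Energy density with the curvature term replaced by the full gradient of the one-form. -/
def density (α β : ℝ) (d : ℤ) (B φ : ℝ × ℝ → ℂ) (x : ℝ × ℝ) : ℝ :=
  ‖cov (bg 0) 0 B x‖ ^ 2 + ‖cov (bg 0) 1 B x‖ ^ 2 + ‖cov (conn d B) 0 φ x‖ ^ 2 +
    ‖cov (conn d B) 1 φ x‖ ^ 2 - α * ‖φ x‖ ^ 2 + β / 2 * ‖φ x‖ ^ 4

/-- The current as a complex-valued function. -/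
def currentC (A : Fin 2 → ℝ × ℝ → ℝ) (φ : ℝ × ℝ → ℂ) (x : ℝ × ℝ) : ℂ :=
  (current A φ 0 x : ℂ) + Complex.I * (current A φ 1 x : ℂ)

/-- The left-hand side of the Euler-Lagrange equation for the section. -/
def glOp (α β : ℝ) (A : Fin 2 → ℝ × ℝ → ℝ) (φ : ℝ × ℝ → ℂ) (x : ℝ × ℝ) : ℂ :=
  -(cov A 0 (cov A 0 φ) x + cov A 1 (cov A 1 φ) x) - (α : ℂ) * φ x +
    (β : ℂ) * ((‖φ x‖ ^ 2 : ℝ) : ℂ) * φ x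

theorem sqInt_lin {p0 p1 p2 p3 p4 : ℝ × ℝ → ℝ} (h0 : Continuous p0) (h1 : Continuous p1)
    (h2 : Continuous p2) (h3 : Continuous p3) (h4 : Continuous p4) (t : ℝ) :
    (sqInt fun x => p0 x + t * p1 x + t ^ 2 * p2 x + t ^ 3 * p3 x + t ^ 4 * p4 x) =
      sqInt p0 + t * sqInt p1 + t ^ 2 * sqInt p2 + t ^ 3 * sqInt p3 + t ^ 4 * sqInt p4 := by
  rw [sqInt_add (by fun_prop) (by fun_prop), sqInt_add (by fun_prop) (by fun_prop),
    sqInt_add (by fun_prop) (by fun_prop), sqInt_add (by fun_prop) (by fun_prop)]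
  simp only [sqInt_const_mul]

theorem first_variation {p0 p1 p2 p3 p4 : ℝ × ℝ → ℝ} (h0 : Continuous p0) (h1 : Continuous p1)
    (h2 : Continuous p2) (h3 : Continuous p3) (h4 : Continuous p4) {F : ℝ → ℝ}
    (hmin : ∀ t, F 0 ≤ F t)
    (hF : ∀ t, F t = sqInt fun x =>
      p0 x + t * p1 x + t ^ 2 * p2 x + t ^ 3 * p3 x + t ^ 4 * p4 x) : sqInt p1 = 0 := by
  have hd : HasDerivAt F (sqInt p1) 0 := by
    have e : F = fun t => sqInt p0 + t * sqInt p1 + t ^ 2 * sqInt p2 + t ^ 3 * sqInt p3 +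
        t ^ 4 * sqInt p4 := by
      funext t; rw [hF, sqInt_lin h0 h1 h2 h3 h4]
    rw [e]
    have hp : ∀ n : ℕ, ∀ c : ℝ, HasDerivAt (fun t : ℝ => t ^ n * c) (n * 0 ^ (n - 1) * c) 0 :=
      fun n c => (hasDerivAt_pow n (0 : ℝ)).mul_const c
    have h1 : HasDerivAt (fun t : ℝ => t * sqInt p1) (1 * sqInt p1) 0 :=
      (hasDerivAt_id' (0 : ℝ)).mul_const _
    have := ((((h1.const_add (sqInt p0)).fun_add (hp 2 (sqInt p2))).fun_add
      (hp 3 (sqInt p3))).fun_add (hp 4 (sqInt p4)))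
    exact this.congr_deriv (by norm_num)
  have hm : IsLocalMin F 0 := Filter.Eventually.of_forall hmin
  exact hm.hasDerivAt_eq_zero hd

theorem norm_add_real_mul_sq (a p : ℂ) (t : ℝ) :
    ‖a + t * p‖ ^ 2 = ‖a‖ ^ 2 + t * (2 * ((starRingEnd ℂ) p * a).re) + t ^ 2 * ‖p‖ ^ 2 := by
  simp only [← Complex.normSq_eq_norm_sq, Complex.normSq_apply]
  simp
  ring

theorem sqInt_pairing_re {u v : ℝ × ℝ → ℂ} (hu : Continuous u) (hv : Continuous v) :
    (sqInt fun x => 2 * ((starRingEnd ℂ) (u x) * v x).re) = 2 * (ip u v).re := by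
  rw [sqInt_const_mul, sqInt_re (by fun_prop)]
  rfl

section EulerLagrange

attribute [local irreducible] cov

variable {α β : ℝ} {d : ℤ} {B φ : ℝ × ℝ → ℂ}

theorem isSec_norm_sq_mul (hφ : IsSec d φ) : IsSec d (fun x => ((‖φ x‖ ^ 2 : ℝ) : ℂ) * φ x) :=
  hφ.norm_sq.ofReal.mul hφ (by ring)

theorem isSec_glOp {A : Fin 2 → ℝ × ℝ → ℝ} (hA : IsConn d A) (hφ : IsSec d φ) :
    IsSec d (glOp α β A φ) := by
  have := (((((hφ.cov hA 0).cov hA 0).add ((hφ.cov hA 1).cov hA 1)).neg).sub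
    (hφ.const_mul (α : ℂ))).add ((isSec_norm_sq_mul hφ).const_mul (β : ℂ))
  refine (congrArg (IsSec d) ?_).mp this
  funext x
  simp only [glOp]; ring

theorem ip_glOp {A : Fin 2 → ℝ × ℝ → ℝ} (hA : IsConn d A) (hφ : IsSec d φ) {ψ : ℝ × ℝ → ℂ}
    (hψ : IsSec d ψ) : ip ψ (glOp α β A φ) =
      ip (cov A 0 ψ) (cov A 0 φ) + ip (cov A 1 ψ) (cov A 1 φ) - α * ip ψ φ +
        β * ip ψ (fun x => ((‖φ x‖ ^ 2 : ℝ) : ℂ) * φ x) := by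
  have e : glOp α β A φ = fun x => ((- (cov A 0 (cov A 0 φ) x + cov A 1 (cov A 1 φ) x)) -
      (α : ℂ) * φ x) + (β : ℂ) * (((‖φ x‖ ^ 2 : ℝ) : ℂ) * φ x) := by
    funext x; simp only [glOp]; ring
  have c0 := ((hφ.cov hA 0).cov hA 0)
  have c1 := ((hφ.cov hA 1).cov hA 1)
  have cn := (isSec_norm_sq_mul hφ)
  rw [e, ip_add hψ.continuous ((c0.add c1).neg.sub (hφ.const_mul _)).continuous
    (cn.const_mul _).continuous, ip_sub hψ.continuous (c0.add c1).neg.continuous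
    (hφ.const_mul _).continuous, ip_neg, ip_add hψ.continuous c0.continuous c1.continuous,
    ip_const_mul, ip_const_mul, ip_cov hA hψ (hφ.cov hA 0), ip_cov hA hψ (hφ.cov hA 1)]
  ring

theorem re_ip_glOp_eq_zero (hB : IsSec 0 B) (hφ : IsSec d φ) {ψ : ℝ × ℝ → ℂ} (hψ : IsSec d ψ)
    (hmin : ∀ t : ℝ, sqInt (density α β d B φ) ≤
      sqInt (density α β d B (fun x => φ x + (t : ℂ) * ψ x))) :
    (ip ψ (glOp α β (conn d B) φ)).re = 0 := by
  set A := conn d B with hAd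
  have hA : IsConn d A := isConn_conn d hB
  have cB0 := (hB.bgcov 0).continuous
  have cB1 := (hB.bgcov 1).continuous
  have cφ := hφ.continuous
  have cψ := hψ.continuous
  have f0 := (hφ.cov hA 0).continuous
  have f1 := (hφ.cov hA 1).continuous
  have g0 := (hψ.cov hA 0).continuous
  have g1 := (hψ.cov hA 1).continuous
  have key := first_variation
    (p0 := density α β d B φ)
    (p1 := fun x => 2 * ((starRingEnd ℂ) (cov A 0 ψ x) * cov A 0 φ x).re +
      2 * ((starRingEnd ℂ) (cov A 1 ψ x) * cov A 1 φ x).re -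
      α * (2 * ((starRingEnd ℂ) (ψ x) * φ x).re) +
      β * (2 * ((starRingEnd ℂ) (ψ x) * (((‖φ x‖ ^ 2 : ℝ) : ℂ) * φ x)).re))
    (p2 := fun x => ‖cov A 0 ψ x‖ ^ 2 + ‖cov A 1 ψ x‖ ^ 2 - α * ‖ψ x‖ ^ 2 +
      β / 2 * ((2 * ((starRingEnd ℂ) (ψ x) * φ x).re) ^ 2 + 2 * (‖φ x‖ ^ 2 * ‖ψ x‖ ^ 2)))
    (p3 := fun x => β / 2 * (2 * (2 * ((starRingEnd ℂ) (ψ x) * φ x).re) * ‖ψ x‖ ^ 2))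
    (p4 := fun x => β / 2 * ‖ψ x‖ ^ 4)
    (F := fun t : ℝ => sqInt (density α β d B (fun x => φ x + (t : ℂ) * ψ x)))
    (by unfold density; fun_prop) (by fun_prop) (by fun_prop) (by fun_prop) (by fun_prop)
    (by simpa using hmin) (fun t => by
      congr 1; funext x
      have e : ∀ j, cov (conn d B) j (fun x => φ x + (t : ℂ) * ψ x) x =
          cov A j φ x + t * cov A j ψ x := fun j => by
        rw [cov_add hφ.smooth (hψ.const_mul _).smooth, cov_const_mul _ hψ.smooth]
      have hr : ((starRingEnd ℂ) (ψ x) * (((‖φ x‖ ^ 2 : ℝ) : ℂ) * φ x)).re =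
          ‖φ x‖ ^ 2 * ((starRingEnd ℂ) (ψ x) * φ x).re := by
        rw [← re_ofReal_mul]; ring_nf
      have q4 : ∀ z : ℂ, ‖z‖ ^ 4 = (‖z‖ ^ 2) ^ 2 := fun z => by ring
      simp only [density, e, q4 (φ x + t * ψ x), norm_add_real_mul_sq, hr]
      ring)
  rw [sqInt_add (by fun_prop) (by fun_prop), sqInt_sub (by fun_prop) (by fun_prop),
    sqInt_add (by fun_prop) (by fun_prop), sqInt_pairing_re g0 f0, sqInt_pairing_re g1 f1,
    sqInt_const_mul α, sqInt_const_mul β, sqInt_pairing_re cψ cφ,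
    sqInt_pairing_re cψ (by fun_prop)] at key
  rw [ip_glOp hA hφ hψ]
  simp only [add_re, sub_re, re_ofReal_mul]
  linarith

theorem isSec_currentC {A : Fin 2 → ℝ × ℝ → ℝ} (hA : IsConn d A) (hφ : IsSec d φ) :
    IsSec 0 (currentC A φ) :=
  (isPer_current hA hφ 0).ofReal.add ((isPer_current hA hφ 1).ofReal.const_mul Complex.I)

theorem re_ip_lap_add_current_eq_zero (hB : IsSec 0 B) (hφ : IsSec d φ) {C : ℝ × ℝ → ℂ}
    (hC : IsSec 0 C)
    (hmin : ∀ t : ℝ, sqInt (density α β d B φ) ≤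
      sqInt (density α β d (fun x => B x + (t : ℂ) * C x) φ)) :
    (ip C (fun x => lap 0 B x + currentC (conn d B) φ x)).re = 0 := by
  set A := conn d B with hAd
  have hA : IsConn d A := isConn_conn d hB
  have cB0 := (hB.bgcov 0).continuous
  have cB1 := (hB.bgcov 1).continuous
  have cC := hC.continuous
  have cC0 := (hC.bgcov 0).continuous
  have cC1 := (hC.bgcov 1).continuous
  have cφ := hφ.continuous
  have f0 := (hφ.cov hA 0).continuous
  have f1 := (hφ.cov hA 1).continuous
  have k0 := (isPer_coef hC 0).continuous
  have k1 := (isPer_coef hC 1).continuous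
  have j0 := (isPer_current hA hφ 0).continuous
  have j1 := (isPer_current hA hφ 1).continuous
  have cJ := (isSec_currentC hA hφ).continuous
  have key := first_variation
    (p0 := density α β d B φ)
    (p1 := fun x => 2 * ((starRingEnd ℂ) (cov (bg 0) 0 C x) * cov (bg 0) 0 B x).re +
      2 * ((starRingEnd ℂ) (cov (bg 0) 1 C x) * cov (bg 0) 1 B x).re +
      2 * ((starRingEnd ℂ) (C x) * currentC A φ x).re)
    (p2 := fun x => ‖cov (bg 0) 0 C x‖ ^ 2 + ‖cov (bg 0) 1 C x‖ ^ 2 +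
      ‖Complex.I * coef C 0 x * φ x‖ ^ 2 + ‖Complex.I * coef C 1 x * φ x‖ ^ 2)
    (p3 := fun _ => 0) (p4 := fun _ => 0)
    (F := fun t : ℝ => sqInt (density α β d (fun x => B x + (t : ℂ) * C x) φ))
    (by unfold density; fun_prop) (by fun_prop) (by fun_prop) (by fun_prop) (by fun_prop)
    (by simpa using hmin) (fun t => by
      congr 1; funext x
      have e : ∀ j, cov (bg 0) j (fun x => B x + (t : ℂ) * C x) x =
          cov (bg 0) j B x + t * cov (bg 0) j C x := fun j => by
        rw [cov_add hB.smooth (hC.const_mul _).smooth, cov_const_mul _ hC.smooth]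
      have e' : ∀ j, cov (conn d (fun x => B x + (t : ℂ) * C x)) j φ x =
          cov A j φ x + t * (Complex.I * coef C j x * φ x) := fun j => by
        rw [cov_conn, hAd, cov_conn, coef_add, coef_real_mul]
        push_cast; ring
      have hr : ∀ j, ((starRingEnd ℂ) (Complex.I * coef C j x * φ x) * cov A j φ x).re =
          coef C j x * current A φ j x := fun j => by
        simp [current]; ring
      have hc : ((starRingEnd ℂ) (C x) * currentC A φ x).re =
          coef C 0 x * current A φ 0 x + coef C 1 x * current A φ 1 x := by
        simp [currentC, coef]
      simp only [density, e, e', norm_add_real_mul_sq, hr, hc]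
      ring)
  rw [sqInt_add (by fun_prop) (by fun_prop), sqInt_add (by fun_prop) (by fun_prop),
    sqInt_pairing_re cC0 cB0, sqInt_pairing_re cC1 cB1, sqInt_pairing_re hC.continuous cJ] at key
  rw [ip_add hC.continuous hB.lap.continuous cJ, ip_lap hC hB]
  simp only [add_re]
  linarith

end EulerLagrange

/-! ### Galerkin minimizers -/

theorem continuous_sqInt_param {X : Type*} [TopologicalSpace X] [FirstCountableTopology X]
    [LocallyCompactSpace X]
    {f : X → ℝ × ℝ → ℝ} (hf : Continuous fun p : X × (ℝ × ℝ) => f p.1 p.2) :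
    Continuous fun c => sqInt (f c) := by
  unfold sqInt
  exact continuous_parametric_integral_of_continuous hf isCompact_unitSquare

theorem IsSec.sum {d : ℤ} {n : ℕ} {e : Fin n → ℝ × ℝ → ℂ} (he : ∀ i, IsSec d (e i))
    (c : Fin n → ℂ) (s : Finset (Fin n)) : IsSec d (fun x => ∑ i ∈ s, c i * e i x) := by
  classical
  induction s using Finset.induction_on with
  | empty => simpa using isSec_zero d
  | insert a s ha ih =>
    simp only [Finset.sum_insert ha]
    exact ((he a).const_mul _).add ih

theorem cov_sum {d : ℤ} {n : ℕ} {e : Fin n → ℝ × ℝ → ℂ} (he : ∀ i, IsSec d (e i))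
    (A : Fin 2 → ℝ × ℝ → ℝ) (j : Fin 2)
    (c : Fin n → ℂ) (s : Finset (Fin n)) (x : ℝ × ℝ) :
    cov A j (fun x => ∑ i ∈ s, c i * e i x) x = ∑ i ∈ s, c i * cov A j (e i) x := by
  classical
  induction s using Finset.induction_on with
  | empty => simp [cov, pd_const]
  | insert a s ha ih =>
    simp only [Finset.sum_insert ha]
    rw [cov_add ((he a).const_mul _).smooth (IsSec.sum he c s).smooth,
      cov_const_mul _ (he a).smooth, ih]

theorem exists_coercive_const {n : ℕ} {f : (Fin n → ℂ) → ℝ} (hf : Continuous f)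
    (hpos : ∀ c, c ≠ 0 → 0 < f c) (hhom : ∀ (t : ℝ) c, f (fun i => (t : ℂ) * c i) = t ^ 2 * f c) :
    ∃ m > 0, ∀ c, m * ‖c‖ ^ 2 ≤ f c := by
  have hz : f 0 = 0 := by simpa [← Pi.zero_def] using hhom 0 0
  have hscale : ∀ c : Fin n → ℂ, c ≠ 0 →
      ∃ b ∈ Metric.sphere (0 : Fin n → ℂ) 1, f c = ‖c‖ ^ 2 * f b := fun c hc => by
    have hn : ‖c‖ ≠ 0 := norm_ne_zero_iff.mpr hc
    refine ⟨fun i => ((‖c‖⁻¹ : ℝ) : ℂ) * c i, ?_, ?_⟩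
    · have e : (fun i => ((‖c‖⁻¹ : ℝ) : ℂ) * c i) = ((‖c‖⁻¹ : ℝ) : ℂ) • c := rfl
      rw [mem_sphere_zero_iff_norm, e, norm_smul, norm_real, norm_inv, norm_norm,
        inv_mul_cancel₀ hn]
    · rw [hhom]; field_simp
  rcases (Metric.sphere (0 : Fin n → ℂ) 1).eq_empty_or_nonempty with he | hne
  · refine ⟨1, one_pos, fun c => ?_⟩
    by_cases hc : c = 0
    · simp [hc, hz]
    · obtain ⟨b, hb, -⟩ := hscale c hc
      simp [he] at hb
  · obtain ⟨b, hb, hmin⟩ := (isCompact_sphere (0 : Fin n → ℂ) 1).exists_isMinOn hne hf.continuousOn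
    refine ⟨f b, hpos b fun h => by simp [h] at hb, fun c => ?_⟩
    by_cases hc : c = 0
    · simp [hc, hz]
    · obtain ⟨b', hb', e⟩ := hscale c hc
      rw [e, mul_comm]
      exact mul_le_mul_of_nonneg_left (hmin hb') (sq_nonneg _)

/-- Coordinates on the spaces of a Galerkin system. -/
theorem GalerkinSystem.exists_coordinates {d : ℤ} (V : GalerkinSystem d) (N : ℕ) :
    ∃ (n : ℕ) (U : (Fin n → ℂ) → ℝ × ℝ → ℂ), (∀ c, U c ∈ V.space N) ∧
      (∀ u ∈ V.space N, ∃ c, U c = u) ∧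
      (Continuous fun p : (Fin n → ℂ) × (ℝ × ℝ) => U p.1 p.2) ∧
      (∀ j, Continuous fun p : (Fin n → ℂ) × (ℝ × ℝ) => cov (bg d) j (U p.1) p.2) ∧
      ∃ m > 0, ∀ c, m * ‖c‖ ^ 2 ≤ nsq (U c) := by
  have := V.finite N
  let b := Module.finBasis ℂ (V.space N)
  have hb : ∀ i, IsSec d ((b i : ℝ × ℝ → ℂ)) := fun i => V.isSec N _ (b i).2
  let U : (Fin (Module.finrank ℂ (V.space N)) → ℂ) → ℝ × ℝ → ℂ :=
    fun c x => ∑ i, c i * (b i : ℝ × ℝ → ℂ) x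
  have hU : ∀ c, U c = ((∑ i, c i • b i : V.space N) : ℝ × ℝ → ℂ) := fun c => by
    funext x
    simp [U, Finset.sum_apply]
  have hmem : ∀ c, U c ∈ V.space N := fun c => by rw [hU]; exact Subtype.property _
  have hcont : Continuous fun p : (Fin (Module.finrank ℂ (V.space N)) → ℂ) × (ℝ × ℝ) =>
      U p.1 p.2 := by
    refine continuous_finsetSum _ fun i _ => ?_
    have := (hb i).continuous
    fun_prop
  refine ⟨_, U, hmem, fun u hu => ?_, hcont, fun j => ?_, ?_⟩
  · refine ⟨fun i => b.repr ⟨u, hu⟩ i, ?_⟩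
    rw [hU, b.sum_repr]
  · simp only [U, cov_sum hb]
    refine continuous_finsetSum _ fun i _ => ?_
    have := ((hb i).bgcov j).continuous
    exact ((continuous_apply i).comp continuous_fst).mul (this.comp continuous_snd)
  · refine exists_coercive_const (f := fun c => nsq (U c)) ?_ (fun c hc => ?_) fun t c => ?_
    · exact continuous_sqInt_param (f := fun c x => ‖U c x‖ ^ 2) (by fun_prop)
    · refine lt_of_le_of_ne (nsq_nonneg _) fun h => hc ?_
      have h0 := (V.isSec N _ (hmem c)).eq_zero_of_nsq h.symm
      have h1 : (∑ i, c i • b i : V.space N) = 0 := by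
        apply Subtype.ext
        rw [← hU]
        funext x; exact h0 x
      funext i
      exact Fintype.linearIndependent_iff.mp b.linearIndependent c h1 i
    · have e : U (fun i => (t : ℂ) * c i) = fun x => (t : ℂ) * U c x := by
        funext x; simp only [U, Finset.mul_sum, mul_assoc]
      rw [e, nsq_const_mul]
      simp

theorem quartic_lower_bound {α β : ℝ} (hβ : 0 < β) (s : ℝ) :
    s - (α + 1) ^ 2 / (2 * β) ≤ - α * s + β / 2 * s ^ 2 := by
  have : 0 ≤ β / 2 * (s - (α + 1) / β) ^ 2 := by positivity
  have e : β / 2 * (s - (α + 1) / β) ^ 2 =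
      β / 2 * s ^ 2 - (α + 1) * s + (α + 1) ^ 2 / (2 * β) := by field_simp; ring
  linarith

section

variable {α β : ℝ} {d : ℤ} {B φ : ℝ × ℝ → ℂ}

/-- Sum of the squared norms of the covariant derivatives for a perturbed connection. -/
def kin (d : ℤ) (B φ : ℝ × ℝ → ℂ) : ℝ :=
  nsq (cov (conn d B) 0 φ) + nsq (cov (conn d B) 1 φ)

theorem kin_nonneg (d : ℤ) (B φ : ℝ × ℝ → ℂ) : 0 ≤ kin d B φ :=
  add_nonneg (nsq_nonneg _) (nsq_nonneg _)

theorem sqInt_density (hB : IsSec 0 B) (hφ : IsSec d φ) :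
    sqInt (density α β d B φ) = grad2 0 B + kin d B φ - α * nsq φ +
      β / 2 * sqInt fun x => ‖φ x‖ ^ 4 := by
  have cB0 := (hB.bgcov 0).continuous
  have cB1 := (hB.bgcov 1).continuous
  have cφ := hφ.continuous
  have f0 := (hφ.cov (isConn_conn d hB) 0).continuous
  have f1 := (hφ.cov (isConn_conn d hB) 1).continuous
  unfold density
  rw [sqInt_add (by fun_prop) (by fun_prop), sqInt_sub (by fun_prop) (by fun_prop),
    sqInt_add (by fun_prop) (by fun_prop), sqInt_add (by fun_prop) (by fun_prop),
    sqInt_add (by fun_prop) (by fun_prop), sqInt_const_mul, sqInt_const_mul]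
  simp only [grad2, kin, nsq]
  ring

theorem sqInt_potential_ge (hβ : 0 < β) (hφ : IsSec d φ) :
    nsq φ - (α + 1) ^ 2 / (2 * β) ≤ - α * nsq φ + β / 2 * sqInt fun x => ‖φ x‖ ^ 4 := by
  have cφ := hφ.continuous
  have := sqInt_mono (f := fun x => ‖φ x‖ ^ 2 - (α + 1) ^ 2 / (2 * β))
    (g := fun x => - α * ‖φ x‖ ^ 2 + β / 2 * ‖φ x‖ ^ 4) (by fun_prop) (by fun_prop) fun x => by
      have := quartic_lower_bound (α := α) hβ (‖φ x‖ ^ 2)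
      rw [← pow_mul] at this
      exact this
  rw [sqInt_sub (by fun_prop) (by fun_prop), sqInt_const,
    sqInt_add (by fun_prop) (by fun_prop), sqInt_const_mul, sqInt_const_mul] at this
  exact this

theorem grad2_zero_eq (B : ℝ × ℝ → ℂ) :
    grad2 0 B = (sqInt fun y => ‖pd 0 B y‖ ^ 2) + sqInt fun y => ‖pd 1 B y‖ ^ 2 := by
  simp [grad2, nsq, cov, bg]

theorem nsq_le_grad2 (hB : IsSec 0 B) (h0 : sqInt B = 0) : nsq B ≤ 2 * grad2 0 B := by
  rw [grad2_zero_eq]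
  exact poincare hB.smooth h0

theorem sqInt_density_ge (hβ : 0 < β) (hB : IsSec 0 B) (hφ : IsSec d φ) (h0 : sqInt B = 0) :
    1 / 2 * nsq B + nsq φ - (α + 1) ^ 2 / (2 * β) ≤ sqInt (density α β d B φ) := by
  rw [sqInt_density hB hφ]
  have := sqInt_potential_ge (α := α) hβ hφ
  linarith [nsq_le_grad2 hB h0, kin_nonneg d B φ]

theorem exists_galerkin_minimizer (hβ : 0 < β) (W : GalerkinSystem 0) (V : GalerkinSystem d)
    (hW : ∀ N, ∀ B ∈ W.space N, sqInt B = 0) (N : ℕ) :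
    ∃ B ∈ W.space N, ∃ φ ∈ V.space N, ∀ B' ∈ W.space N, ∀ φ' ∈ V.space N,
      sqInt (density α β d B φ) ≤ sqInt (density α β d B' φ') := by
  obtain ⟨n, U, hU, hUs, cU, cU', m, m0, hm⟩ := W.exists_coordinates N
  obtain ⟨n', U', hU', hUs', cV, cV', m', m0', hm'⟩ := V.exists_coordinates N
  let F : (Fin n → ℂ) × (Fin n' → ℂ) → ℝ := fun c => sqInt (density α β d (U c.1) (U' c.2))
  have hF : Continuous F := by
    refine continuous_sqInt_param (f := fun c : (Fin n → ℂ) × (Fin n' → ℂ) =>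
      density α β d (U c.1) (U' c.2)) ?_
    have q : Continuous fun p : ((Fin n → ℂ) × (Fin n' → ℂ)) × (ℝ × ℝ) => (p.1.1, p.2) := by
      fun_prop
    have q' : Continuous fun p : ((Fin n → ℂ) × (Fin n' → ℂ)) × (ℝ × ℝ) => (p.1.2, p.2) := by
      fun_prop
    have a := cU.comp q
    have a0 := (cU' 0).comp q
    have a1 := (cU' 1).comp q
    have b := cV.comp q'
    have b0 := (cV' 0).comp q'
    have b1 := (cV' 1).comp q'
    simp only [Function.comp_def] at a a0 a1 b b0 b1
    have k0 : Continuous fun p : ((Fin n → ℂ) × (Fin n' → ℂ)) × (ℝ × ℝ) =>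
        (coef (U p.1.1) 0 p.2 : ℂ) := continuous_ofReal.comp (continuous_re.comp a)
    have k1 : Continuous fun p : ((Fin n → ℂ) × (Fin n' → ℂ)) × (ℝ × ℝ) =>
        (coef (U p.1.1) 1 p.2 : ℂ) := continuous_ofReal.comp (continuous_im.comp a)
    simp only [density, cov_conn]
    have e0 := b0.add ((continuous_const (y := Complex.I)).mul k0 |>.mul b)
    have e1 := b1.add ((continuous_const (y := Complex.I)).mul k1 |>.mul b)
    exact (((((a0.norm.pow 2).add (a1.norm.pow 2)).add (e0.norm.pow 2)).add (e1.norm.pow 2)).sub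
      (continuous_const.mul (b.norm.pow 2))).add (continuous_const.mul (b.norm.pow 4))
  set K := (α + 1) ^ 2 / (2 * β) with hK
  have hlow : ∀ c, 1 / 2 * (m * ‖c.1‖ ^ 2) + m' * ‖c.2‖ ^ 2 - K ≤ F c := fun c => by
    have := sqInt_density_ge (α := α) hβ (W.isSec N _ (hU c.1)) (V.isSec N _ (hU' c.2))
      (hW N _ (hU c.1))
    have h1 := hm c.1
    have h2 := hm' c.2
    simp only [F]
    linarith
  set μ := min (1 / 2 * m) m' with hμ
  have μ0 : 0 < μ := lt_min (by positivity) m0'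
  have hlow' : ∀ c, μ * ‖c‖ ^ 2 - K ≤ F c := fun c => by
    refine le_trans ?_ (hlow c)
    have l1 : μ ≤ 1 / 2 * m := min_le_left _ _
    have l2 : μ ≤ m' := min_le_right _ _
    rw [Prod.norm_def]
    rcases max_cases ‖c.1‖ ‖c.2‖ with ⟨h, -⟩ | ⟨h, -⟩
    · rw [h]
      have := mul_le_mul_of_nonneg_right l1 (sq_nonneg ‖c.1‖)
      have : 0 ≤ m' * ‖c.2‖ ^ 2 := by positivity
      linarith
    · rw [h]
      have := mul_le_mul_of_nonneg_right l2 (sq_nonneg ‖c.2‖)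
      have : 0 ≤ m * ‖c.1‖ ^ 2 := by positivity
      linarith
  obtain ⟨c, hc⟩ := hF.exists_forall_le' 0 (by
    have hcomp : (Metric.closedBall (0 : (Fin n → ℂ) × (Fin n' → ℂ))
        √((F 0 + K) / μ))ᶜ ∈ Filter.cocompact _ :=
      (isCompact_closedBall _ _).compl_mem_cocompact
    filter_upwards [hcomp] with c hc
    have hc' : √((F 0 + K) / μ) < ‖c‖ := by simpa using hc
    have := Real.lt_sq_of_sqrt_lt hc'
    rw [div_lt_iff₀ μ0] at this
    linarith [hlow' c])
  refine ⟨U c.1, hU _, U' c.2, hU' _, fun B' hB' φ' hφ' => ?_⟩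
  obtain ⟨c1, rfl⟩ := hUs B' hB'
  obtain ⟨c2, rfl⟩ := hUs' φ' hφ'
  exact hc (c1, c2)

end

/-! ### The sequence of Galerkin minimizers -/

/-- A sequence of solutions of the projected Euler-Lagrange equations with energy bounds. -/
structure GalerkinSequence (α β : ℝ) {d : ℤ} (W : GalerkinSystem 0) (V : GalerkinSystem d)
    (B φ : ℕ → ℝ × ℝ → ℂ) (K : ℝ) : Prop where
  memB : ∀ N, B N ∈ W.space N
  memφ : ∀ N, φ N ∈ V.space N
  mean : ∀ N, sqInt (B N) = 0
  bound_grad : ∀ N, grad2 0 (B N) ≤ K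
  bound_kin : ∀ N, kin d (B N) (φ N) ≤ K
  bound_nsq : ∀ N, nsq (φ N) ≤ K
  bound_four : ∀ N, (sqInt fun x => ‖φ N x‖ ^ 4) ≤ K
  eqφ : ∀ N, ∀ ψ ∈ V.space N, ip ψ (glOp α β (conn d (B N)) (φ N)) = 0
  eqB : ∀ N, ∀ C ∈ W.space N,
    ip C (fun x => lap 0 (B N) x + currentC (conn d (B N)) (φ N) x) = 0

theorem eq_zero_of_re_ip {S : Submodule ℂ (ℝ × ℝ → ℂ)} {G : ℝ × ℝ → ℂ}
    (h : ∀ ψ ∈ S, (ip ψ G).re = 0) : ∀ ψ ∈ S, ip ψ G = 0 := fun ψ hψ => by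
  have h1 := h ψ hψ
  have h2 := h _ (S.smul_mem Complex.I hψ)
  have e : (Complex.I • ψ) = fun x => Complex.I * ψ x := rfl
  rw [e, ip_const_mul_left] at h2
  apply Complex.ext
  · simpa using h1
  · simpa using h2

section

variable {α β : ℝ} {d : ℤ}

theorem conn_zero (d : ℤ) : conn d (fun _ => 0) = bg d := by
  funext j x; simp [conn, coef]

theorem exists_negative_energy (hβ : 0 < β) {θ : ℝ × ℝ → ℂ} (hθ : IsSec d θ)
    (hg : grad2 d θ < α * nsq θ) :
    ∃ s : ℝ, sqInt (density α β d (fun _ => 0) (fun x => (s : ℂ) * θ x)) < 0 := by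
  set q := β / 2 * sqInt fun x => ‖θ x‖ ^ 4 with hq
  have q0 : 0 ≤ q := mul_nonneg (by positivity) (sqInt_nonneg fun _ => by positivity)
  set p := α * nsq θ - grad2 d θ with hp
  have p0 : 0 < p := sub_pos.mpr hg
  refine ⟨√(p / (2 * q + 1)), ?_⟩
  set s := √(p / (2 * q + 1)) with hs
  have hs2 : s ^ 2 = p / (2 * q + 1) := Real.sq_sqrt (by positivity)
  rw [sqInt_density (isSec_zero 0) (hθ.const_mul _)]
  have e0 : grad2 0 (fun _ => 0) = 0 := by
    simp [grad2_zero_eq, pd_const, sqInt_const]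
  have e1 : kin d (fun _ => 0) (fun x => (s : ℂ) * θ x) = s ^ 2 * grad2 d θ := by
    have c : ∀ j, cov (bg d) j (fun x => (s : ℂ) * θ x) = fun x => (s : ℂ) * cov (bg d) j θ x :=
      fun j => funext fun x => cov_const_mul _ hθ.smooth j x
    simp only [kin, conn_zero, c, nsq_const_mul, grad2, norm_real, Real.norm_eq_abs, sq_abs]
    ring
  have e2 : (sqInt fun x => ‖(s : ℂ) * θ x‖ ^ 4) = s ^ 4 * sqInt fun x => ‖θ x‖ ^ 4 := by
    rw [← sqInt_const_mul]
    congr 1; funext x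
    rw [norm_mul, mul_pow, norm_real, Real.norm_eq_abs]
    rw [show |s| ^ 4 = (|s| ^ 2) ^ 2 by ring, sq_abs]; ring
  rw [e0, e1, e2, nsq_const_mul, norm_real, Real.norm_eq_abs, sq_abs]
  have e3 : 0 + s ^ 2 * grad2 d θ - α * (s ^ 2 * nsq θ) +
      β / 2 * (s ^ 4 * sqInt fun x => ‖θ x‖ ^ 4) = s ^ 2 * (s ^ 2 * q - p) := by
    rw [hq, hp]; ring
  rw [e3, hs2]
  refine mul_neg_of_pos_of_neg (by positivity) ?_
  have : p / (2 * q + 1) * q < p := by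
    rw [div_mul_eq_mul_div, div_lt_iff₀ (by positivity)]
    nlinarith
  linarith

theorem exists_galerkinSequence (hα : 0 < α) (hβ : 0 < β) (W : GalerkinSystem 0)
    (V : GalerkinSystem d) (hW : ∀ N, ∀ B ∈ W.space N, sqInt B = 0) {θ : ℝ × ℝ → ℂ}
    (hθ : θ ∈ V.space 0) (hg : grad2 d θ < α * nsq θ) :
    ∃ B φ K e, GalerkinSequence α β W V B φ K ∧ 0 < e ∧ ∀ N, e ≤ nsq (φ N) := by
  choose B hB φ hφ hmin using exists_galerkin_minimizer (α := α) hβ W V hW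
  have sB : ∀ N, IsSec 0 (B N) := fun N => W.isSec N _ (hB N)
  have sφ : ∀ N, IsSec d (φ N) := fun N => V.isSec N _ (hφ N)
  obtain ⟨s, hs⟩ := exists_negative_energy (α := α) hβ (V.isSec 0 _ hθ) hg
  set E := sqInt (density α β d (fun _ => 0) (fun x => (s : ℂ) * θ x)) with hE
  have hle : ∀ N, sqInt (density α β d (B N) (φ N)) ≤ E := fun N =>
    hmin N _ (W.space N).zero_mem _
      ((V.space N).smul_mem (s : ℂ) (V.mono (Nat.zero_le N) hθ))
  set K := (α + 1) ^ 2 / (2 * β) with hK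
  have K0 : 0 ≤ K := by positivity
  have four : ∀ N, 0 ≤ sqInt fun x => ‖φ N x‖ ^ 4 := fun N => sqInt_nonneg fun _ => by positivity
  have main : ∀ N, grad2 0 (B N) + kin d (B N) (φ N) + nsq (φ N) ≤ K := fun N => by
    have := hle N
    rw [sqInt_density (sB N) (sφ N)] at this
    linarith [sqInt_potential_ge (α := α) hβ (sφ N)]
  have b1 : ∀ N, grad2 0 (B N) ≤ K := fun N => by
    linarith [main N, kin_nonneg d (B N) (φ N), nsq_nonneg (φ N)]
  have b2 : ∀ N, kin d (B N) (φ N) ≤ K := fun N => by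
    linarith [main N, grad2_nonneg 0 (B N), nsq_nonneg (φ N)]
  have b3 : ∀ N, nsq (φ N) ≤ K := fun N => by
    linarith [main N, grad2_nonneg 0 (B N), kin_nonneg d (B N) (φ N)]
  have b4 : ∀ N, (sqInt fun x => ‖φ N x‖ ^ 4) ≤ 2 * α * K / β := fun N => by
    have := hle N
    rw [sqInt_density (sB N) (sφ N)] at this
    rw [le_div_iff₀ hβ]
    nlinarith [b3 N, grad2_nonneg 0 (B N), kin_nonneg d (B N) (φ N)]
  have kle : K ≤ max K (2 * α * K / β) := le_max_left _ _
  refine ⟨B, φ, max K (2 * α * K / β), - E / α, ⟨hB, hφ, fun N => hW N _ (hB N),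
    fun N => (b1 N).trans kle, fun N => (b2 N).trans kle, fun N => (b3 N).trans kle,
    fun N => (b4 N).trans (le_max_right _ _), fun N => ?_, fun N => ?_⟩,
    div_pos (by linarith) hα, fun N => ?_⟩
  · refine eq_zero_of_re_ip fun ψ hψ => ?_
    refine re_ip_glOp_eq_zero (sB N) (sφ N) (V.isSec N _ hψ) fun t => ?_
    exact hmin N _ (hB N) _ ((V.space N).add_mem (hφ N) ((V.space N).smul_mem (t : ℂ) hψ))
  · refine eq_zero_of_re_ip fun C hC => ?_
    refine re_ip_lap_add_current_eq_zero (α := α) (β := β) (sB N) (sφ N) (W.isSec N _ hC)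
      fun t => ?_
    exact hmin N _ ((W.space N).add_mem (hB N) ((W.space N).smul_mem (t : ℂ) hC)) _ (hφ N)
  · have := hle N
    rw [sqInt_density (sB N) (sφ N)] at this
    rw [div_le_iff₀ hα]
    nlinarith [four N, grad2_nonneg 0 (B N), kin_nonneg d (B N) (φ N),
      mul_nonneg hβ.le (four N)]

/-! ### The nonlinear remainder -/

/-- First-order part of the difference between the perturbed and the background Laplacian. -/
def drift (d : ℤ) (B φ : ℝ × ℝ → ℂ) (j : Fin 2) (x : ℝ × ℝ) : ℂ :=
  Complex.I * (cov (bg 0) j (fun y => (coef B j y : ℂ)) x * φ x) +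
    2 * Complex.I * (cov (bg d) j φ x * (coef B j x : ℂ)) -
    (φ x * (coef B j x : ℂ)) * (coef B j x : ℂ)

/-- The difference between the background Laplacian and the Ginzburg-Landau operator. -/
def remainder (α β : ℝ) (d : ℤ) (B φ : ℝ × ℝ → ℂ) (x : ℝ × ℝ) : ℂ :=
  (drift d B φ 0 x + drift d B φ 1 x) + ((α : ℂ) * φ x - (β : ℂ) * (((‖φ x‖ ^ 2 : ℝ) : ℂ) * φ x))

theorem cov_cov_conn {B φ : ℝ × ℝ → ℂ} (hB : IsSec 0 B) (hφ : IsSec d φ) (j : Fin 2)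
    (x : ℝ × ℝ) : cov (conn d B) j (cov (conn d B) j φ) x =
      cov (bg d) j (cov (bg d) j φ) x + drift d B φ j x := by
  have e : cov (conn d B) j φ = fun x => cov (bg d) j φ x +
      Complex.I * ((coef B j x : ℂ) * φ x) := by
    funext x; rw [cov_conn]; ring
  have sb : IsSec 0 (fun y => (coef B j y : ℂ)) := (isPer_coef hB j).ofReal
  have sbφ : IsSec d (fun y => (coef B j y : ℂ) * φ y) := sb.mul hφ (by ring)
  rw [cov_conn, e, cov_add (hφ.bgcov j).smooth (sbφ.const_mul _).smooth,
    cov_const_mul _ sbφ.smooth, cov_bg_mul (d := 0) (e := d) (by ring) sb.smooth hφ.smooth]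
  simp only [drift]
  linear_combination (- (coef B j x : ℂ) ^ 2 * φ x) * (-Complex.I_sq)

theorem glOp_conn {B φ : ℝ × ℝ → ℂ} (hB : IsSec 0 B) (hφ : IsSec d φ) (x : ℝ × ℝ) :
    glOp α β (conn d B) φ x = lap d φ x - remainder α β d B φ x := by
  simp only [glOp, cov_cov_conn hB hφ, lap, remainder]
  ring

end

/-! ### Uniform Sobolev bounds for Galerkin minimizers -/

section Growth

variable {u v : ℕ → ℝ × ℝ → ℂ} {Y : ℕ → ℝ}

/-- The squared `L²` norms of the family grow at most linearly in `Y`. -/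
def GrowthLe (Y : ℕ → ℝ) (u : ℕ → ℝ × ℝ → ℂ) : Prop :=
  (∀ N, Continuous (u N)) ∧ ∃ C, 0 ≤ C ∧ ∀ N, nsq (u N) ≤ C * Y N

theorem GrowthLe.add (hu : GrowthLe Y u) (hv : GrowthLe Y v) :
    GrowthLe Y (fun N x => u N x + v N x) := by
  obtain ⟨cu, C, p, h⟩ := hu
  obtain ⟨cv, C', p', h'⟩ := hv
  refine ⟨fun N => (cu N).add (cv N), 2 * C + 2 * C', by positivity, fun N => ?_⟩
  refine (nsq_add_le (cu N) (cv N)).trans ?_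
  linarith [h N, h' N]

theorem GrowthLe.const_mul (c : ℂ) (hu : GrowthLe Y u) : GrowthLe Y (fun N x => c * u N x) := by
  obtain ⟨cu, C, p, h⟩ := hu
  refine ⟨fun N => (cu N).const_mul c, ‖c‖ ^ 2 * C, by positivity, fun N => ?_⟩
  rw [nsq_const_mul, mul_assoc]
  exact mul_le_mul_of_nonneg_left (h N) (sq_nonneg _)

theorem GrowthLe.sub (hu : GrowthLe Y u) (hv : GrowthLe Y v) :
    GrowthLe Y (fun N x => u N x - v N x) := by
  simpa only [sub_eq_add_neg, neg_one_mul] using hu.add (hv.const_mul (-1))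

theorem GrowthLe.of_bound (hu : ∀ N, Continuous (u N)) (hY : ∀ N, 1 ≤ Y N) {C : ℝ} (hC : 0 ≤ C)
    (h : ∀ N, nsq (u N) ≤ C) : GrowthLe Y u :=
  ⟨hu, C, hC, fun N => (h N).trans (le_mul_of_one_le_right hC (hY N))⟩

theorem GrowthLe.mul_of_sup (hu : ∀ N, Continuous (u N)) (hv : ∀ N, Continuous (v N))
    {C D : ℝ} (hC : 0 ≤ C) (h : ∀ N, nsq (u N) ≤ C) (hD : 0 ≤ D) (hY : ∀ N, 0 ≤ Y N)
    (hs : ∀ N x, ‖v N x‖ ^ 2 ≤ D * Y N) : GrowthLe Y (fun N x => u N x * v N x) := by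
  refine ⟨fun N => (hu N).mul (hv N), D * C, by positivity, fun N => ?_⟩
  refine (nsq_mul_le (hu N) (hv N) (hs N)).trans ?_
  have := mul_le_mul_of_nonneg_left (h N) (mul_nonneg hD (hY N))
  linarith

end Growth

theorem nsq_mul_le_sqrt {u v : ℝ × ℝ → ℂ} (hu : Continuous u) (hv : Continuous v) {C D : ℝ}
    (hD : 0 ≤ D) (h : (sqInt fun x => ‖u x‖ ^ 4) ≤ C) (h' : (sqInt fun x => ‖v x‖ ^ 4) ≤ D ^ 2) :
    nsq (fun x => u x * v x) ≤ √C * D := by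
  have h0 : 0 ≤ sqInt fun x => ‖v x‖ ^ 4 := sqInt_nonneg fun _ => by positivity
  have h1 : 0 ≤ sqInt fun x => ‖u x‖ ^ 4 := sqInt_nonneg fun _ => by positivity
  refine le_of_sq_le_sq ?_ (by positivity)
  rw [mul_pow, Real.sq_sqrt (h1.trans h)]
  exact (nsq_mul_sq_le hu hv).trans (mul_le_mul h h' h0 (h1.trans h))

theorem le_of_le_mul_one_add_sqrt {X C : ℝ} (hX : 0 ≤ X)
    (h : X ≤ C * (1 + √X)) : X ≤ 2 * C + C ^ 2 := by
  have hs := Real.sq_sqrt hX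
  nlinarith [sq_nonneg (√X - C)]

theorem Bdd.coef {k : ℕ} {B : ℕ → ℝ × ℝ → ℂ} (hB : Bdd 0 k B) (j : Fin 2) :
    Bdd 0 k (fun N x => (GinzburgLandau.coef (B N) j x : ℂ)) := by
  fin_cases j
  · exact hB.re
  · exact hB.im

section

variable {d : ℤ} {k : ℕ} {B φ : ℕ → ℝ × ℝ → ℂ}

theorem Bdd.norm_sq_mul (hφ : Bdd d k φ) (hφ' : Bdd d (max k 2) φ) :
    Bdd d k (fun N x => ((‖φ N x‖ ^ 2 : ℝ) : ℂ) * φ N x) := by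
  have h1 := (hφ.conj rfl).mul (f := 0) (by ring) hφ'
  have h2 := h1.mul (f := d) (by ring) hφ'
  refine (congrArg (Bdd d k) ?_).mp h2
  funext N x
  rw [mul_comm ((starRingEnd ℂ) (φ N x)), Complex.mul_conj, Complex.normSq_eq_norm_sq]

theorem Bdd.drift (hB : Bdd 0 (k + 2) B) (hφ : Bdd d (k + 2) φ) (j : Fin 2) :
    Bdd d (k + 1) (fun N => GinzburgLandau.drift d (B N) (φ N) j) := by
  have hb := hB.coef j
  have m2 : max (k + 1) 2 ≤ k + 2 := by omega
  have t1 := (hb.cov j).mul (f := d) (by ring) (hφ.mono m2)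
  have t2 := (hφ.cov j).mul (f := d) (by ring) (hb.mono m2)
  have t3 := (hφ.of_succ.mul (f := d) (by ring) (hb.mono m2)).mul (f := d) (by ring) (hb.mono m2)
  exact ((t1.const_mul Complex.I).add (t2.const_mul (2 * Complex.I))).sub t3

theorem Bdd.remainder (α β : ℝ) (hB : Bdd 0 (k + 2) B) (hφ : Bdd d (k + 2) φ) :
    Bdd d (k + 1) (fun N => GinzburgLandau.remainder α β d (B N) (φ N)) :=
  ((hB.drift hφ 0).add (hB.drift hφ 1)).add ((hφ.of_succ.const_mul _).sub
    ((hφ.of_succ.norm_sq_mul (hφ.mono (by omega))).const_mul _))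

theorem Bdd.cov_conn (hB : Bdd 0 (k + 1) B) (hφ : Bdd d (k + 2) φ) (j : Fin 2) :
    Bdd d (k + 1) (fun N => GinzburgLandau.cov (conn d (B N)) j (φ N)) := by
  have := (hφ.cov j).add
    (((hB.coef j).mul (f := d) (by ring) (hφ.mono (by omega))).const_mul Complex.I)
  refine (congrArg (Bdd d (k + 1)) ?_).mp this
  funext N x
  rw [GinzburgLandau.cov_conn]; ring

theorem Bdd.currentC (hB : Bdd 0 (k + 1) B) (hφ : Bdd d (k + 2) φ) :
    Bdd 0 (k + 1) (fun N => GinzburgLandau.currentC (conn d (B N)) (φ N)) := by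
  have h : ∀ j, Bdd 0 (k + 1) (fun N x => (current (conn d (B N)) (φ N) j x : ℂ)) := fun j => by
    have := ((hB.cov_conn hφ j).mul (f := 0) (by ring)
      ((hφ.mono (by omega : max (k + 1) 2 ≤ k + 2)).conj rfl)).im
    refine (congrArg (Bdd 0 (k + 1)) ?_).mp this
    funext N x
    simp only [current, mul_comm]
  exact (h 0).add ((h 1).const_mul Complex.I)

end

namespace GalerkinSequence

variable {α β : ℝ} {d : ℤ} {W : GalerkinSystem 0} {V : GalerkinSystem d}
  {B φ : ℕ → ℝ × ℝ → ℂ} {K : ℝ}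

theorem secB (h : GalerkinSequence α β W V B φ K) (N : ℕ) : IsSec 0 (B N) := W.isSec N _ (h.memB N)

theorem secφ (h : GalerkinSequence α β W V B φ K) (N : ℕ) : IsSec d (φ N) := V.isSec N _ (h.memφ N)

theorem bdd_one_B (h : GalerkinSequence α β W V B φ K) : Bdd 0 1 B := by
  have h0 : Bdd 0 0 B := ⟨h.secB, 2 * K, fun N =>
    (nsq_le_grad2 (h.secB N) (h.mean N)).trans (by linarith [h.bound_grad N])⟩
  exact h0.of_grad2 h.bound_grad

theorem bdd_one_φ (h : GalerkinSequence α β W V B φ K) : Bdd d 1 φ := by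
  have h0 : Bdd d 0 φ := ⟨h.secφ, K, h.bound_nsq⟩
  have hK : 0 ≤ K := (kin_nonneg _ _ _).trans (h.bound_kin 0)
  refine Bdd.succ h0 fun j => ?_
  obtain ⟨C, p, hC⟩ := (h.bdd_one_B.coef j).four_bound
  have sb : ∀ N, IsSec 0 (fun y => (coef (B N) j y : ℂ)) := fun N => (isPer_coef (h.secB N) j).ofReal
  have a1 : Bdd d 0 (fun N x => (coef (B N) j x : ℂ) * φ N x) :=
    ⟨fun N => (sb N).mul (h.secφ N) (by ring), √C * √K, fun N =>
      nsq_mul_le_sqrt (sb N).continuous (h.secφ N).continuous (Real.sqrt_nonneg _) (hC N)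
        (by rw [Real.sq_sqrt hK]; exact h.bound_four N)⟩
  have a2 : Bdd d 0 (fun N => cov (conn d (B N)) j (φ N)) :=
    ⟨fun N => (h.secφ N).cov (isConn_conn d (h.secB N)) j, K, fun N => by
      have hk := h.bound_kin N
      simp only [kin] at hk
      have n0 := nsq_nonneg (cov (conn d (B N)) 0 (φ N))
      have n1 := nsq_nonneg (cov (conn d (B N)) 1 (φ N))
      fin_cases j
      · change nsq (cov (conn d (B N)) 0 (φ N)) ≤ K; linarith
      · change nsq (cov (conn d (B N)) 1 (φ N)) ≤ K; linarith⟩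
  refine (congrArg (Bdd d 0) ?_).mp (a2.sub (a1.const_mul Complex.I))
  funext N x
  rw [cov_conn]; ring

theorem ip_lap_φ (h : GalerkinSequence α β W V B φ K) (N : ℕ) (ψ : ℝ × ℝ → ℂ) (hψ : ψ ∈ V.space N) :
    ip ψ (lap d (φ N)) = ip ψ (remainder α β d (B N) (φ N)) := by
  have e := h.eqφ N ψ hψ
  have s := h.secφ N
  have sB := h.secB N
  have hr : remainder α β d (B N) (φ N) =
      fun x => lap d (φ N) x - glOp α β (conn d (B N)) (φ N) x := by
    funext x; rw [glOp_conn sB s]; ring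
  rw [hr, ip_sub (V.isSec N _ hψ).continuous s.lap.continuous
    (isSec_glOp (isConn_conn d sB) s).continuous, e, sub_zero]

theorem ip_lap_B (h : GalerkinSequence α β W V B φ K) (N : ℕ) (C : ℝ × ℝ → ℂ) (hC : C ∈ W.space N) :
    ip C (lap 0 (B N)) = ip C (fun x => - currentC (conn d (B N)) (φ N) x) := by
  have e := h.eqB N C hC
  rw [ip_add (W.isSec N _ hC).continuous (h.secB N).lap.continuous
    (isSec_currentC (isConn_conn d (h.secB N)) (h.secφ N)).continuous] at e
  rw [ip_neg]
  exact eq_neg_of_add_eq_zero_left e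

theorem bdd_two_φ (h : GalerkinSequence α β W V B φ K) : Bdd d 2 φ := by
  have hφ := h.bdd_one_φ
  have hB := h.bdd_one_B
  obtain ⟨c0, p0, k0⟩ := hφ.exists_bound
  obtain ⟨c1, p1, k1⟩ := hφ.grad2_bound
  obtain ⟨c2, p2, k2⟩ := hφ.four_bound
  set X : ℕ → ℝ := fun N => hess2 d (φ N) with hX
  have X0 : ∀ N, 0 ≤ X N := fun N => hess2_nonneg _ _
  set Y : ℕ → ℝ := fun N => 1 + √(X N) with hY
  have Y1 : ∀ N, 1 ≤ Y N := fun N => by simp only [hY]; linarith [Real.sqrt_nonneg (X N)]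
  have Y0 : ∀ N, 0 ≤ Y N := fun N => zero_le_one.trans (Y1 N)
  have sY : ∀ N, √(X N) ≤ Y N := fun N => by simp only [hY]; linarith
  have cφ : ∀ N, Continuous (φ N) := fun N => (h.secφ N).continuous
  have sup : ∀ N x, ‖φ N x‖ ^ 2 ≤ (3 * c0 + 2 * c1 + 2 * √c0) * Y N := fun N x => by
    refine (GinzburgLandau.sup_bound (h.secφ N) x).trans ?_
    have e : √(nsq (φ N) * hess2 d (φ N)) ≤ √c0 * Y N := by
      rw [Real.sqrt_mul (nsq_nonneg _)]
      exact mul_le_mul (Real.sqrt_le_sqrt (k0 N)) (sY N) (Real.sqrt_nonneg _) (Real.sqrt_nonneg _)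
    have e0 := (k0 N).trans (le_mul_of_one_le_right p0 (Y1 N))
    have e1 := (k1 N).trans (le_mul_of_one_le_right p1 (Y1 N))
    linarith
  have D0 : 0 ≤ 3 * c0 + 2 * c1 + 2 * √c0 := by positivity
  have gφ : GrowthLe Y φ := GrowthLe.of_bound cφ Y1 p0 k0
  have g3 : GrowthLe Y (fun N x => ((‖φ N x‖ ^ 2 : ℝ) : ℂ) * φ N x) := by
    refine GrowthLe.mul_of_sup (fun N => by have := cφ N; fun_prop) cφ p2 (fun N => ?_) D0 Y0 sup
    refine le_trans (le_of_eq ?_) (k2 N)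
    simp only [nsq, norm_real, Real.norm_eq_abs, sq_abs]
    congr 1; funext x; ring
  have gd : ∀ j, GrowthLe Y (fun N => drift d (B N) (φ N) j) := fun j => by
    have hb := hB.coef j
    obtain ⟨c3, p3, k3⟩ := (hb.cov j).exists_bound
    obtain ⟨c4, p4, k4⟩ := hb.four_bound
    have cb : ∀ N, Continuous fun x => (coef (B N) j x : ℂ) := fun N => (hb.isSec N).continuous
    have cdb := fun N => ((hb.cov j).isSec N).continuous
    have cdφ := fun N => ((hφ.cov j).isSec N).continuous
    have t1 := GrowthLe.mul_of_sup cdb cφ p3 k3 D0 Y0 sup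
    have t2 : GrowthLe Y (fun N x => cov (bg d) j (φ N) x * (coef (B N) j x : ℂ)) := by
      refine ⟨fun N => (cdφ N).mul (cb N), √c4 * (c1 + 2 * √c1), by positivity, fun N => ?_⟩
      have e1 : nsq (cov (bg d) j (φ N)) ≤ c1 := (nsq_cov_le d (φ N) j).trans (k1 N)
      have four := sqInt_pow_four_le ((hφ.cov j).isSec N)
      have e2 : √(nsq (cov (bg d) j (φ N)) * grad2 d (cov (bg d) j (φ N))) ≤ √c1 * √(X N) := by
        rw [Real.sqrt_mul (nsq_nonneg _)]
        exact mul_le_mul (Real.sqrt_le_sqrt e1) (Real.sqrt_le_sqrt (grad2_cov_le d (φ N) j))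
          (Real.sqrt_nonneg _) (Real.sqrt_nonneg _)
      have e3 : (sqInt fun x => ‖cov (bg d) j (φ N) x‖ ^ 4) ≤
          (c1 + 2 * (√c1 * √(X N))) ^ 2 := by
        refine four.trans ?_
        have := nsq_nonneg (cov (bg d) j (φ N))
        gcongr
      have e4 := nsq_mul_le_sqrt (cb N) (cdφ N) (D := c1 + 2 * (√c1 * √(X N))) (by positivity)
        (k4 N) e3
      have e5 : c1 + 2 * (√c1 * √(X N)) ≤ (c1 + 2 * √c1) * Y N := by
        have q1 := le_mul_of_one_le_right p1 (Y1 N)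
        have q2 := mul_le_mul_of_nonneg_left (sY N) (Real.sqrt_nonneg c1)
        linarith
      have e6 : (fun x => cov (bg d) j (φ N) x * (coef (B N) j x : ℂ)) =
        fun x => (coef (B N) j x : ℂ) * cov (bg d) j (φ N) x := by funext x; ring
      change nsq (fun x => cov (bg d) j (φ N) x * (coef (B N) j x : ℂ)) ≤ _
      rw [e6, mul_assoc]
      exact e4.trans (mul_le_mul_of_nonneg_left e5 (Real.sqrt_nonneg _))
    have t3 : GrowthLe Y (fun N x => (φ N x * (coef (B N) j x : ℂ)) * (coef (B N) j x : ℂ)) := by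
      have := GrowthLe.mul_of_sup (u := fun N x => (coef (B N) j x : ℂ) * (coef (B N) j x : ℂ))
        (fun N => (cb N).mul (cb N)) cφ p4 (fun N => by
          refine le_trans (le_of_eq ?_) (k4 N)
          simp only [nsq, norm_mul]
          congr 1; funext x; ring) D0 Y0 sup
      refine (congrArg (GrowthLe Y) ?_).mp this
      funext N x; ring
    exact ((t1.const_mul Complex.I).add (t2.const_mul (2 * Complex.I))).sub t3
  have gR : GrowthLe Y (fun N => remainder α β d (B N) (φ N)) :=
    ((gd 0).add (gd 1)).add ((gφ.const_mul _).sub (g3.const_mul _))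
  obtain ⟨cR, c, p, k⟩ := gR
  have proj : ∀ N, nsq (lap d (φ N)) ≤ nsq (remainder α β d (B N) (φ N)) := fun N => by
    have hs := (h.secφ N).lap
    have e := h.ip_lap_φ N _ (V.lap_mem N _ (h.memφ N))
    rw [ip_self hs.continuous] at e
    have b := norm_ip_le hs.continuous (cR N)
    rw [← e, norm_real, Real.norm_eq_abs, abs_of_nonneg (nsq_nonneg _)] at b
    linarith
  set D := c + 4 * Real.pi * |(d : ℝ)| * c1 with hD
  have pD : 0 ≤ 4 * Real.pi * |(d : ℝ)| := by have := Real.pi_pos; positivity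
  have Xle : ∀ N, X N ≤ D * (1 + √(X N)) := fun N => by
    have e1 := hess2_le (h.secφ N)
    have e2 := mul_le_mul_of_nonneg_left (k1 N) pD
    have e3 := le_mul_of_one_le_right (mul_nonneg pD p1) (Y1 N)
    have e4 := k N
    have e5 := proj N
    change X N ≤ D * Y N
    rw [hD, add_mul]
    simp only [hX]
    linarith
  have hD0 : 0 ≤ D := by positivity
  refine Bdd.succ hφ.zero fun j => (hφ.cov j).of_grad2 (C := 2 * D + D ^ 2) fun N => ?_
  exact (grad2_cov_le d (φ N) j).trans (le_of_le_mul_one_add_sqrt (X0 N) (Xle N))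

theorem bdd_of_current (h : GalerkinSequence α β W V B φ K) {k : ℕ}
    (hB : Bdd 0 (k + 1) B) (hφ : Bdd d (k + 2) φ) :
    Bdd 0 (k + 3) B :=
  hB.zero.of_lap (Bdd.of_projection W (fun N => W.lap_mem N _ (h.memB N))
    (hB.currentC hφ).neg h.ip_lap_B)

/-- All Sobolev norms of the Galerkin minimizers are uniformly bounded. -/
theorem bdd_all (h : GalerkinSequence α β W V B φ K) (k : ℕ) : Bdd 0 k B ∧ Bdd d k φ := by
  have h2φ := h.bdd_two_φ
  have h2B : Bdd 0 2 B := (h.bdd_of_current h.bdd_one_B h2φ).of_succ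
  have key : ∀ m, Bdd 0 (m + 2) B ∧ Bdd d (m + 2) φ := fun m => by
    induction m with
    | zero => exact ⟨h2B, h2φ⟩
    | succ m ih =>
      refine ⟨h.bdd_of_current ih.1.of_succ ih.2, ih.2.zero.of_lap ?_⟩
      exact Bdd.of_projection V (fun N => V.lap_mem N _ (h.memφ N)) (ih.1.remainder α β ih.2)
        h.ip_lap_φ
  exact ⟨(key k).1.mono (by omega), (key k).2.mono (by omega)⟩

end GalerkinSequence

/-! ### Limits of families with uniform Sobolev bounds -/

section Limits

open Filter Topology

variable {d : ℤ} {l : Filter ℕ} {u : ℕ → ℝ × ℝ → ℂ} {f : ℝ × ℝ → ℂ}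

/-- Convergence uniform near every point. -/
def ContinuousLimit (l : Filter ℕ) (u : ℕ → ℝ × ℝ → ℂ) (f : ℝ × ℝ → ℂ) : Prop :=
  ∀ x, Tendsto (fun p : ℕ × (ℝ × ℝ) => u p.1 p.2) (l ×ˢ 𝓝 x) (𝓝 (f x))

/-- Pointwise convergence of a family with all Sobolev norms uniformly bounded. -/
def SobolevLimit (l : Filter ℕ) (d : ℤ) (u : ℕ → ℝ × ℝ → ℂ) (f : ℝ × ℝ → ℂ) : Prop :=
  (∀ k, Bdd d k u) ∧ ∀ x, Tendsto (fun N => u N x) l (𝓝 (f x))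

theorem Bdd.locally_lipschitz (hu : Bdd d 3 u) (x : ℝ × ℝ) :
    ∃ L, 0 ≤ L ∧ ∀ N, ∀ y ∈ Metric.ball x 1, ‖u N y - u N x‖ ≤ L * ‖y - x‖ := by
  obtain ⟨c, p, h⟩ := (hu.of_succ : Bdd d 2 u).sup_bound
  obtain ⟨c0, p0, h0⟩ := (hu.cov 0).sup_bound
  obtain ⟨c1, p1, h1⟩ := (hu.cov 1).sup_bound
  have s : ∀ {a b : ℝ}, 0 ≤ a → a ^ 2 ≤ b → a ≤ √b := fun ha hab => Real.le_sqrt_of_sq_le hab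
  refine ⟨√c0 + 2 * Real.pi * |(d : ℝ)| * (‖x‖ + 1) * √c + √c1, by positivity, fun N y hy => ?_⟩
  have hd : ∀ z, DifferentiableAt ℝ (u N) z := fun z =>
    ((hu.isSec N).smooth.differentiable (by simp)).differentiableAt
  refine (convex_ball x 1).norm_image_sub_le_of_norm_fderiv_le (𝕜 := ℝ) (fun z _ => hd z)
    (fun z hz => ?_) (Metric.mem_ball_self one_pos) hy
  have hz2 : |z.2| ≤ ‖x‖ + 1 := by
    have e1 : |z.2| ≤ ‖z‖ := norm_snd_le z
    have e2 : ‖z‖ ≤ ‖x‖ + ‖z - x‖ := by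
      simpa using norm_add_le x (z - x)
    rw [mem_ball_iff_norm] at hz
    linarith
  have b0 : ‖pd 0 (u N) z‖ ≤ √c0 + 2 * Real.pi * |(d : ℝ)| * (‖x‖ + 1) * √c := by
    have e : pd 0 (u N) z =
        GinzburgLandau.cov (bg d) 0 (u N) z - Complex.I * (bg d 0 z : ℂ) * u N z := by
      simp only [GinzburgLandau.cov]; ring
    rw [e]
    refine (norm_sub_le _ _).trans (add_le_add (s (norm_nonneg _) (h0 N z)) ?_)
    rw [norm_mul, norm_mul, norm_I, one_mul, norm_real, Real.norm_eq_abs]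
    have e3 : |bg d 0 z| ≤ 2 * Real.pi * |(d : ℝ)| * (‖x‖ + 1) := by
      simp only [bg, dir, if_true, mul_one, abs_mul, abs_neg, abs_two, abs_of_pos Real.pi_pos]
      gcongr
    exact mul_le_mul e3 (s (norm_nonneg _) (h N z)) (norm_nonneg _) (by positivity)
  have b1 : ‖pd 1 (u N) z‖ ≤ √c1 := by
    have e : pd 1 (u N) z = GinzburgLandau.cov (bg d) 1 (u N) z := by
      simp [GinzburgLandau.cov, bg, dir]
    rw [e]
    exact s (norm_nonneg _) (h1 N z)
  refine ContinuousLinearMap.opNorm_le_bound _ (by positivity) fun v => ?_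
  rw [fderiv_eq_pd]
  refine (norm_add_le _ _).trans ?_
  rw [norm_smul, norm_smul, add_mul]
  rw [mul_comm ‖v.1‖, mul_comm ‖v.2‖]
  exact add_le_add (mul_le_mul b0 (norm_fst_le v) (norm_nonneg _) (by positivity))
    (mul_le_mul b1 (norm_snd_le v) (norm_nonneg _) (by positivity))

namespace SobolevLimit

theorem continuousLimit (h : SobolevLimit l d u f) : ContinuousLimit l u f := fun x => by
  obtain ⟨L, p, hL⟩ := (h.1 3).locally_lipschitz x
  have t1 : Tendsto (fun p : ℕ × (ℝ × ℝ) => u p.1 x) (l ×ˢ 𝓝 x) (𝓝 (f x)) :=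
    (h.2 x).comp tendsto_fst
  have t2 : Tendsto (fun p : ℕ × (ℝ × ℝ) => u p.1 p.2 - u p.1 x) (l ×ˢ 𝓝 x) (𝓝 0) := by
    have t3 : Tendsto (fun p : ℕ × (ℝ × ℝ) => L * ‖p.2 - x‖) (l ×ˢ 𝓝 x) (𝓝 0) := by
      have : Tendsto (fun y : ℝ × ℝ => L * ‖y - x‖) (𝓝 x) (𝓝 (L * ‖x - x‖)) := by
        apply Continuous.tendsto; fun_prop
      rw [sub_self, norm_zero, mul_zero] at this
      exact this.comp tendsto_snd
    refine squeeze_zero_norm' ?_ t3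
    have : ∀ᶠ p : ℕ × (ℝ × ℝ) in l ×ˢ 𝓝 x, p.2 ∈ Metric.ball x 1 :=
      tendsto_snd.eventually (Metric.ball_mem_nhds x one_pos)
    filter_upwards [this] with q hq
    exact hL q.1 q.2 hq
  simpa using t2.add t1

theorem continuous [l.NeBot] (h : SobolevLimit l d u f) : Continuous f := by
  rw [continuous_iff_continuousAt]
  intro x
  obtain ⟨L, p, hL⟩ := (h.1 3).locally_lipschitz x
  have key : ∀ y ∈ Metric.ball x 1, ‖f y - f x‖ ≤ L * ‖y - x‖ := fun y hy =>
    le_of_tendsto ((h.2 y).sub (h.2 x)).norm (Eventually.of_forall fun N => hL N y hy)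
  rw [ContinuousAt, tendsto_iff_norm_sub_tendsto_zero]
  have : Tendsto (fun y : ℝ × ℝ => L * ‖y - x‖) (𝓝 x) (𝓝 (L * ‖x - x‖)) := by
    apply Continuous.tendsto; fun_prop
  rw [sub_self, norm_zero, mul_zero] at this
  refine squeeze_zero' (Eventually.of_forall fun _ => norm_nonneg _) ?_ this
  filter_upwards [Metric.ball_mem_nhds x one_pos] with y hy using key y hy

theorem exists_limit {l : Ultrafilter ℕ} (h : ∀ k, Bdd d k u) :
    ∃ f, SobolevLimit (l : Filter ℕ) d u f := by
  obtain ⟨C, p, hC⟩ := (h 2).sup_bound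
  have key : ∀ x, ∃ z, Tendsto (fun N => u N x) l (𝓝 z) := fun x => by
    have hm : ∀ N, u N x ∈ Metric.closedBall (0 : ℂ) (√C) := fun N => by
      rw [mem_closedBall_zero_iff]
      exact Real.le_sqrt_of_sq_le (hC N x)
    obtain ⟨z, -, hz⟩ := (isCompact_closedBall (0 : ℂ) (√C)).ultrafilter_le_nhds
      (l.map fun N => u N x) (by
        rw [Ultrafilter.coe_map, le_principal_iff]
        exact mem_map.mpr (univ_mem' hm))
    exact ⟨z, hz⟩
  choose f hf using key
  exact ⟨f, h, hf⟩

/-- A two-dimensional differential assembled from partial derivatives. -/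
def ofPartials (a b : ℂ) : ℝ × ℝ →L[ℝ] ℂ :=
  (ContinuousLinearMap.fst ℝ ℝ ℝ).smulRight a + (ContinuousLinearMap.snd ℝ ℝ ℝ).smulRight b

theorem continuous_ofPartials : Continuous fun p : ℂ × ℂ => ofPartials p.1 p.2 := by
  unfold ofPartials
  fun_prop

theorem exists_hasFDerivAt {l : Ultrafilter ℕ} (h : SobolevLimit l d u f) :
    ∃ g : Fin 2 → ℝ × ℝ → ℂ, (∀ j, SobolevLimit l d (fun N => GinzburgLandau.cov (bg d) j (u N)) (g j)) ∧
      ∀ x, HasFDerivAt f (ofPartials (g 0 x - Complex.I * (bg d 0 x : ℂ) * f x)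
        (g 1 x - Complex.I * (bg d 1 x : ℂ) * f x)) x := by
  choose g hg using fun j => exists_limit (l := l) (u := fun N => GinzburgLandau.cov (bg d) j (u N))
    (d := d) fun k => (h.1 (k + 1)).cov j
  refine ⟨g, hg, fun x => ?_⟩
  have cb : ∀ j, Continuous fun y => (bg d j y : ℂ) := fun j => by
    have := (isConn_bg d).smooth j |>.continuous
    fun_prop
  have cg : ∀ j, Continuous (g j) := fun j => (hg j).continuous
  have cf : Continuous f := h.continuous
  have lim : ∀ j, Tendsto (fun p : ℕ × (ℝ × ℝ) => GinzburgLandau.cov (bg d) j (u p.1) p.2 -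
      Complex.I * (bg d j p.2 : ℂ) * u p.1 p.2) ((l : Filter ℕ) ×ˢ 𝓝 x)
      (𝓝 (g j x - Complex.I * (bg d j x : ℂ) * f x)) := fun j =>
    ((hg j).continuousLimit x).sub (((((cb j).tendsto x).comp tendsto_snd).const_mul _).mul
      (h.continuousLimit x))
  have lim' : ∀ j, Tendsto (fun p : ℕ × (ℝ × ℝ) => g j p.2 -
      Complex.I * (bg d j p.2 : ℂ) * f p.2) ((l : Filter ℕ) ×ˢ 𝓝 x)
      (𝓝 (g j x - Complex.I * (bg d j x : ℂ) * f x)) := fun j => by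
    have : Continuous fun y => g j y - Complex.I * (bg d j y : ℂ) * f y := by
      have := cg j; have := cb j; fun_prop
    exact (this.tendsto x).comp tendsto_snd
  refine hasFDerivAt_of_tendstoUniformlyOnFilter (l := (l : Filter ℕ)) (f := u)
    (f' := fun N y => ofPartials
      (GinzburgLandau.cov (bg d) 0 (u N) y - Complex.I * (bg d 0 y : ℂ) * u N y)
      (GinzburgLandau.cov (bg d) 1 (u N) y - Complex.I * (bg d 1 y : ℂ) * u N y))
    (g' := fun y => ofPartials (g 0 y - Complex.I * (bg d 0 y : ℂ) * f y)
        (g 1 y - Complex.I * (bg d 1 y : ℂ) * f y)) ?_ ?_ (Eventually.of_forall h.2)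
  · rw [tendstoUniformlyOnFilter_iff_tendsto]
    have c := continuous_ofPartials.tendsto
      (g 0 x - Complex.I * (bg d 0 x : ℂ) * f x, g 1 x - Complex.I * (bg d 1 x : ℂ) * f x)
    exact ((c.comp ((lim' 0).prodMk_nhds (lim' 1))).prodMk_nhds
      (c.comp ((lim 0).prodMk_nhds (lim 1)))).mono_right (nhds_le_uniformity _)
  · refine Eventually.of_forall fun p => ?_
    have hd := (((h.1 0).isSec p.1).smooth.differentiable (by simp) p.2).hasFDerivAt
    convert hd using 1
    ext <;> simp [ofPartials, fderiv_eq_pd, GinzburgLandau.cov]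

theorem cov {l : Ultrafilter ℕ} (h : SobolevLimit l d u f) (j : Fin 2) :
    SobolevLimit l d (fun N => GinzburgLandau.cov (bg d) j (u N))
      (GinzburgLandau.cov (bg d) j f) := by
  obtain ⟨g, hg, hd⟩ := h.exists_hasFDerivAt
  have e : GinzburgLandau.cov (bg d) j f = g j := by
    funext x
    simp only [GinzburgLandau.cov, pd, (hd x).fderiv]
    fin_cases j <;> simp [ofPartials, dir]
  rw [e]
  exact hg j

theorem contDiff {l : Ultrafilter ℕ} (h : SobolevLimit l d u f) : ContDiff ℝ smoothOrder f := by
  have key : ∀ (n : ℕ) {u : ℕ → ℝ × ℝ → ℂ} {f : ℝ × ℝ → ℂ}, SobolevLimit l d u f →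
      ContDiff ℝ n f := fun n => by
    induction n with
    | zero => intro u f h; exact contDiff_zero.mpr h.continuous
    | succ n ih =>
      intro u f h
      obtain ⟨g, hg, hd⟩ := h.exists_hasFDerivAt
      have cb : ∀ j, ContDiff ℝ n fun y => (bg d j y : ℂ) := fun j =>
        (smooth_ofReal ((isConn_bg d).smooth j)).of_le (by exact_mod_cast le_top)
      have c0 := ih (hg 0)
      have c1 := ih (hg 1)
      have cf := ih h
      have b0 := cb 0
      have b1 := cb 1
      refine contDiff_succ_iff_hasFDerivAt.mpr ⟨_, ?_, hd⟩
      unfold ofPartials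
      fun_prop
  exact contDiff_infty.mpr fun n => key n h

theorem isSec {l : Ultrafilter ℕ} (h : SobolevLimit l d u f) : IsSec d f where
  smooth := h.contDiff
  per1 s t := tendsto_nhds_unique (h.2 _) (by
    simpa only [((h.1 0).isSec _).per1 s t] using h.2 (s, t))
  per2 s t := tendsto_nhds_unique (h.2 _) (by
    simpa only [((h.1 0).isSec _).per2 s t] using (h.2 (s, t)).const_mul _)

theorem lap {l : Ultrafilter ℕ} (h : SobolevLimit l d u f) :
    SobolevLimit l d (fun N => GinzburgLandau.lap d (u N)) (GinzburgLandau.lap d f) :=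
  ⟨fun k => (h.1 (k + 2)).lap, fun x =>
    ((((h.cov 0).cov 0).2 x).add (((h.cov 1).cov 1).2 x)).neg⟩

theorem coef {l : Ultrafilter ℕ} (h : SobolevLimit l 0 u f) (j : Fin 2) :
    SobolevLimit l 0 (fun N x => (GinzburgLandau.coef (u N) j x : ℂ))
      (fun x => (GinzburgLandau.coef f j x : ℂ)) := by
  refine ⟨fun k => (h.1 k).coef j, fun x => ?_⟩
  have r := (continuous_ofReal.tendsto _).comp ((continuous_re.tendsto _).comp (h.2 x))
  have i := (continuous_ofReal.tendsto _).comp ((continuous_im.tendsto _).comp (h.2 x))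
  fin_cases j
  · exact r
  · exact i

end SobolevLimit

theorem ContinuousLimit.sqInt [l.NeBot] (h : ContinuousLimit l u f) (hu : ∀ N, Continuous (u N))
    (hf : Continuous f) : Tendsto (fun N => sqInt (u N)) l (𝓝 (sqInt f)) := by
  have hloc : TendstoLocallyUniformlyOn u f l unitSquare := by
    refine TendstoLocallyUniformly.tendstoLocallyUniformlyOn ?_
    rw [tendstoLocallyUniformly_iff_forall_tendsto]
    intro x
    exact (((hf.tendsto x).comp tendsto_snd).prodMk_nhds (h x)).mono_right (nhds_le_uniformity _)
  rw [tendstoLocallyUniformlyOn_iff_tendstoUniformlyOn_of_compact isCompact_unitSquare,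
    Metric.tendstoUniformlyOn_iff] at hloc
  rw [Metric.tendsto_nhds]
  intro ε hε
  filter_upwards [hloc (ε / 2) (half_pos hε)] with N hN
  rw [dist_eq_norm, ← sqInt_sub (hu N) hf]
  have : ‖GinzburgLandau.sqInt fun x => u N x - f x‖ ≤ ε / 2 * volume.real unitSquare := by
    refine norm_setIntegral_le_of_norm_le_const ?_ fun x hx => ?_
    · rw [volume_unitSquare]; exact ENNReal.one_lt_top
    · rw [← dist_eq_norm, dist_comm]; exact (hN x hx).le
  rw [measureReal_def, volume_unitSquare, ENNReal.toReal_one, mul_one] at this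
  linarith

theorem SobolevLimit.ip {l : Ultrafilter ℕ} (h : SobolevLimit l d u f) {ψ : ℝ × ℝ → ℂ}
    (hψ : Continuous ψ) : Tendsto (fun N => ip ψ (u N)) l (𝓝 (ip ψ f)) := by
  have c : Continuous fun x => (starRingEnd ℂ) (ψ x) := continuous_conj.comp hψ
  refine ContinuousLimit.sqInt (fun x => ?_) (fun N => c.mul ((h.1 0).isSec N).continuous)
    (c.mul h.continuous)
  exact ((c.tendsto x).comp tendsto_snd).mul (h.continuousLimit x)

theorem SobolevLimit.nsq {l : Ultrafilter ℕ} (h : SobolevLimit l d u f) :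
    Tendsto (fun N => nsq (u N)) l (𝓝 (nsq f)) := by
  have t : Tendsto (fun N => GinzburgLandau.ip (u N) (u N)) l (𝓝 (GinzburgLandau.ip f f)) := by
    have c : ∀ {g : ℝ × ℝ → ℂ}, Continuous g → Continuous fun x => (starRingEnd ℂ) (g x) :=
      fun hg => continuous_conj.comp hg
    refine ContinuousLimit.sqInt (fun x => ?_)
      (fun N => (c ((h.1 0).isSec N).continuous).mul ((h.1 0).isSec N).continuous)
      ((c h.continuous).mul h.continuous)
    exact ((continuous_conj.tendsto _).comp (h.continuousLimit x)).mul (h.continuousLimit x)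
  have t' := (continuous_re.tendsto _).comp t
  simpa only [Function.comp_def, ip_self ((h.1 0).isSec _).continuous, ip_self h.continuous,
    ofReal_re] using t'

end Limits

namespace GalerkinSequence

open Filter Topology

variable {α β : ℝ} {d : ℤ} {W : GalerkinSystem 0} {V : GalerkinSystem d}
  {B φ : ℕ → ℝ × ℝ → ℂ} {K : ℝ}

/-- A Galerkin sequence has a smooth limit satisfying the weak Euler-Lagrange equations. -/
theorem exists_weak_solution (h : GalerkinSequence α β W V B φ K) {e : ℝ} (he : 0 < e)
    (hφ : ∀ N, e ≤ nsq (φ N)) :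
    ∃ b f, IsSec 0 b ∧ IsSec d f ∧ 0 < nsq f ∧
      (∀ N, ∀ ψ ∈ V.space N, ip ψ (glOp α β (conn d b) f) = 0) ∧
      ∀ N, ∀ C ∈ W.space N, ip C (fun x => lap 0 b x + currentC (conn d b) f x) = 0 := by
  let l : Ultrafilter ℕ := hyperfilter ℕ
  have hl : (l : Filter ℕ) ≤ atTop := Nat.hyperfilter_le_atTop
  obtain ⟨b, hb⟩ := SobolevLimit.exists_limit (l := l) fun k => (h.bdd_all k).1
  obtain ⟨f, hf⟩ := SobolevLimit.exists_limit (l := l) fun k => (h.bdd_all k).2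
  have sb := hb.isSec
  have sf := hf.isSec
  have lnorm : ∀ x, Tendsto (fun N => ((‖φ N x‖ ^ 2 : ℝ) : ℂ)) l (𝓝 ((‖f x‖ ^ 2 : ℝ) : ℂ)) :=
    fun x => (continuous_ofReal.tendsto _).comp ((hf.2 x).norm.pow 2)
  have ldrift : ∀ j x, Tendsto (fun N => drift d (B N) (φ N) j x) l (𝓝 (drift d b f j x)) :=
    fun j x => (((((hb.coef j).cov j).2 x).mul (hf.2 x)).const_mul _ |>.add
      ((((hf.cov j).2 x).mul ((hb.coef j).2 x)).const_mul _)).sub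
      (((hf.2 x).mul ((hb.coef j).2 x)).mul ((hb.coef j).2 x))
  have lrem : SobolevLimit l d (fun N => remainder α β d (B N) (φ N)) (remainder α β d b f) :=
    ⟨fun k => ((h.bdd_all (k + 2)).1.remainder α β (h.bdd_all (k + 2)).2).of_succ, fun x =>
      ((ldrift 0 x).add (ldrift 1 x)).add (((hf.2 x).const_mul _).sub
        (((lnorm x).mul (hf.2 x)).const_mul _))⟩
  have lgl : SobolevLimit l d (fun N => glOp α β (conn d (B N)) (φ N)) (glOp α β (conn d b) f) := by
    have e1 : (fun N => glOp α β (conn d (B N)) (φ N)) =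
        fun N x => lap d (φ N) x - remainder α β d (B N) (φ N) x := by
      funext N x; exact glOp_conn (h.secB N) (h.secφ N) x
    have e2 : glOp α β (conn d b) f = fun x => lap d f x - remainder α β d b f x := by
      funext x; exact glOp_conn sb sf x
    rw [e1, e2]
    exact ⟨fun k => (hf.lap.1 k).sub (lrem.1 k), fun x => (hf.lap.2 x).sub (lrem.2 x)⟩
  have lcur : ∀ j x, Tendsto (fun N => (current (conn d (B N)) (φ N) j x : ℂ)) l
      (𝓝 (current (conn d b) f j x : ℂ)) := fun j x => by
    have t : Tendsto (fun N => cov (conn d (B N)) j (φ N) x) l (𝓝 (cov (conn d b) j f x)) := by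
      simp only [cov_conn]
      exact ((hf.cov j).2 x).add ((((hb.coef j).2 x).const_mul _).mul (hf.2 x))
    exact (continuous_ofReal.tendsto _).comp ((continuous_im.tendsto _).comp
      (((continuous_conj.tendsto _).comp (hf.2 x)).mul t))
  have lJ : SobolevLimit l 0 (fun N x => lap 0 (B N) x + currentC (conn d (B N)) (φ N) x)
      (fun x => lap 0 b x + currentC (conn d b) f x) :=
    ⟨fun k => (hb.lap.1 k).add (((h.bdd_all (k + 1)).1.currentC (h.bdd_all (k + 2)).2).of_succ),
      fun x => (hb.lap.2 x).add ((lcur 0 x).add ((lcur 1 x).const_mul _))⟩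
  refine ⟨b, f, sb, sf, ?_, fun M ψ hψ => ?_, fun M C hC => ?_⟩
  · exact he.trans_le (ge_of_tendsto hf.nsq (Eventually.of_forall hφ))
  · refine tendsto_nhds_unique (lgl.ip (V.isSec M ψ hψ).continuous) ?_
    refine tendsto_const_nhds.congr' (hl ?_)
    filter_upwards [eventually_ge_atTop M] with N hN
    exact (h.eqφ N ψ (V.mono hN hψ)).symm
  · refine tendsto_nhds_unique (lJ.ip (W.isSec M C hC).continuous) ?_
    refine tendsto_const_nhds.congr' (hl ?_)
    filter_upwards [eventually_ge_atTop M] with N hN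
    exact (h.eqB N C (W.mono hN hC)).symm

end GalerkinSequence

/-! ### Fourier modes -/

section Fourier

open Function

theorem eq_zero_of_fourierCoeff_eq_zero {T : ℝ} [Fact (0 < T)] {f : C(AddCircle T, ℂ)}
    (h : fourierCoeff f = 0) : f = 0 := by
  have hs := hasSum_fourier_series_of_summable (f := f) (h ▸ summable_zero)
  have e : (fun i : ℤ => fourierCoeff f i • (fourier i : C(AddCircle T, ℂ))) = fun _ => 0 := by
    funext i
    rw [h, Pi.zero_apply, zero_smul]
  rw [e] at hs
  exact hs.unique hasSum_zero

/-- A continuous 1-periodic function with vanishing Fourier coefficients is zero. -/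
theorem eq_zero_of_fourier_eq_zero {g : ℝ → ℂ} (hg : Continuous g) (hp : Periodic g 1)
    (h : ∀ n : ℤ, ∫ s in (0 : ℝ)..1, cexp (-(2 * Real.pi * Complex.I * n * s)) * g s = 0)
    (s : ℝ) : g s = 0 := by
  let f : C(AddCircle (1 : ℝ), ℂ) := ⟨hp.lift, continuous_coinduced_dom.mpr hg⟩
  have c : fourierCoeff f = 0 := by
    funext n
    rw [fourierCoeff_eq_intervalIntegral _ n 0]
    simp only [Pi.zero_apply, zero_add, div_one, one_smul]
    rw [← h n]
    refine intervalIntegral.integral_congr fun t _ => ?_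
    simp only [fourier_coe_apply, smul_eq_mul]
    change _ * g t = _
    congr 2
    push_cast; ring
  have h0 := eq_zero_of_fourierCoeff_eq_zero c
  have := DFunLike.congr_fun h0 (s : AddCircle (1 : ℝ))
  exact this

theorem continuous_fourier_coefficient {G : ℝ × ℝ → ℂ} (hG : Continuous G) (n : ℤ) :
    Continuous fun t : ℝ =>
      ∫ s in (0 : ℝ)..1, cexp (-(2 * Real.pi * Complex.I * n * s)) * G (s, t) := by
  refine intervalIntegral.continuous_parametric_intervalIntegral_of_continuous' (μ := volume)
    (f := fun t s => cexp (-(2 * Real.pi * Complex.I * n * s)) * G (s, t)) ?_ 0 1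
  unfold Function.uncurry
  fun_prop

/-- The Fourier mode on the torus with frequency `k`. -/
def mode (k : ℤ × ℤ) (x : ℝ × ℝ) : ℂ :=
  cexp (2 * Real.pi * Complex.I * (k.1 * x.1 + k.2 * x.2))

theorem exp_two_pi_int_mul (n : ℤ) : cexp (2 * Real.pi * Complex.I * n) = 1 := by
  rw [mul_comm]; exact exp_int_mul_two_pi_mul_I n

theorem isSec_mode (k : ℤ × ℤ) : IsSec 0 (mode k) where
  smooth := by
    have h1 : ContDiff ℝ smoothOrder fun x : ℝ × ℝ => (x.1 : ℂ) := smooth_ofReal contDiff_fst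
    have h2 : ContDiff ℝ smoothOrder fun x : ℝ × ℝ => (x.2 : ℂ) := smooth_ofReal contDiff_snd
    unfold mode
    fun_prop
  per1 s t := by
    have : 2 * (Real.pi : ℂ) * Complex.I * (k.1 * ((s + 1 : ℝ) : ℂ) + k.2 * t) =
      2 * Real.pi * Complex.I * (k.1 * s + k.2 * t) + 2 * Real.pi * Complex.I * k.1 := by
      push_cast; ring
    simp only [mode, this]
    rw [Complex.exp_add, exp_two_pi_int_mul, mul_one]
  per2 s t := by
    have : 2 * (Real.pi : ℂ) * Complex.I * (k.1 * s + k.2 * ((t + 1 : ℝ) : ℂ)) =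
      2 * Real.pi * Complex.I * (k.1 * s + k.2 * t) + 2 * Real.pi * Complex.I * k.2 := by
      push_cast; ring
    simp only [mode, this]
    rw [Complex.exp_add, exp_two_pi_int_mul]; simp

theorem pd_mode (k : ℤ × ℤ) (j : Fin 2) (x : ℝ × ℝ) :
    pd j (mode k) x = 2 * Real.pi * Complex.I * ((if j = 0 then k.1 else k.2 : ℤ) : ℂ) * mode k x := by
  have h1 : HasFDerivAt (fun x : ℝ × ℝ => (x.1 : ℂ)) (ofRealCLM ∘L .fst ℝ ℝ ℝ) x :=
    (ofRealCLM ∘L .fst ℝ ℝ ℝ).hasFDerivAt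
  have h2 : HasFDerivAt (fun x : ℝ × ℝ => (x.2 : ℂ)) (ofRealCLM ∘L .snd ℝ ℝ ℝ) x :=
    (ofRealCLM ∘L .snd ℝ ℝ ℝ).hasFDerivAt
  have h := (((h1.const_mul (k.1 : ℂ)).add (h2.const_mul (k.2 : ℂ))).const_mul
    (2 * Real.pi * Complex.I)).cexp
  have e : fderiv ℝ (mode k) x = _ := h.fderiv
  rw [pd, e]
  fin_cases j <;> simp [dir, mode] <;> ring

theorem cov_mode (k : ℤ × ℤ) (j : Fin 2) : cov (bg 0) j (mode k) =
    fun x => 2 * Real.pi * Complex.I * ((if j = 0 then k.1 else k.2 : ℤ) : ℂ) * mode k x := by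
  funext x
  simp [cov, bg, pd_mode]

theorem lap_mode (k : ℤ × ℤ) : lap 0 (mode k) =
    fun x => (4 * Real.pi ^ 2 * (k.1 ^ 2 + k.2 ^ 2) : ℂ) * mode k x := by
  have s := (isSec_mode k).smooth
  funext x
  simp only [lap, cov_mode]
  rw [cov_const_mul _ s, cov_const_mul _ s, cov_mode, cov_mode]
  simp only [if_true, one_ne_zero, if_false]
  linear_combination (-(4 * Real.pi ^ 2 * (k.1 ^ 2 + k.2 ^ 2)) * mode k x : ℂ) * I_sq

theorem sqInt_mode {k : ℤ × ℤ} (hk : k ≠ 0) : sqInt (mode k) = 0 := by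
  have key : ∀ j : Fin 2, ((if j = 0 then k.1 else k.2 : ℤ) : ℂ) * sqInt (mode k) = 0 := fun j => by
    have h := sqInt_pd_eq_zero (isSec_mode k) j
    have e : pd j (mode k) =
      fun x => 2 * Real.pi * Complex.I * ((if j = 0 then k.1 else k.2 : ℤ) : ℂ) * mode k x := by
      funext x; exact pd_mode k j x
    rw [e, sqInt_const_mul, mul_assoc] at h
    exact (mul_eq_zero.mp h).resolve_left two_pi_I_ne_zero
  by_contra h
  have h1 := (mul_eq_zero.mp (key 0)).resolve_right h
  have h2 := (mul_eq_zero.mp (key 1)).resolve_right h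
  simp only [if_true, one_ne_zero, if_false, Int.cast_eq_zero] at h1 h2
  exact hk (Prod.ext h1 h2)

/-- A periodic function orthogonal to all nonconstant Fourier modes is constant. -/
theorem IsSec.eq_mean {G : ℝ × ℝ → ℂ} (hG : IsSec 0 G)
    (h : ∀ k : ℤ × ℤ, k ≠ 0 → ip (mode k) G = 0) (x : ℝ × ℝ) : G x = sqInt G := by
  set H : ℝ × ℝ → ℂ := fun x => G x + (-sqInt G) with hH
  have sH : IsSec 0 H := hG.add (isSec_const _)
  have cH := sH.continuous
  have zero : ∀ k, ip (mode k) H = 0 := fun k => by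
    rw [hH, ip_add (isSec_mode k).continuous hG.continuous continuous_const]
    by_cases hk : k = 0
    · subst hk
      have : mode 0 = fun _ => 1 := by funext x; simp [mode]
      rw [this]
      simp [ip, sqInt_const]
    · rw [h k hk, zero_add, ← ip_conj continuous_const (isSec_mode k).continuous, ip,
        sqInt_const_mul, sqInt_mode hk, mul_zero, map_zero]
  have conj_mode : ∀ (k : ℤ × ℤ) (s t : ℝ), (starRingEnd ℂ) (mode k (s, t)) =
      cexp (-(2 * Real.pi * Complex.I * k.2 * t)) * cexp (-(2 * Real.pi * Complex.I * k.1 * s)) :=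
    fun k s t => by
      rw [mode, ← Complex.exp_conj, ← Complex.exp_add]
      congr 1
      simp only [map_mul, map_add, conj_I, conj_ofReal, map_ofNat, map_intCast]
      ring
  have vanish : ∀ (n : ℤ) (t : ℝ),
      ∫ s in (0 : ℝ)..1, cexp (-(2 * Real.pi * Complex.I * n * s)) * H (s, t) = 0 := fun n => by
    refine eq_zero_of_fourier_eq_zero (continuous_fourier_coefficient cH n) (fun t => ?_)
      fun m => ?_
    · refine intervalIntegral.integral_congr fun s _ => ?_
      simp only [sH.periodic2]
    · have e := zero (n, m)
      rw [ip, sqInt_eq_iterated_symm (by have := (isSec_mode (n, m)).continuous; fun_prop)] at e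
      simp only [conj_mode, mul_assoc, intervalIntegral.integral_const_mul] at e ⊢
      exact e
  have := eq_zero_of_fourier_eq_zero (g := fun s => H (s, x.2)) (by fun_prop)
    (fun s => sH.per1 s x.2) (fun n => vanish n x.2) x.1
  exact sub_eq_zero.mp ((sub_eq_add_neg _ _).trans this)

end Fourier

theorem lap_add {d : ℤ} {u v : ℝ × ℝ → ℂ} (hu : IsSec d u) (hv : IsSec d v) :
    lap d (fun x => u x + v x) = fun x => lap d u x + lap d v x := by
  have e : ∀ j, cov (bg d) j (fun x => u x + v x) =
      fun x => cov (bg d) j u x + cov (bg d) j v x := fun j =>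
    funext fun x => cov_add hu.smooth hv.smooth j x
  funext x
  simp only [lap, e]
  rw [cov_add (hu.bgcov 0).smooth (hv.bgcov 0).smooth, cov_add (hu.bgcov 1).smooth (hv.bgcov 1).smooth]
  ring

theorem lap_const_mul {d : ℤ} {u : ℝ × ℝ → ℂ} (hu : IsSec d u) (c : ℂ) :
    lap d (fun x => c * u x) = fun x => c * lap d u x := by
  have e : ∀ j, cov (bg d) j (fun x => c * u x) = fun x => c * cov (bg d) j u x := fun j =>
    funext fun x => cov_const_mul c hu.smooth j x
  funext x
  simp only [lap, e]
  rw [cov_const_mul c (hu.bgcov 0).smooth, cov_const_mul c (hu.bgcov 1).smooth]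
  ring

/-- A Galerkin system spanned by finite sets of sections. -/
def GalerkinSystem.ofSpan {d : ℤ} (S : ℕ → Set (ℝ × ℝ → ℂ)) (hfin : ∀ N, (S N).Finite)
    (hsec : ∀ N, ∀ u ∈ S N, IsSec d u)
    (hlap : ∀ N, ∀ u ∈ S N, lap d u ∈ Submodule.span ℂ (S N)) (hmono : Monotone S) :
    GalerkinSystem d :=
  have sec : ∀ N, ∀ u ∈ Submodule.span ℂ (S N), IsSec d u := fun N u hu =>
    Submodule.span_induction (fun u hu => hsec N u hu) (isSec_zero d)
      (fun _ _ _ _ hu hv => hu.add hv) (fun c _ _ hu => hu.const_mul c) hu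
  { space := fun N => Submodule.span ℂ (S N)
    finite := fun N => FiniteDimensional.span_of_finite ℂ (hfin N)
    isSec := sec
    lap_mem := fun N u hu => by
      induction hu using Submodule.span_induction with
      | mem u hu => exact hlap N u hu
      | zero =>
        have : lap d (0 : ℝ × ℝ → ℂ) = 0 := by
          have := lap_const_mul (isSec_zero d) 0
          simp only [zero_mul] at this
          exact this
        rw [this]; exact Submodule.zero_mem _
      | add u v hu hv iu iv =>
        have : lap d (u + v) = lap d u + lap d v := lap_add (sec N u hu) (sec N v hv)
        rw [this]; exact Submodule.add_mem _ iu iv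
      | smul c u hu iu =>
        have : lap d (c • u) = c • lap d u := lap_const_mul (sec N u hu) c
        rw [this]; exact Submodule.smul_mem _ _ iu
    mono := fun _ _ h => Submodule.span_mono (hmono h) }

/-- The Galerkin system of nonconstant Fourier modes. -/
def modeSystem : GalerkinSystem 0 :=
  GalerkinSystem.ofSpan (fun N : ℕ => mode '' {k | k ∈ Set.Icc (-(N : ℤ), -(N : ℤ)) (N, N) ∧ k ≠ 0})
    (fun N => ((Set.finite_Icc _ _).subset fun _ h => h.1).image _)
    (fun N u => by rintro ⟨k, -, rfl⟩; exact isSec_mode k)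
    (fun N u => by
      rintro ⟨k, hk, rfl⟩
      rw [lap_mode]
      exact Submodule.smul_mem _ _ (Submodule.subset_span ⟨k, hk, rfl⟩))
    (fun M N h => Set.image_mono fun k hk => ⟨by
      have h' : (M : ℤ) ≤ N := by exact_mod_cast h
      obtain ⟨⟨a, b⟩, c, e⟩ := hk.1
      simp only at a b c e
      exact ⟨⟨by simp only; linarith, by simp only; linarith⟩, by simp only; linarith, by simp only; linarith⟩, hk.2⟩)

theorem sqInt_modeSystem (N : ℕ) (B : ℝ × ℝ → ℂ) (hB : B ∈ modeSystem.space N) : sqInt B = 0 := by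
  induction hB using Submodule.span_induction with
  | mem u hu => obtain ⟨k, hk, rfl⟩ := hu; exact sqInt_mode hk.2
  | zero => exact sqInt_const 0
  | add u v hu hv iu iv =>
    have := sqInt_add (modeSystem.isSec N u hu).continuous (modeSystem.isSec N v hv).continuous
    rw [iu, iv, add_zero] at this
    exact this
  | smul c u hu iu =>
    have := sqInt_const_mul c u
    rw [iu, mul_zero] at this
    exact this

theorem mode_mem_modeSystem {k : ℤ × ℤ} (hk : k ≠ 0) : ∃ N, mode k ∈ modeSystem.space N := by
  refine ⟨max k.1.natAbs k.2.natAbs, Submodule.subset_span ⟨k, ⟨⟨⟨?_, ?_⟩, ?_, ?_⟩, hk⟩, rfl⟩⟩ <;>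
    simp only <;> omega

/-! ### Lowest Landau level -/

section Landau

variable {d : ℤ}

/-- The argument of the theta factor of a Landau state. -/
def thetaArg (d j : ℤ) (x : ℝ × ℝ) : ℂ := d * x.1 - Complex.I * (d * x.2 - j)

/-- The exponent of the Gaussian factor of a Landau state. -/
def gaussArg (d j : ℤ) (x : ℝ × ℝ) : ℂ :=
  -(Real.pi * d * (x.2 - j / d) ^ 2) + 2 * Real.pi * Complex.I * j * x.1

/-- Theta-function sections spanning the lowest Landau level. -/
def landau (d j : ℤ) (x : ℝ × ℝ) : ℂ :=
  cexp (gaussArg d j x) * jacobiTheta₂ (thetaArg d j x) (d * Complex.I)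

theorem im_modulus (hd : 0 < d) : 0 < ((d : ℂ) * Complex.I).im := by simpa using hd

theorem contDiff_thetaArg (j : ℤ) : ContDiff ℝ smoothOrder (thetaArg d j) := by
  have h1 : ContDiff ℝ smoothOrder fun x : ℝ × ℝ => (x.1 : ℂ) := smooth_ofReal contDiff_fst
  have h2 : ContDiff ℝ smoothOrder fun x : ℝ × ℝ => (x.2 : ℂ) := smooth_ofReal contDiff_snd
  unfold thetaArg
  fun_prop

theorem contDiff_gaussArg (j : ℤ) : ContDiff ℝ smoothOrder (gaussArg d j) := by
  have h1 : ContDiff ℝ smoothOrder fun x : ℝ × ℝ => (x.1 : ℂ) := smooth_ofReal contDiff_fst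
  have h2 : ContDiff ℝ smoothOrder fun x : ℝ × ℝ => (x.2 : ℂ) := smooth_ofReal contDiff_snd
  unfold gaussArg
  fun_prop

theorem isSec_landau (hd : 0 < d) (j : ℤ) : IsSec d (landau d j) where
  smooth := by
    have h : Differentiable ℂ fun z => jacobiTheta₂ z (d * Complex.I) := fun z =>
      differentiableAt_jacobiTheta₂_fst z (im_modulus hd)
    have h' : ContDiff ℝ smoothOrder fun z => jacobiTheta₂ z (d * Complex.I) :=
      h.contDiff.restrict_scalars ℝ
    exact (contDiff_gaussArg j).cexp.mul (h'.comp (contDiff_thetaArg j))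
  per1 s t := by
    have hp : Function.Periodic (fun z => jacobiTheta₂ z (d * Complex.I)) 1 := fun z =>
      jacobiTheta₂_add_left z _
    have e1 : thetaArg d j (s + 1, t) = thetaArg d j (s, t) + (d : ℂ) * 1 := by
      simp only [thetaArg]; push_cast; ring
    have e2 : gaussArg d j (s + 1, t) = gaussArg d j (s, t) + 2 * Real.pi * Complex.I * j := by
      simp only [gaussArg]; push_cast; ring
    rw [landau, e1, e2, Complex.exp_add, exp_two_pi_int_mul, mul_one]
    exact congrArg _ (hp.int_mul d _)
  per2 s t := by
    have hd0 : (d : ℂ) ≠ 0 := by exact_mod_cast hd.ne'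
    have e := jacobiTheta₂_add_left' (thetaArg d j (s, t + 1)) (d * Complex.I)
    have e1 : thetaArg d j (s, t + 1) + d * Complex.I = thetaArg d j (s, t) := by
      simp only [thetaArg]; push_cast; ring
    rw [e1] at e
    rw [landau, landau, e, ← mul_assoc, ← mul_assoc, ← Complex.exp_add, ← Complex.exp_add]
    congr 2
    simp only [thetaArg, gaussArg]
    push_cast
    field_simp
    linear_combination (d * (2 * j - d * (1 + 2 * t)) : ℂ) * I_sq

theorem cov_one_landau (hd : 0 < d) (j : ℤ) :
    cov (bg d) 1 (landau d j) = fun x => -Complex.I * cov (bg d) 0 (landau d j) x := by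
  funext x
  have hd0 : (d : ℂ) ≠ 0 := by exact_mod_cast hd.ne'
  have h1 : HasFDerivAt (fun x : ℝ × ℝ => (x.1 : ℂ)) (ofRealCLM ∘L .fst ℝ ℝ ℝ) x :=
    (ofRealCLM ∘L .fst ℝ ℝ ℝ).hasFDerivAt
  have h2 : HasFDerivAt (fun x : ℝ × ℝ => (x.2 : ℂ)) (ofRealCLM ∘L .snd ℝ ℝ ℝ) x :=
    (ofRealCLM ∘L .snd ℝ ℝ ℝ).hasFDerivAt
  have hg := ((((h2.sub_const ((j : ℂ) / d)).pow 2).const_mul (Real.pi * d : ℂ)).neg.add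
    (h1.const_mul (2 * Real.pi * Complex.I * j))).cexp
  have hz := (h1.const_mul (d : ℂ)).sub (((h2.const_mul (d : ℂ)).sub_const (j : ℂ)).const_mul Complex.I)
  have hθ := ((hasDerivAt_jacobiTheta₂_fst (thetaArg d j x) (im_modulus hd)).hasFDerivAt.restrictScalars
    ℝ).comp x hz
  have e : fderiv ℝ (landau d j) x = _ := (hg.mul hθ).fderiv
  have eg : gaussArg d j x = -(Real.pi * d * (x.2 - j / d) ^ 2) + 2 * Real.pi * Complex.I * j * x.1 := rfl
  simp only [cov, pd, e, bg]
  simp [dir, landau, ← eg]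
  field_simp
  linear_combination (2 * Real.pi * jacobiTheta₂ (thetaArg d j x) (Complex.I * d) * (j - d * x.2)) * I_sq

end Landau

section Unfolding

variable {d : ℤ}

theorem hasSum_landau (hd : 0 < d) (j : ℤ) (x : ℝ × ℝ) :
    HasSum (fun m : ℤ => ((Real.exp (-(Real.pi * d) * (x.2 + m - j / d) ^ 2) : ℝ) : ℂ) *
      cexp (2 * Real.pi * Complex.I * (j - d * m) * x.1)) (landau d j x) := by
  have hd0 : (d : ℂ) ≠ 0 := by exact_mod_cast hd.ne'
  have h := (hasSum_jacobiTheta₂_term (thetaArg d j x) (im_modulus hd)).mul_left (cexp (gaussArg d j x))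
  rw [← (Equiv.neg ℤ).hasSum_iff] at h
  refine h.congr_fun fun m => ?_
  simp only [Function.comp, Equiv.neg_apply, jacobiTheta₂_term, ofReal_exp, ← Complex.exp_add]
  congr 1
  simp only [thetaArg, gaussArg]
  push_cast
  field_simp
  linear_combination (-(d * m * (2 * d * x.2 - 2 * j + d * m))) * I_sq

theorem IsSec.add_int {u : ℝ × ℝ → ℂ} (hu : IsSec d u) (m : ℤ) (s t : ℝ) :
    u (s, t + m) = cexp (2 * Real.pi * Complex.I * (d * m) * s) * u (s, t) := by
  induction m using Int.induction_on with
  | zero => simp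
  | succ n ih =>
    have := hu.per2 s (t + n)
    push_cast at ih ⊢
    rw [← add_assoc, this, ih, ← mul_assoc, ← Complex.exp_add]
    congr 2; ring
  | pred n ih =>
    have := hu.per2 s (t + (-n - 1))
    push_cast at ih ⊢
    rw [show t + (-(n : ℝ) - 1) + 1 = t + -n by ring, ih] at this
    rw [← mul_right_inj' (Complex.exp_ne_zero (2 * Real.pi * Complex.I * d * s)), ← mul_assoc,
      ← Complex.exp_add]
    refine this.symm.trans ?_
    congr 2; ring

/-- The Fourier coefficients of a section in the first variable. -/
def fcoef (j : ℤ) (G : ℝ × ℝ → ℂ) (t : ℝ) : ℂ :=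
  ∫ s in (0 : ℝ)..1, cexp (-(2 * Real.pi * Complex.I * j * s)) * G (s, t)

theorem continuous_fcoef (j : ℤ) {G : ℝ × ℝ → ℂ} (hG : Continuous G) : Continuous (fcoef j G) :=
  continuous_fourier_coefficient hG j

theorem IsSec.exists_norm_le {u : ℝ × ℝ → ℂ} (hu : IsSec d u) : ∃ C, 0 ≤ C ∧ ∀ x, ‖u x‖ ≤ C :=
  ⟨_, Real.sqrt_nonneg _, fun x => Real.le_sqrt_of_sq_le (sup_bound hu x)⟩

theorem norm_fcoef_le (j : ℤ) {G : ℝ × ℝ → ℂ} {C : ℝ} (hC : ∀ x, ‖G x‖ ≤ C) (t : ℝ) :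
    ‖fcoef j G t‖ ≤ C := by
  have := intervalIntegral.norm_integral_le_of_norm_le_const (a := 0) (b := 1) (C := C)
    (f := fun s : ℝ => cexp (-(2 * Real.pi * Complex.I * j * s)) * G (s, t)) fun s _ => by
      rw [norm_mul, norm_exp]
      simpa using hC (s, t)
  simpa [fcoef] using this

theorem integrable_gaussian_mul {b c : ℝ} (hb : 0 < b) {g : ℝ → ℂ} (hg : Continuous g) {C : ℝ}
    (hC : ∀ t, ‖g t‖ ≤ C) :
    Integrable fun t : ℝ => ((Real.exp (-b * (t - c) ^ 2) : ℝ) : ℂ) * g t := by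
  have h := ((integrable_exp_neg_mul_sq hb).comp_sub_right c).ofReal (𝕜 := ℂ)
  exact h.mul_bdd hg.aestronglyMeasurable (.of_forall hC)

theorem ip_landau (hd : 0 < d) (j : ℤ) {G : ℝ × ℝ → ℂ} (hG : IsSec d G) :
    ip (landau d j) G =
      ∫ t : ℝ, ((Real.exp (-(Real.pi * d) * (t - j / d) ^ 2) : ℝ) : ℂ) * fcoef j G t := by
  obtain ⟨C, hC0, hC⟩ := hG.exists_norm_le
  have hb : 0 < Real.pi * d := mul_pos Real.pi_pos (by exact_mod_cast hd)
  have hint := (integrable_gaussian_mul (c := j / d) hb (continuous_fcoef j hG.continuous)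
    (norm_fcoef_le j hC)).hasSum_intervalIntegral_comp_add_int
  have cG := hG.continuous
  let w : ℤ → ℝ × ℝ → ℝ := fun m x => Real.exp (-(Real.pi * d) * (x.2 + m - j / d) ^ 2)
  let F : ℤ → ℝ × ℝ → ℂ := fun m x => (w m x : ℂ) *
    (cexp (-(2 * Real.pi * Complex.I * j * x.1)) * G (x.1, x.2 + m))
  have cF : ∀ m, Continuous (F m) := fun m => by unfold F w; fun_prop
  have hw : ∀ x : ℝ × ℝ, HasSum (fun m => w m x) (landau d j (0, x.2)).re := fun x => by
    refine (Complex.hasSum_re (hasSum_landau hd j (0, x.2))).congr_fun fun m => ?_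
    rw [re_ofReal_mul]
    simp [w]
  have cL : Continuous (landau d j) := (isSec_landau hd j).continuous
  have hs : HasSum (fun m => sqInt (F m)) (ip (landau d j) G) := by
    refine hasSum_integral_of_dominated_convergence (fun m x => w m x * C)
      (fun m => (cF m).aestronglyMeasurable) (fun m => .of_forall fun x => ?_)
      (.of_forall fun x => (hw x).summable.mul_right C) ?_ (.of_forall fun x => ?_)
    · rw [norm_mul, norm_mul, norm_exp, norm_real, Real.norm_eq_abs, abs_of_pos (Real.exp_pos _)]
      refine mul_le_mul_of_nonneg_left ?_ (Real.exp_pos _).le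
      simpa using hC _
    · have : (fun x => ∑' m, w m x * C) = fun x : ℝ × ℝ => (landau d j (0, x.2)).re * C := by
        funext x; exact ((hw x).mul_right C).tsum_eq
      rw [this]
      exact integrableOn_square ((continuous_re.comp (cL.comp (by fun_prop))).mul_const C)
    · refine (((hasSum_landau hd j x).map (starRingEnd ℂ) continuous_conj).mul_right (G x)).congr_fun
        fun m => ?_
      simp only [F, w, Function.comp, map_mul, conj_ofReal, hG.add_int, mul_assoc]
      congr 1
      rw [← mul_assoc, ← mul_assoc, ← Complex.exp_conj, ← Complex.exp_add]
      congr 2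
      simp [conj_ofNat]
      ring
  refine hs.unique ?_
  refine hint.congr_fun fun m => ?_
  rw [sqInt_eq_iterated_symm (cF m)]
  refine intervalIntegral.integral_congr fun t _ => ?_
  simp only [F, w, fcoef, intervalIntegral.integral_const_mul]

end Unfolding

section Moments

open scoped FourierTransform

theorem fourier_integrand_hasSum (w y : ℝ) (z : ℂ) :
    HasSum (fun k : ℕ => (-(2 * Real.pi * Complex.I * w)) ^ k / (k.factorial : ℂ) * ((y : ℂ) ^ k * z))
      (cexp (-(2 * Real.pi * Complex.I * w * y)) * z) := by
  have h := (NormedSpace.expSeries_div_hasSum_exp (-(2 * Real.pi * Complex.I * w * y))).mul_right z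
  rw [← Complex.exp_eq_exp_ℂ] at h
  refine h.congr_fun fun k => ?_
  rw [← neg_mul, mul_pow]; ring

theorem integrable_exp_abs_mul_gaussian {b : ℝ} (hb : 0 < b) (a : ℝ) :
    Integrable fun y : ℝ => Real.exp |a * y| * Real.exp (-b * y ^ 2) := by
  refine ((integrable_exp_neg_mul_sq (half_pos hb)).const_mul (Real.exp (a ^ 2 / (2 * b)))).mono'
    (by fun_prop) (.of_forall fun y => ?_)
  rw [Real.norm_eq_abs, abs_of_pos (by positivity), ← Real.exp_add, ← Real.exp_add,
    Real.exp_le_exp, abs_mul]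
  have : 0 ≤ (|a| - b * |y|) ^ 2 / (2 * b) := by positivity
  have e : (|a| - b * |y|) ^ 2 / (2 * b) = a ^ 2 / (2 * b) - |a| * |y| + b / 2 * y ^ 2 := by
    field_simp
    rw [← sq_abs a, ← sq_abs y]
    ring
  linarith

/-- A bounded continuous function orthogonal to all polynomials in a Gaussian weight vanishes. -/
theorem eq_zero_of_gaussian_moments {b : ℝ} (hb : 0 < b) {h : ℝ → ℂ} (hc : Continuous h) {C : ℝ}
    (hC : ∀ y, ‖h y‖ ≤ C)
    (hm : ∀ k : ℕ, ∫ y : ℝ, (y : ℂ) ^ k * (((Real.exp (-b * y ^ 2) : ℝ) : ℂ) * h y) = 0) (y : ℝ) :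
    h y = 0 := by
  let f : ℝ → ℂ := fun y => ((Real.exp (-b * y ^ 2) : ℝ) : ℂ) * h y
  have hC0 : 0 ≤ C := (norm_nonneg _).trans (hC 0)
  have cf : Continuous f := by unfold f; fun_prop
  have hf : Integrable f := by
    simpa [f] using integrable_gaussian_mul (c := 0) hb hc hC
  have hF : 𝓕 f = 0 := by
    funext w
    rw [Real.fourier_real_eq_integral_exp_smul]
    have hs := hasSum_integral_of_dominated_convergence (μ := volume)
      (F := fun (k : ℕ) (y : ℝ) =>
        (-(2 * Real.pi * Complex.I * w)) ^ k / (k.factorial : ℂ) * ((y : ℂ) ^ k * f y))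
      (f := fun y => cexp (-(2 * Real.pi * Complex.I * w * y)) * f y)
      (fun k y => |2 * Real.pi * w * y| ^ k / k.factorial * (Real.exp (-b * y ^ 2) * C))
      (fun k => Continuous.aestronglyMeasurable (by fun_prop)) (fun k => .of_forall fun y => ?_)
      (.of_forall fun y => (Real.summable_pow_div_factorial _).mul_right _) ?_
      (.of_forall fun y => fourier_integrand_hasSum w y _)
    · simp only [integral_const_mul, f, hm, mul_zero] at hs
      rw [Pi.zero_apply, ← hs.unique hasSum_zero]
      refine integral_congr_ae (.of_forall fun y => ?_)
      simp only [f, smul_eq_mul]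
      congr 2
      push_cast; ring
    · simp only [f, norm_mul, norm_div, norm_pow, norm_neg, norm_natCast, norm_real, norm_I,
        Real.norm_eq_abs, abs_mul, abs_of_pos (Real.exp_pos _), Complex.norm_ofNat, mul_pow]
      rw [abs_of_pos Real.pi_pos, abs_two]
      have : Real.exp (-b * y ^ 2) * ‖h y‖ ≤ Real.exp (-b * y ^ 2) * C :=
        mul_le_mul_of_nonneg_left (hC y) (Real.exp_pos _).le
      calc _ = (2 ^ k * Real.pi ^ k * |w| ^ k * |y| ^ k) / k.factorial *
            (Real.exp (-b * y ^ 2) * ‖h y‖) := by ring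
        _ ≤ _ := mul_le_mul_of_nonneg_left this (by positivity)
    · have : (fun y : ℝ => ∑' k : ℕ, |2 * Real.pi * w * y| ^ k / k.factorial *
          (Real.exp (-b * y ^ 2) * C)) =
          fun y : ℝ => Real.exp |2 * Real.pi * w * y| * Real.exp (-b * y ^ 2) * C := by
        funext y
        have h := NormedSpace.expSeries_div_hasSum_exp (𝔸 := ℝ) |2 * Real.pi * w * y|
        rw [← Real.exp_eq_exp_ℝ] at h
        exact (h.mul_right _).tsum_eq.trans (mul_assoc _ _ _).symm
      rw [this]
      exact (integrable_exp_abs_mul_gaussian hb _).mul_const C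
  have hinv := cf.fourierInv_fourier_eq hf (by rw [hF]; exact integrable_zero _ _ _)
  have hy : f y = 0 := by
    rw [← hinv, hF]
    simp [Real.fourierInv_eq]
  simpa [f] using hy

end Moments

section Tower

variable {d : ℤ}

/-- Iterated covariant derivatives in the first direction. -/
def raise (d : ℤ) (k : ℕ) (u : ℝ × ℝ → ℂ) : ℝ × ℝ → ℂ := (cov (bg d) 0)^[k] u

theorem raise_zero (u : ℝ × ℝ → ℂ) : raise d 0 u = u := rfl

theorem raise_succ (k : ℕ) (u : ℝ × ℝ → ℂ) :
    raise d (k + 1) u = cov (bg d) 0 (raise d k u) := Function.iterate_succ_apply' _ _ _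

theorem IsSec.raise {u : ℝ × ℝ → ℂ} (hu : IsSec d u) : ∀ k, IsSec d (raise d k u)
  | 0 => hu
  | k + 1 => by rw [raise_succ]; exact (hu.raise k).bgcov 0

theorem ip_raise {u v : ℝ × ℝ → ℂ} (hu : IsSec d u) (hv : IsSec d v) (k : ℕ) :
    ip (raise d k u) v = (-1) ^ k * ip u (raise d k v) := by
  induction k generalizing v with
  | zero => simp [raise_zero]
  | succ k ih =>
    have e : raise d (k + 1) v = raise d k (cov (bg d) 0 v) := Function.iterate_succ_apply _ _ _
    rw [e, raise_succ, ← neg_inj, ← ip_cov (isConn_bg d) (hu.raise k) hv, ih (hv.bgcov 0)]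
    ring

theorem fcoef_cov (hd : 0 < d) (j : ℤ) {G : ℝ × ℝ → ℂ} (hG : IsSec d G) (t : ℝ) :
    fcoef j (cov (bg d) 0 G) t = -(2 * Real.pi * Complex.I * d) * (t - j / d) * fcoef j G t := by
  have hd0 : (d : ℂ) ≠ 0 := by exact_mod_cast hd.ne'
  have cG := hG.continuous
  have cp : Continuous (pd 0 G) := (smooth_pd hG.smooth 0).continuous
  have key : ∫ s in (0 : ℝ)..1, (cexp (-(2 * Real.pi * Complex.I * j * s)) * pd 0 G (s, t) -
      2 * Real.pi * Complex.I * j * (cexp (-(2 * Real.pi * Complex.I * j * s)) * G (s, t))) = 0 := by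
    rw [intervalIntegral.integral_eq_sub_of_hasDerivAt
      (f := fun s : ℝ => cexp (-(2 * Real.pi * Complex.I * j * s)) * G (s, t))]
    · have h1 := hG.per1 0 t
      have h2 : cexp (-(2 * Real.pi * Complex.I * j)) = 1 := by
        rw [← exp_two_pi_int_mul (-j)]; congr 1; push_cast; ring
      rw [zero_add] at h1
      simp [h1, h2]
    · intro s _
      have hl : HasDerivAt (fun s : ℝ => -(2 * Real.pi * Complex.I * j * s)) (-(2 * Real.pi * Complex.I * j)) s := by
        simpa using ((hasDerivAt_id s).ofReal_comp.const_mul (2 * Real.pi * Complex.I * j : ℂ)).fun_neg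
      exact (hl.cexp.mul (hasDerivAt_fst hG.smooth s t)).congr_deriv (by ring)
    · exact Continuous.intervalIntegrable (by fun_prop) _ _
  rw [intervalIntegral.integral_sub (Continuous.intervalIntegrable (by fun_prop) _ _)
    (Continuous.intervalIntegrable (by fun_prop) _ _), intervalIntegral.integral_const_mul,
    sub_eq_zero] at key
  have e : ∀ s : ℝ, cexp (-(2 * Real.pi * Complex.I * j * s)) * cov (bg d) 0 G (s, t) =
      cexp (-(2 * Real.pi * Complex.I * j * s)) * pd 0 G (s, t) +
        (-(2 * Real.pi * Complex.I * d * t)) * (cexp (-(2 * Real.pi * Complex.I * j * s)) * G (s, t)) :=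
    fun s => by
      simp only [cov, bg, dir]; push_cast; simp; ring
  simp only [fcoef, e]
  rw [intervalIntegral.integral_add (Continuous.intervalIntegrable (by fun_prop) _ _)
    (Continuous.intervalIntegrable (by fun_prop) _ _), intervalIntegral.integral_const_mul, key]
  field_simp
  ring

theorem fcoef_raise (hd : 0 < d) (j : ℤ) {G : ℝ × ℝ → ℂ} (hG : IsSec d G) (k : ℕ) (t : ℝ) :
    fcoef j (raise d k G) t =
      (-(2 * Real.pi * Complex.I * d)) ^ k * ((t - j / d) ^ k * fcoef j G t) := by
  induction k with
  | zero => simp [raise_zero]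
  | succ k ih => rw [raise_succ, fcoef_cov hd j (hG.raise k), ih]; ring

/-- Landau states and their iterated derivatives are total. -/
theorem IsSec.eq_zero_of_ip_landau (hd : 0 < d) {G : ℝ × ℝ → ℂ} (hG : IsSec d G)
    (h : ∀ (k : ℕ) (j : ℤ), ip (GinzburgLandau.raise d k (landau d j)) G = 0) (x : ℝ × ℝ) : G x = 0 := by
  obtain ⟨C, hC0, hC⟩ := hG.exists_norm_le
  have hb : 0 < Real.pi * d := mul_pos Real.pi_pos (by exact_mod_cast hd)
  have hd0 : (d : ℂ) ≠ 0 := by exact_mod_cast hd.ne'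
  have hj : ∀ (j : ℤ) (t : ℝ), fcoef j G t = 0 := fun j t => by
    have := eq_zero_of_gaussian_moments hb (h := fun y => fcoef j G (y + j / d))
      ((continuous_fcoef j hG.continuous).comp (by fun_prop)) (fun y => norm_fcoef_le j hC _)
      (fun k => ?_) (t - j / d)
    · simpa using this
    · have e := h k j
      rw [ip_raise (isSec_landau hd j) hG, ip_landau hd j (hG.raise k)] at e
      have e' := (mul_eq_zero_iff_left (pow_ne_zero k (by norm_num : (-1 : ℂ) ≠ 0))).1 e
      simp only [fcoef_raise hd j hG, mul_left_comm _ ((-(2 * Real.pi * Complex.I * d)) ^ k),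
        integral_const_mul] at e'
      have e'' := (mul_eq_zero_iff_left (pow_ne_zero k (neg_ne_zero.2 (by simp [hd0, Real.pi_ne_zero])))).1 e'
      rw [← integral_add_right_eq_self _ ((j : ℝ) / d)] at e''
      rw [← e'']
      refine integral_congr_ae (.of_forall fun y => ?_)
      simp only [add_sub_cancel_right]
      push_cast
      rw [add_sub_cancel_right]
      ring
  have cG := hG.continuous
  exact eq_zero_of_fourier_eq_zero (g := fun s => G (s, x.2)) (by fun_prop)
    (fun s => hG.per1 s x.2) (fun n => hj n x.2) x.1

theorem cov_one_raise (hd : 0 < d) (j : ℤ) (k : ℕ) (x : ℝ × ℝ) :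
    cov (bg d) 1 (raise d k (landau d j)) x = -Complex.I * raise d (k + 1) (landau d j) x -
      Complex.I * (k * (2 * Real.pi * d)) * raise d (k - 1) (landau d j) x := by
  have hs := (isSec_landau hd j).raise (d := d)
  induction k generalizing x with
  | zero => simp [raise_zero, raise_succ, cov_one_landau hd j]
  | succ k ih =>
    have h1 := cov_cov_bg (d := d) (hs k).smooth x
    have h2 : cov (bg d) 1 (raise d k (landau d j)) = fun x =>
        -Complex.I * raise d (k + 1) (landau d j) x +
        -(Complex.I * (k * (2 * Real.pi * d))) * raise d (k - 1) (landau d j) x := by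
      funext x; rw [ih x]; ring
    rw [h2, cov_add ((hs _).const_mul _).smooth ((hs _).const_mul _).smooth,
      cov_const_mul _ (hs _).smooth, cov_const_mul _ (hs _).smooth, ← raise_succ, ← raise_succ,
      ← raise_succ] at h1
    have h3 : (k : ℂ) * raise d (k - 1 + 1) (landau d j) x = k * raise d k (landau d j) x := by
      cases k <;> simp
    rw [Nat.add_sub_cancel]
    push_cast
    linear_combination -h1 - Complex.I * (2 * Real.pi * d) * h3

theorem lap_raise (hd : 0 < d) (j : ℤ) (k : ℕ) :
    lap d (raise d k (landau d j)) = fun x =>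
      ((2 * k + 1) * (2 * Real.pi * d)) * raise d k (landau d j) x +
      (k * (k - 1) * (2 * Real.pi * d) ^ 2) * raise d (k - 2) (landau d j) x := by
  funext x
  have hs := (isSec_landau hd j).raise (d := d)
  have h2 : cov (bg d) 1 (raise d k (landau d j)) = fun x =>
      -Complex.I * raise d (k + 1) (landau d j) x +
      -(Complex.I * (k * (2 * Real.pi * d))) * raise d (k - 1) (landau d j) x := by
    funext x; rw [cov_one_raise hd j k x]; ring
  rw [lap, h2, cov_add ((hs _).const_mul _).smooth ((hs _).const_mul _).smooth,
    cov_const_mul _ (hs _).smooth, cov_const_mul _ (hs _).smooth, ← raise_succ, ← raise_succ,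
    cov_one_raise hd j, cov_one_raise hd j, Nat.add_sub_cancel]
  have h3 : (k : ℂ) * raise d (k - 1 + 1) (landau d j) x = k * raise d k (landau d j) x := by
    cases k <;> simp
  have h4 : (k : ℂ) * ((k - 1 : ℕ) * raise d (k - 1 - 1) (landau d j) x) =
      k * ((k - 1) * raise d (k - 2) (landau d j) x) := by
    cases k with
    | zero => simp
    | succ k => simp
  push_cast
  linear_combination (2 * Real.pi * d) * h3 + (2 * Real.pi * d) ^ 2 * h4 -
    (raise d (k + 1 + 1) (landau d j) x + 2 * Real.pi * d * ((k + 1) * raise d k (landau d j) x +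
      k * raise d (k - 1 + 1) (landau d j) x) +
      (2 * Real.pi * d) ^ 2 * (k * (k - 1 : ℕ) * raise d (k - 1 - 1) (landau d j) x)) * I_sq

/-- The Galerkin system spanned by iterated derivatives of Landau states. -/
def landauSystem (hd : 0 < d) : GalerkinSystem d :=
  GalerkinSystem.ofSpan
    (fun N : ℕ => (fun p : ℕ × ℤ => raise d p.1 (landau d p.2)) '' Set.Icc (0, -(N : ℤ)) (N, (N : ℤ)))
    (fun N => (Set.finite_Icc _ _).image _)
    (fun N u => by rintro ⟨p, -, rfl⟩; exact (isSec_landau hd _).raise _)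
    (fun N u => by
      rintro ⟨⟨k, j⟩, hp, rfl⟩
      dsimp only
      rw [lap_raise hd]
      refine Submodule.add_mem _
        (Submodule.smul_mem _ _ (Submodule.subset_span ⟨(k, j), hp, rfl⟩))
        (Submodule.smul_mem _ _ (Submodule.subset_span ⟨(k - 2, j), ?_, rfl⟩))
      exact ⟨⟨Nat.zero_le _, hp.1.2⟩, (Nat.sub_le _ _).trans hp.2.1, hp.2.2⟩)
    (fun M N h => Set.image_mono (Set.Icc_subset_Icc
      ⟨le_rfl, neg_le_neg (by exact_mod_cast h)⟩ ⟨h, Int.ofNat_le.2 h⟩))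

theorem raise_mem_landauSystem (hd : 0 < d) (k : ℕ) (j : ℤ) :
    raise d k (landau d j) ∈ (landauSystem hd).space (max k j.natAbs) := by
  refine Submodule.subset_span ⟨(k, j), ⟨⟨Nat.zero_le _, ?_⟩, le_max_left _ _, ?_⟩, rfl⟩ <;>
  · simp only [Nat.cast_max]; grind

theorem landau_mem_landauSystem (hd : 0 < d) : landau d 0 ∈ (landauSystem hd).space 0 :=
  raise_mem_landauSystem hd 0 0

theorem nsq_landau_pos (hd : 0 < d) : 0 < nsq (landau d 0) := by
  refine (nsq_nonneg _).lt_of_ne fun h => ?_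
  have h0 := (isSec_landau hd 0).eq_zero_of_nsq h.symm (0, 0)
  have hs := Complex.hasSum_re (hasSum_landau hd 0 (0, 0))
  rw [h0] at hs
  refine (hs.summable.tsum_pos (fun m => ?_) 0 ?_).ne' hs.tsum_eq <;>
  · rw [re_ofReal_mul]; simp [Real.exp_nonneg]

theorem grad2_landau (hd : 0 < d) : grad2 d (landau d 0) = 2 * Real.pi * d * nsq (landau d 0) := by
  have h := grad2_eq (isSec_landau hd 0)
  have e := lap_raise hd 0 0
  simp only [raise_zero, Nat.cast_zero, mul_zero, zero_mul, add_zero, zero_add, one_mul] at e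
  rw [e, ip_const_mul, ip_self (isSec_landau hd 0).continuous] at h
  exact_mod_cast h

end Tower

section Force

variable {d : ℤ} {A : Fin 2 → ℝ × ℝ → ℝ} {φ : ℝ × ℝ → ℂ} {α β : ℝ}

/-- The total Lorentz force of a solution vanishes. -/
theorem sqInt_force (hA : IsConn d A) (hφ : IsSec d φ)
    (h3 : ∀ x, -(cov A 0 (cov A 0 φ) x + cov A 1 (cov A 1 φ) x) =
      (α : ℂ) * φ x - (β : ℂ) * (‖φ x‖ : ℂ) ^ 2 * φ x) (k : Fin 2) :
    (sqInt fun x => (pd 0 (A k) x - pd k (A 0) x) * current A φ 0 x +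
      (pd 1 (A k) x - pd k (A 1) x) * current A φ 1 x) = 0 := by
  have hu : ∀ j, IsSec d (cov A j φ) := fun j => hφ.cov hA j
  have hP : ∀ j, IsPer fun x => ((starRingEnd ℂ) (cov A k φ x) * cov A j φ x).re :=
    fun j => ((hu k).pairing (hu j)).re
  have hQ0 := ((hu 0).norm_sq.add (hu 1).norm_sq).const_mul (1 / 2)
  have hQ1 := hφ.norm_sq.const_mul (α / 2)
  have hQ2 := (hφ.norm_sq.mul hφ.norm_sq).const_mul (β / 4)
  have hQ := (hQ0.sub hQ1).add hQ2
  have e : (fun x => (pd 0 (A k) x - pd k (A 0) x) * current A φ 0 x +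
      (pd 1 (A k) x - pd k (A 1) x) * current A φ 1 x) = fun x =>
      pd 0 (fun x => ((starRingEnd ℂ) (cov A k φ x) * cov A 0 φ x).re) x +
      pd 1 (fun x => ((starRingEnd ℂ) (cov A k φ x) * cov A 1 φ x).re) x -
      pd k (fun x => 1 / 2 * (‖cov A 0 φ x‖ ^ 2 + ‖cov A 1 φ x‖ ^ 2) - α / 2 * ‖φ x‖ ^ 2 +
        β / 4 * (‖φ x‖ ^ 2 * ‖φ x‖ ^ 2)) x := by
    funext x
    rw [pd_add (hQ0.sub hQ1).smooth hQ2.smooth, pd_sub hQ0.smooth hQ1.smooth,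
      pd_const_mul _ ((hu 0).norm_sq.add (hu 1).norm_sq).smooth, pd_const_mul _ hφ.norm_sq.smooth,
      pd_const_mul _ (hφ.norm_sq.mul hφ.norm_sq).smooth,
      pd_add (hu 0).norm_sq.smooth (hu 1).norm_sq.smooth,
      pd_mul hφ.norm_sq.smooth hφ.norm_sq.smooth, pd_norm_sq A (hu 0), pd_norm_sq A (hu 1),
      pd_norm_sq A hφ, pd_re ((hu k).pairing (hu 0)).smooth, pd_re ((hu k).pairing (hu 1)).smooth,
      pd_conj_mul A (hu k).smooth (hu 0).smooth, pd_conj_mul A (hu k).smooth (hu 1).smooth,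
      cov_comm hA.smooth hφ.smooth 0 k x, cov_comm hA.smooth hφ.smooth 1 k x]
    have e1 : (cov A 0 (cov A 0 φ) x + cov A 1 (cov A 1 φ) x) =
      ((β * ‖φ x‖ ^ 2 - α : ℝ) : ℂ) * φ x := by
      push_cast; linear_combination -h3 x
    have er := congrArg re e1
    have ei := congrArg im e1
    rw [re_ofReal_mul, add_re] at er
    rw [im_ofReal_mul, add_im] at ei
    simp only [current, map_add, map_mul, conj_I, conj_ofReal, add_re, mul_re, mul_im, conj_re,
      conj_im, add_im, neg_re, neg_im, I_re, I_im, ofReal_re, ofReal_im]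
    linear_combination -(cov A k φ x).re * er - (cov A k φ x).im * ei
  rw [e, sqInt_sub (((hP 0).pd 0).add ((hP 1).pd 1)).continuous (hQ.pd k).continuous,
    sqInt_add ((hP 0).pd 0).continuous ((hP 1).pd 1).continuous, (hP 0).sqInt_pd, (hP 1).sqInt_pd,
    hQ.sqInt_pd]
  norm_num

theorem pd_current_divergence (hA : IsConn d A) (hφ : IsSec d φ)
    (h3 : ∀ x, -(cov A 0 (cov A 0 φ) x + cov A 1 (cov A 1 φ) x) =
      (α : ℂ) * φ x - (β : ℂ) * (‖φ x‖ : ℂ) ^ 2 * φ x) (x : ℝ × ℝ) :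
    pd 0 (current A φ 0) x + pd 1 (current A φ 1) x = 0 := by
  rw [pd_current hA hφ, pd_current hA hφ]
  have e1 : (cov A 0 (cov A 0 φ) x + cov A 1 (cov A 1 φ) x) =
      ((β * ‖φ x‖ ^ 2 - α : ℝ) : ℂ) * φ x := by
    push_cast; linear_combination -h3 x
  have er := congrArg re e1
  have ei := congrArg im e1
  rw [re_ofReal_mul, add_re] at er
  rw [im_ofReal_mul, add_im] at ei
  simp only [mul_im, conj_re, conj_im]
  linear_combination (φ x).re * ei - (φ x).im * er

theorem IsPer.pd_eq_zero_of_laplace {g : ℝ × ℝ → ℝ} (hg : IsPer g)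
    (h : ∀ x, GinzburgLandau.pd 0 (GinzburgLandau.pd 0 g) x +
      GinzburgLandau.pd 1 (GinzburgLandau.pd 1 g) x = 0) (j : Fin 2) (x : ℝ × ℝ) :
    GinzburgLandau.pd j g x = 0 := by
  have hk : ∀ k, IsPer fun x => GinzburgLandau.pd k g x * GinzburgLandau.pd k g x :=
    fun k => (hg.pd k).mul (hg.pd k)
  have hs : (sqInt fun x => GinzburgLandau.pd 0 g x * GinzburgLandau.pd 0 g x +
      GinzburgLandau.pd 1 g x * GinzburgLandau.pd 1 g x) = 0 := by
    have c := hg.continuous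
    have c0 := ((hg.pd 0).pd 0).continuous
    have c1 := ((hg.pd 1).pd 1).continuous
    have e0 := hg.sqInt_mul_pd (hg.pd 0) 0
    have e1 := hg.sqInt_mul_pd (hg.pd 1) 1
    have := sqInt_add (f := fun x => g x * GinzburgLandau.pd 0 (GinzburgLandau.pd 0 g) x)
      (g := fun x => g x * GinzburgLandau.pd 1 (GinzburgLandau.pd 1 g) x) (by fun_prop) (by fun_prop)
    simp only [← mul_add, h, mul_zero, sqInt_const] at this
    rw [sqInt_add (hk 0).continuous (hk 1).continuous]
    linarith
  have := ((hk 0).add (hk 1)).eq_zero_of_sqInt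
    (fun x => add_nonneg (mul_self_nonneg _) (mul_self_nonneg _)) hs x
  have h0 := mul_self_nonneg (GinzburgLandau.pd 0 g x)
  have h1 := mul_self_nonneg (GinzburgLandau.pd 1 g x)
  fin_cases j
  · exact mul_self_eq_zero.1 (by simp only [Fin.zero_eta]; linarith)
  · exact mul_self_eq_zero.1 (by simp only [Fin.mk_one]; linarith)

end Force

section Existence

variable {d : ℤ} {α β : ℝ}

theorem curvature_conn (d : ℤ) {b : ℝ × ℝ → ℂ} (hb : IsSec 0 b) (x : ℝ × ℝ) :
    curvature (conn d b) x = 2 * Real.pi * d +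
      (pd 0 (fun x => (b x).im) x - pd 1 (fun x => (b x).re) x) := by
  have e : ∀ i j, pd i (conn d b j) x = pd i (bg d j) x + pd i (coef b j) x := fun i j =>
    pd_add ((isConn_bg d).smooth j) (isPer_coef hb j).smooth i x
  have e0 : coef b 0 = fun x => (b x).re := rfl
  have e1 : coef b 1 = fun x => (b x).im := rfl
  rw [curvature, e, e, pd_bg, pd_bg, e0, e1]
  simp [dir]; ring

/-- A gauge-fixed solution up to a constant current is a solution. -/
theorem solution_of_gauge_fixed (hd : d ≠ 0) {b φ : ℝ × ℝ → ℂ} (hb : IsSec 0 b) (hφ : IsSec d φ)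
    (h3 : ∀ x, -(cov (conn d b) 0 (cov (conn d b) 0 φ) x + cov (conn d b) 1 (cov (conn d b) 1 φ) x) =
      (α : ℂ) * φ x - (β : ℂ) * (‖φ x‖ : ℂ) ^ 2 * φ x) {κ : ℂ}
    (hκ : ∀ x, lap 0 b x + currentC (conn d b) φ x = κ) :
    (∀ x, pd 1 (curvature (conn d b)) x + current (conn d b) φ 0 x = 0) ∧
      ∀ x, -pd 0 (curvature (conn d b)) x + current (conn d b) φ 1 x = 0 := by
  have hA := isConn_conn d hb
  have hF := hA.isPer_curvature
  set p : ℝ × ℝ → ℝ := fun x => (b x).re with hp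
  set q : ℝ × ℝ → ℝ := fun x => (b x).im with hq
  have sp : IsPer p := hb.re
  have sq : IsPer q := hb.im
  have eF : curvature (conn d b) = fun x => 2 * Real.pi * d + (pd 0 q x - pd 1 p x) := by
    funext x; exact curvature_conn d hb x
  have dF : ∀ i x, pd i (curvature (conn d b)) x = pd i (pd 0 q) x - pd i (pd 1 p) x := fun i x => by
    rw [eF, pd_add contDiff_const ((sq.pd 0).sub (sp.pd 1)).smooth, pd_const,
      pd_sub (sq.pd 0).smooth (sp.pd 1).smooth, zero_add]
  have hc : ∀ j (u : ℝ × ℝ → ℂ), cov (bg 0) j u = pd j u := fun j u => by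
    funext x; simp [cov, bg]
  have hre : ∀ i j x, (pd i (pd j b) x).re = pd i (pd j p) x := fun i j x => by
    rw [← pd_re (smooth_pd hb.smooth j)]
    congr 1; funext y; exact (pd_re hb.smooth j y).symm
  have him : ∀ i j x, (pd i (pd j b) x).im = pd i (pd j q) x := fun i j x => by
    rw [← pd_im (smooth_pd hb.smooth j)]
    congr 1; funext y; exact (pd_im hb.smooth j y).symm
  have k0 : ∀ x, -(pd 0 (pd 0 p) x + pd 1 (pd 1 p) x) + current (conn d b) φ 0 x = κ.re := fun x => by
    have := congrArg re (hκ x)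
    simpa [lap, hc, currentC, hre] using this
  have k1 : ∀ x, -(pd 0 (pd 0 q) x + pd 1 (pd 1 q) x) + current (conn d b) φ 1 x = κ.im := fun x => by
    have := congrArg im (hκ x)
    simpa [lap, hc, currentC, him] using this
  set δ : ℝ × ℝ → ℝ := fun x => pd 0 p x + pd 1 q x with hδ
  have sδ : IsPer δ := (sp.pd 0).add (sq.pd 1)
  have dδ : ∀ i x, pd i δ x = pd i (pd 0 p) x + pd i (pd 1 q) x := fun i x =>
    pd_add (sp.pd 0).smooth (sq.pd 1).smooth i x
  have m0 : ∀ x, pd 1 (curvature (conn d b)) x + current (conn d b) φ 0 x = κ.re + pd 0 δ x := fun x => by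
    rw [dF, dδ, ← k0, pd_comm sq.smooth 1 0]; ring
  have m1 : ∀ x, -pd 0 (curvature (conn d b)) x + current (conn d b) φ 1 x = κ.im + pd 1 δ x := fun x => by
    rw [dF, dδ, ← k1, pd_comm sp.smooth 1 0]; ring
  have hlap : ∀ x, pd 0 (pd 0 δ) x + pd 1 (pd 1 δ) x = 0 := fun x => by
    have e0 : pd 0 δ = fun x => (pd 1 (curvature (conn d b)) x + current (conn d b) φ 0 x) - κ.re := by
      funext x; rw [m0]; ring
    have e1 : pd 1 δ = fun x => (current (conn d b) φ 1 x - pd 0 (curvature (conn d b)) x) - κ.im := by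
      funext x; linear_combination -m1 x
    have J := fun j => (isPer_current hA hφ j).smooth
    rw [e0, e1, pd_sub ((hF.pd 1).smooth.add (J 0)) contDiff_const,
      pd_sub ((J 1).sub (hF.pd 0).smooth) contDiff_const, pd_add (hF.pd 1).smooth (J 0),
      pd_sub (J 1) (hF.pd 0).smooth, pd_const, pd_const, pd_comm hF.smooth 1 0]
    linear_combination pd_current_divergence hA hφ h3 x
  have hδ0 := sδ.pd_eq_zero_of_laplace hlap
  have hself : ∀ j, (sqInt fun x => curvature (conn d b) x * pd j (curvature (conn d b)) x) = 0 :=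
    fun j => by
      have := hF.sqInt_mul_pd hF j
      simp only [mul_comm (pd j (curvature (conn d b)) _)] at this
      linarith
  have cF := hF.continuous
  have c0 := (hF.pd 0).continuous
  have c1 := (hF.pd 1).continuous
  have hd' : 2 * Real.pi * (d : ℝ) ≠ 0 := mul_ne_zero (by positivity) (by exact_mod_cast hd)
  have r0 : κ.re = 0 := by
    have h := sqInt_force hA hφ h3 1
    have e : (fun x => (pd 0 (conn d b 1) x - pd 1 (conn d b 0) x) * current (conn d b) φ 0 x +
        (pd 1 (conn d b 1) x - pd 1 (conn d b 1) x) * current (conn d b) φ 1 x) = fun x =>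
        κ.re * curvature (conn d b) x - curvature (conn d b) x * pd 1 (curvature (conn d b)) x := by
      funext x
      have := m0 x
      rw [hδ0] at this
      rw [← curvature]
      linear_combination curvature (conn d b) x * this
    rw [e, sqInt_sub (by fun_prop) (by fun_prop), sqInt_const_mul, hself, hA.sqInt_curvature,
      sub_zero] at h
    exact (mul_eq_zero.1 h).resolve_right hd'
  have r1 : κ.im = 0 := by
    have h := sqInt_force hA hφ h3 0
    have e : (fun x => (pd 0 (conn d b 0) x - pd 0 (conn d b 0) x) * current (conn d b) φ 0 x +
        (pd 1 (conn d b 0) x - pd 0 (conn d b 1) x) * current (conn d b) φ 1 x) = fun x =>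
        (-κ.im) * curvature (conn d b) x - curvature (conn d b) x * pd 0 (curvature (conn d b)) x := by
      funext x
      have := m1 x
      rw [hδ0] at this
      have e2 : pd 1 (conn d b 0) x - pd 0 (conn d b 1) x = -curvature (conn d b) x := by
        rw [curvature]; ring
      rw [e2]
      linear_combination -curvature (conn d b) x * this
    rw [e, sqInt_sub (by fun_prop) (by fun_prop), sqInt_const_mul, hself, hA.sqInt_curvature,
      sub_zero] at h
    exact neg_eq_zero.1 ((mul_eq_zero.1 h).resolve_right hd')
  exact ⟨fun x => by rw [m0, hδ0, r0, add_zero], fun x => by rw [m1, hδ0, r1, add_zero]⟩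

theorem exists_solution_of_pos (hα : 0 < α) (hβ : 0 < β) (hd : 0 < d) (h : 2 * Real.pi * d < α) :
    ∃ A φ, IsConn d A ∧ IsSec d φ ∧ 0 < nsq φ ∧
      (∀ x, pd 1 (curvature A) x + current A φ 0 x = 0) ∧
      (∀ x, -pd 0 (curvature A) x + current A φ 1 x = 0) ∧
      ∀ x, -(cov A 0 (cov A 0 φ) x + cov A 1 (cov A 1 φ) x) =
        (α : ℂ) * φ x - (β : ℂ) * (‖φ x‖ : ℂ) ^ 2 * φ x := by
  have hg : grad2 d (landau d 0) < α * nsq (landau d 0) := by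
    rw [grad2_landau hd]
    exact mul_lt_mul_of_pos_right h (nsq_landau_pos hd)
  obtain ⟨B, φ, K, e, hs, he, hφ⟩ := exists_galerkinSequence hα hβ modeSystem (landauSystem hd)
    sqInt_modeSystem (landau_mem_landauSystem hd) hg
  obtain ⟨b, f, hb, hf, hpos, hV, hW⟩ := hs.exists_weak_solution he hφ
  have hA := isConn_conn d hb
  have h3 : ∀ x, glOp α β (conn d b) f x = 0 :=
    (isSec_glOp hA hf).eq_zero_of_ip_landau hd fun k j => hV _ _ (raise_mem_landauSystem hd k j)
  have h3' : ∀ x, -(cov (conn d b) 0 (cov (conn d b) 0 f) x + cov (conn d b) 1 (cov (conn d b) 1 f) x) =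
      (α : ℂ) * f x - (β : ℂ) * (‖f x‖ : ℂ) ^ 2 * f x := fun x => by
    have := h3 x
    simp only [glOp] at this
    push_cast at this
    linear_combination this
  have hκ := (hb.lap.add (isSec_currentC hA hf)).eq_mean fun k hk => by
    obtain ⟨N, hN⟩ := mode_mem_modeSystem hk
    exact hW N _ hN
  obtain ⟨h1, h2⟩ := solution_of_gauge_fixed hd.ne' hb hf h3' hκ
  exact ⟨conn d b, f, hA, hf, hpos, h1, h2, h3'⟩

end Existence

/-! ### Arbitrary degrees -/

section AllDegrees

variable {d : ℤ} {α β : ℝ}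

theorem IsConn.neg {A : Fin 2 → ℝ × ℝ → ℝ} (hA : IsConn (-d) A) :
    IsConn d (fun j x => -A j x) where
  smooth j := (hA.smooth j).neg
  per1 j s t := by rw [hA.per1]
  per2 j s t := by rw [hA.per2]; push_cast; ring

theorem cov_neg_conj (A : Fin 2 → ℝ × ℝ → ℝ) {u : ℝ × ℝ → ℂ} (hu : ContDiff ℝ smoothOrder u)
    (j : Fin 2) :
    cov (fun j x => -A j x) j (fun y => (starRingEnd ℂ) (u y)) =
      fun x => (starRingEnd ℂ) (cov A j u x) := by
  funext x
  simp only [cov, pd_conj hu]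
  simp

theorem exists_solution (hα : 0 < α) (hβ : 0 < β) (h : 2 * Real.pi * |(d : ℝ)| < α) :
    ∃ A φ, IsConn d A ∧ IsSec d φ ∧ (∃ x, φ x ≠ 0) ∧
      (∀ x, pd 1 (curvature A) x + current A φ 0 x = 0) ∧
      (∀ x, -pd 0 (curvature A) x + current A φ 1 x = 0) ∧
      ∀ x, -(cov A 0 (cov A 0 φ) x + cov A 1 (cov A 1 φ) x) =
        (α : ℂ) * φ x - (β : ℂ) * (‖φ x‖ : ℂ) ^ 2 * φ x := by
  have hne : ∀ φ : ℝ × ℝ → ℂ, 0 < nsq φ → ∃ x, φ x ≠ 0 := fun φ hφ => by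
    by_contra! h0
    simp [nsq, h0, sqInt_const] at hφ
  rcases lt_trichotomy d 0 with hd | rfl | hd
  · have h' : 2 * Real.pi * ((-d : ℤ) : ℝ) < α := by
      rwa [abs_of_neg (by exact_mod_cast hd), ← Int.cast_neg] at h
    obtain ⟨A, φ, hA, hφ, hpos, h1, h2, h3⟩ := exists_solution_of_pos hα hβ (neg_pos.mpr hd) h'
    have hcov := fun j => cov_neg_conj A hφ.smooth j
    have hcurv : curvature (fun j x => -A j x) = fun x => -curvature A x := by
      funext x; simp only [curvature, pd_neg]; ring
    have hcur : ∀ j x, current (fun j x => -A j x) (fun x => (starRingEnd ℂ) (φ x)) j x =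
        -current A φ j x := fun j x => by
      rw [current, hcov, ← map_mul, conj_im]; rfl
    refine ⟨fun j x => -A j x, fun x => (starRingEnd ℂ) (φ x), hA.neg, hφ.conj (neg_neg d), ?_,
      fun x => ?_, fun x => ?_, fun x => ?_⟩
    · simpa using hne φ hpos
    · rw [hcurv, hcur, pd_neg]; linear_combination -h1 x
    · rw [hcurv, hcur, pd_neg]; linear_combination -h2 x
    · rw [hcov, hcov, cov_neg_conj A (hφ.cov hA 0).smooth, cov_neg_conj A (hφ.cov hA 1).smooth]
      simpa using congrArg (starRingEnd ℂ) (h3 x)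
  · have hc : ∀ j, cov (bg 0) j (fun _ => ((√(α / β) : ℝ) : ℂ)) = fun _ => 0 := fun j => by
      funext x; simp [cov, bg, pd_const]
    have hc0 : ∀ j, cov (bg 0) j (fun _ => (0 : ℂ)) = fun _ => 0 := fun j => by
      funext x; simp [cov, bg, pd_const]
    have hpos : 0 < √(α / β) := Real.sqrt_pos.mpr (div_pos hα hβ)
    have hcurv : curvature (bg 0) = fun _ => 0 := by
      funext x; simp [curvature, pd_bg]
    refine ⟨bg 0, fun _ => ((√(α / β) : ℝ) : ℂ), isConn_bg 0, isSec_const _,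
      ⟨0, ofReal_ne_zero.mpr hpos.ne'⟩, fun x => ?_, fun x => ?_, fun x => ?_⟩
    · simp [hcurv, current, hc, pd_const]
    · simp [hcurv, current, hc, pd_const]
    · rw [hc, hc, hc0, hc0, norm_real, Real.norm_of_nonneg hpos.le, ← ofReal_pow,
        Real.sq_sqrt (div_pos hα hβ).le]
      have : (β : ℂ) ≠ 0 := by exact_mod_cast hβ.ne'
      push_cast
      field_simp
      ring
  · rw [abs_of_pos (by exact_mod_cast hd)] at h
    obtain ⟨A, φ, hA, hφ, hpos, h⟩ := exists_solution_of_pos hα hβ hd h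
    exact ⟨A, φ, hA, hφ, hne φ hpos, h⟩

/-- Above the threshold some section has Dirichlet quotient below `α`. -/
theorem exists_grad2_lt (h : 2 * Real.pi * |(d : ℝ)| < α) :
    ∃ θ, IsSec d θ ∧ grad2 d θ < α * nsq θ := by
  rcases lt_trichotomy d 0 with hd | rfl | hd
  · have hd' : 0 < -d := neg_pos.mpr hd
    rw [abs_of_neg (by exact_mod_cast hd), ← Int.cast_neg] at h
    have hθ := isSec_landau hd' 0
    refine ⟨fun x => (starRingEnd ℂ) (landau (-d) 0 x), hθ.conj (neg_neg d), ?_⟩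
    have e : ∀ j, cov (bg d) j (fun x => (starRingEnd ℂ) (landau (-d) 0 x)) =
        fun x => (starRingEnd ℂ) (cov (bg (-d)) j (landau (-d) 0) x) := fun j =>
      funext (cov_bg_conj (neg_neg d) hθ.smooth j)
    rw [grad2, e, e, nsq_conj, nsq_conj, nsq_conj, ← grad2, grad2_landau hd']
    exact mul_lt_mul_of_pos_right h (nsq_landau_pos hd')
  · have e : ∀ j, cov (bg 0) j (fun _ => (1 : ℂ)) = fun _ => 0 := fun j => by
      funext x; simp [cov, bg, pd_const]
    refine ⟨fun _ => 1, isSec_const 1, ?_⟩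
    simp only [grad2, e, nsq, norm_zero, norm_one, sqInt_const]
    simpa using h
  · rw [abs_of_pos (by exact_mod_cast hd)] at h
    refine ⟨landau d 0, isSec_landau hd 0, ?_⟩
    rw [grad2_landau hd]
    exact mul_lt_mul_of_pos_right h (nsq_landau_pos hd)

end AllDegrees

/-! ### Field pairs -/

section FieldPairs

variable {d : ℤ} {α β : ℝ}

/-- The connection of a field pair. -/
def fieldConn (P : FieldPair d) (j : Fin 2) : ℝ × ℝ → ℝ := if j = 0 then P.a1 else P.a2

theorem isConn_fieldConn (P : FieldPair d) : IsConn d (fieldConn P) where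
  smooth j := by fin_cases j <;> [exact P.smooth_a1; exact P.smooth_a2]
  per1 j s t := by fin_cases j <;> [exact P.per1_a1 (s, t); exact P.per1_a2 (s, t)]
  per2 j s t := by
    fin_cases j
    · simpa [fieldConn, dir] using P.per2_a1 (s, t)
    · simpa [fieldConn, dir] using P.per2_a2 (s, t)

theorem isSec_field (P : FieldPair d) : IsSec d P.φ where
  smooth := P.smooth_φ
  per1 s t := P.per1_φ (s, t)
  per2 s t := P.per2_φ (s, t)

/-- The field pair formed by a connection and a section. -/
def fieldPair {A : Fin 2 → ℝ × ℝ → ℝ} {φ : ℝ × ℝ → ℂ} (hA : IsConn d A) (hφ : IsSec d φ) :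
    FieldPair d where
  a1 := A 0
  a2 := A 1
  φ := φ
  smooth_a1 := hA.smooth 0
  smooth_a2 := hA.smooth 1
  smooth_φ := hφ.smooth
  per1_a1 x := hA.per1 0 x.1 x.2
  per1_a2 x := hA.per1 1 x.1 x.2
  per1_φ x := hφ.per1 x.1 x.2
  per2_a2 x := by simpa [dir] using hA.per2 1 x.1 x.2
  per2_a1 x := by simpa [dir] using hA.per2 0 x.1 x.2
  per2_φ x := hφ.per2 x.1 x.2

theorem fieldConn_fieldPair {A : Fin 2 → ℝ × ℝ → ℝ} {φ : ℝ × ℝ → ℂ} (hA : IsConn d A)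
    (hφ : IsSec d φ) : fieldConn (fieldPair hA hφ) = A := by
  funext j; fin_cases j <;> rfl

theorem D1_eq (P : FieldPair d) (u : ℝ × ℝ → ℂ) : D1 P.a1 u = cov (fieldConn P) 0 u := by
  funext x; rw [D1, pd1_eq]; rfl

theorem D2_eq (P : FieldPair d) (u : ℝ × ℝ → ℂ) : D2 P.a2 u = cov (fieldConn P) 1 u := by
  funext x; rw [D2, pd2_eq]; rfl

theorem curv_eq (P : FieldPair d) : curv P.a1 P.a2 = curvature (fieldConn P) := by
  funext x; rw [curv, pd1_eq, pd2_eq]; rfl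

theorem isGLSolution_const_iff (c : ℝ) (P : FieldPair d) :
    IsGLSolution α β (fun _ => c) P ↔
      (∀ x, pd 1 (curvature (fieldConn P)) x + current (fieldConn P) P.φ 0 x = 0) ∧
      (∀ x, -pd 0 (curvature (fieldConn P)) x + current (fieldConn P) P.φ 1 x = 0) ∧
      ∀ x, -(cov (fieldConn P) 0 (cov (fieldConn P) 0 P.φ) x +
          cov (fieldConn P) 1 (cov (fieldConn P) 1 P.φ) x) =
        (α : ℂ) * P.φ x - (β : ℂ) * (‖P.φ x‖ : ℂ) ^ 2 * P.φ x := by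
  have e : ∀ j x, pd j (fun y => curvature (fieldConn P) y - c) x =
      pd j (curvature (fieldConn P)) x := fun j x => by
    rw [pd_sub (isConn_fieldConn P).isPer_curvature.smooth contDiff_const, pd_const, sub_zero]
  simp only [IsGLSolution, curv_eq, D1_eq, D2_eq, pd1_eq, pd2_eq, e, current]

/-- The energy density of a field pair is continuous. -/
theorem continuous_energyDensity (c : ℝ) (P : FieldPair d) : Continuous fun x =>
    (curv P.a1 P.a2 x - c) ^ 2 + ‖D1 P.a1 P.φ x‖ ^ 2 + ‖D2 P.a2 P.φ x‖ ^ 2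
      - α * ‖P.φ x‖ ^ 2 + (β / 2) * ‖P.φ x‖ ^ 4 := by
  have h0 := (isConn_fieldConn P).isPer_curvature.smooth.continuous
  have h1 := ((isSec_field P).cov (isConn_fieldConn P) 0).continuous
  have h2 := ((isSec_field P).cov (isConn_fieldConn P) 1).continuous
  have h3 := P.smooth_φ.continuous
  rw [curv_eq, D1_eq, D2_eq]
  fun_prop

theorem bddBelow_energySet (hβ : 0 < β) (c : ℝ) :
    BddBelow (energySet α β (fun _ => c) d) := by
  refine ⟨1 / 2 * (-(α ^ 2 / (2 * β))), ?_⟩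
  rintro _ ⟨P, rfl⟩
  refine mul_le_mul_of_nonneg_left ?_ (by norm_num)
  rw [← sqInt_const (-(α ^ 2 / (2 * β)))]
  refine sqInt_mono continuous_const (continuous_energyDensity c P) fun x => ?_
  have h : 0 ≤ β / 2 * (‖P.φ x‖ ^ 2 - α / β) ^ 2 := by positivity
  have e : β / 2 * (‖P.φ x‖ ^ 2 - α / β) ^ 2 =
      β / 2 * ‖P.φ x‖ ^ 4 - α * ‖P.φ x‖ ^ 2 + α ^ 2 / (2 * β) := by
    field_simp; ring
  nlinarith [sq_nonneg (curv P.a1 P.a2 x - c), sq_nonneg ‖D1 P.a1 P.φ x‖,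
    sq_nonneg ‖D2 P.a2 P.φ x‖]

theorem energy_nonneg_of_reducible {F₀ : ℝ × ℝ → ℝ} {P : FieldPair d} (h : ∀ x, P.φ x = 0) :
    0 ≤ energy α β F₀ P :=
  mul_nonneg (by norm_num) (integral_nonneg fun x => by simp [h x]; positivity)

theorem exists_energy_neg (hβ : 0 < β) (h : 2 * Real.pi * |(d : ℝ)| < α) :
    ∃ P : FieldPair d, energy α β (fun _ => 2 * Real.pi * d) P < 0 := by
  obtain ⟨θ, hθ, hg⟩ := exists_grad2_lt h
  obtain ⟨s, hs⟩ := exists_negative_energy hβ hθ hg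
  refine ⟨fieldPair (isConn_bg d) (hθ.const_mul s), ?_⟩
  have hcurv : ∀ x, curvature (bg d) x = 2 * Real.pi * d := fun x => by
    simp [curvature, pd_bg, dir]
  refine mul_neg_of_pos_of_neg (by norm_num) (lt_of_eq_of_lt ?_ hs)
  refine congrArg sqInt (funext fun x => ?_)
  have h0 : ∀ j, cov (bg 0) j (fun _ => (0 : ℂ)) x = 0 := fun j => by
    simp [cov, pd_const]
  rw [curv_eq, D1_eq, D2_eq, fieldConn_fieldPair, hcurv, density, conn_zero, h0, h0]
  simp [fieldPair]

end FieldPairs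

end GinzburgLandau

open GinzburgLandau

/-- Type-II case: for `β > 1/2` and constant `F₀`, irreducible degree-`d`
GL solutions exist iff `α > 2π|d|`, and then every energy minimizer is irreducible. -/
theorem statement5 (α β : ℝ) (hα : 0 < α) (hβ : 0 < β) (hβ2 : β > 1 / 2) (d : ℤ)
    (F₀ : ℝ × ℝ → ℝ) (hF₀ : ExternalField d F₀)
    (hconst : ∃ c : ℝ, ∀ x : ℝ × ℝ, F₀ x = c) :
    ((∃ P : FieldPair d, IsGLSolution α β F₀ P ∧ ∃ x : ℝ × ℝ, P.φ x ≠ 0) ↔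
      α > 2 * Real.pi * |(d : ℝ)|) ∧
    (α > 2 * Real.pi * |(d : ℝ)| →
      ∀ P : FieldPair d, energy α β F₀ P = sInf (energySet α β F₀ d) →
        ∃ x : ℝ × ℝ, P.φ x ≠ 0) := by
  obtain ⟨c, hc⟩ := hconst
  obtain rfl : F₀ = fun _ => c := funext hc
  obtain rfl : c = 2 * Real.pi * d := (sqInt_const c).symm.trans hF₀.2.2.2
  refine ⟨⟨?_, fun h => ?_⟩, fun h P hP => ?_⟩
  · rintro ⟨P, hP, hne⟩
    obtain ⟨h1, h2, h3⟩ := (isGLSolution_const_iff _ P).mp hP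
    exact critical_lt_of_solution hβ2.le (isConn_fieldConn P) (isSec_field P) h1 h2 h3 hne
  · obtain ⟨A, φ, hA, hφ, hne, hsol⟩ := exists_solution hα hβ h
    refine ⟨fieldPair hA hφ, (isGLSolution_const_iff _ _).mpr ?_, hne⟩
    rw [fieldConn_fieldPair]
    exact hsol
  · by_contra! h0
    obtain ⟨Q, hQ⟩ := exists_energy_neg hβ h
    have h1 := csInf_le (bddBelow_energySet (α := α) (d := d) hβ (2 * Real.pi * d)) ⟨Q, rfl⟩
    have h2 := energy_nonneg_of_reducible (α := α) (β := β) (F₀ := fun _ => 2 * Real.pi * d) h0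
    linarith
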